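/- Let F be a field of characteristic p > 0, let E = F(b_1^{1/p^{m_1}},…,b_r^{1/p^{m_r}}) be a purely inseparable extension of F with b_1,…,b_r ∈ F^* and integers m_1,…,m_r ≥ 1. Then H_p^{n+1}(E/F) = K_F((b_1,m_1),…,(b_r,m_r)). -/

import Mathlib

noncomputable section

/-- The full algebra of absolute differential forms of a field `F`:
the exterior algebra of the `F`-module of absolute Kähler differentials `Ω[F⁄ℤ]`. -/
abbrev DF (F : Type*) [Field F] : Type _ :=
  ExteriorAlgebra F (KaehlerDifferential ℤ F)

/-- `Ω_F^n`, the space of differential `n`-forms, as a submodule of `DF F`. -/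
def omegaPow (F : Type*) [Field F] (n : ℕ) : Submodule F (DF F) :=
  LinearMap.range (ExteriorAlgebra.ι F :
    KaehlerDifferential ℤ F →ₗ[F] DF F) ^ n

/-- `Ω_F^{n-1}`, with the convention `Ω_F^{-1} = 0`. -/
def omegaPred (F : Type*) [Field F] : ℕ → Submodule F (DF F)
  | 0 => ⊥
  | n + 1 => omegaPow F n

/-- The exact 1-form `d a` of an element `a ∈ F`. -/
def dForm (F : Type*) [Field F] (a : F) : DF F :=
  ExteriorAlgebra.ι F (KaehlerDifferential.D ℤ F a)

/-- The logarithmic 1-form `da/a` of an element `a ∈ F`. -/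
def dLog (F : Type*) [Field F] (a : F) : DF F :=
  ExteriorAlgebra.ι F (a⁻¹ • KaehlerDifferential.D ℤ F a)

/-- The logarithmic `n`-form `(dx₁/x₁) ∧ … ∧ (dxₙ/xₙ)`. -/
def logForm (F : Type*) [Field F] {n : ℕ} (x : Fin n → F) : DF F :=
  (List.ofFn fun i => dLog F (x i)).prod

/-- The exterior derivative `d` together with the (`p`-basis dependent) additive map `s_p`
on the differential forms of a field `F` of characteristic `p`. -/
structure DiffStr (p : ℕ) (F : Type*) [Field F] where
  d : DF F →+ DF F
  sp : DF F →+ DF F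
  d_grade : ∀ n : ℕ, ∀ ω ∈ omegaPow F n, d ω ∈ omegaPow F (n + 1)
  d_d : ∀ ω : DF F, d (d ω) = 0
  d_one : d 1 = 0
  d_smul : ∀ (a : F) (ω : DF F), d (a • ω) = dForm F a * ω + a • d ω
  sp_grade : ∀ n : ℕ, ∀ ω ∈ omegaPow F n, sp ω ∈ omegaPow F n
  sp_log : ∀ (n : ℕ) (a : F) (x : Fin n → F),
      ∃ η ∈ omegaPred F n, sp (a • logForm F x) = a ^ p • logForm F x + d η

/-- The Artin–Schreier map `℘ = s_p − id` on differential forms. -/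
def asMap {p : ℕ} {F : Type*} [Field F] (S : DiffStr p F) : DF F →+ DF F :=
  S.sp - AddMonoidHom.id (DF F)

/-- The subgroup `℘Ω_F^n + dΩ_F^{n-1}` of `Ω_F^n`; the group `H_p^{n+1}(F)` is the quotient
of `Ω_F^n` by this subgroup. -/
def hRel {p : ℕ} {F : Type*} [Field F] (S : DiffStr p F) (n : ℕ) : AddSubgroup (DF F) :=
  ((omegaPow F n).toAddSubgroup.map (asMap S)) ⊔ ((omegaPred F n).toAddSubgroup.map S.d)

/-- The `t`-th iterate `v ↦ v^{[p^t]}` of the map `s_p`. -/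
def spIter {p : ℕ} {F : Type*} [Field F] (S : DiffStr p F) (t : ℕ) : DF F → DF F :=
  (fun x => S.sp x)^[t]

/-- `ν_n(F) = ker(℘ : Ω_F^n → Ω_F^n/dΩ_F^{n-1})`. -/
def nuSet {p : ℕ} {F : Type*} [Field F] (S : DiffStr p F) (n : ℕ) : Set (DF F) :=
  { η | η ∈ omegaPow F n ∧ ∃ z ∈ omegaPred F n, S.sp η - η = S.d z }

/-- Restriction of differential forms along a field extension `E/F`. -/
structure DiffRes (p : ℕ) (F E : Type*) [Field F] [Field E] [Algebra F E]
    (SF : DiffStr p F) (SE : DiffStr p E) where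
  res : DF F →+ DF E
  res_one : res 1 = 1
  res_mul : ∀ x y : DF F, res (x * y) = res x * res y
  res_smul : ∀ (a : F) (ω : DF F), res (a • ω) = algebraMap F E a • res ω
  res_dForm : ∀ a : F, res (dForm F a) = dForm E (algebraMap F E a)
  res_grade : ∀ n : ℕ, ∀ ω ∈ omegaPow F n, res ω ∈ omegaPow E n
  res_d : ∀ ω : DF F, res (SF.d ω) = SE.d (res ω)

/-- The generators of the group `K_F((b₁,m₁),…,(b_r,m_r)) ⊆ H_p^{n+1}(F)`:
(i) the forms `bᵢ·dz` with `z ∈ Ω_F^{n-1}`, and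
(ii) the forms `b₁^{k(t,1)}⋯b_r^{k(t,r)}·(dv)^{[p^t]}` with `v ∈ Ω_F^{n-1}`,
`t = 1,…,max(m)−1`, `0 ≤ k(t,i) < p^t` and `max{1, p^{t−mᵢ+1}} ∣ k(t,i)`. -/
def kGens {p : ℕ} {F : Type*} [Field F] (S : DiffStr p F) {r : ℕ}
    (b : Fin r → F) (m : Fin r → ℕ) (n : ℕ) : Set (DF F) :=
  { x | ∃ i : Fin r, ∃ z ∈ omegaPred F n, x = b i • S.d z } ∪
  { x | ∃ (t : ℕ) (k : Fin r → ℕ), 0 < t ∧ t < Finset.univ.sup m ∧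
      (∀ i, k i < p ^ t ∧ p ^ (t + 1 - m i) ∣ k i) ∧
      ∃ v ∈ omegaPred F n, x = (∏ i, b i ^ k i) • spIter S t (S.d v) }

/-- The preimage in `Ω_F^n` of the subgroup `K_F((b₁,m₁),…,(b_r,m_r))` of `H_p^{n+1}(F)`:
the subgroup generated by `℘Ω_F^n + dΩ_F^{n-1}` together with the generators above.
Two subgroups of `H_p^{n+1}(F)` agree iff their preimages agree. -/
def kGroup {p : ℕ} {F : Type*} [Field F] (S : DiffStr p F) {r : ℕ}
    (b : Fin r → F) (m : Fin r → ℕ) (n : ℕ) : AddSubgroup (DF F) :=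
  AddSubgroup.closure ((hRel S n : Set (DF F)) ∪ kGens S b m n)

section Part1
set_option linter.all false
open Finset Polynomial

/-! ### Part 1: characteristic `p` operator identities -/

theorem choose_pred_char {R : Type*} [Ring R] (p : ℕ) (hp : p.Prime) [CharP R p] (i : ℕ)
    (hi : i ≤ p - 1) : (((p - 1).choose i : ℕ) : R) = (-1) ^ i := by
  induction i with
  | zero => simp
  | succ i ih =>
    have h1 : (p - 1).choose i + (p - 1).choose (i + 1) = p.choose (i + 1) := by
      obtain ⟨q, rfl⟩ : ∃ q, p = q + 1 := ⟨p - 1, by have := hp.pos; omega⟩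
      simp [Nat.choose_succ_succ]
    have h2 : ((p.choose (i + 1) : ℕ) : R) = 0 := by
      rw [CharP.cast_eq_zero_iff R p]
      exact hp.dvd_choose_self (by omega) (by omega)
    rw [← h1, Nat.cast_add, ih (by omega)] at h2
    rw [pow_succ]
    have := eq_neg_of_add_eq_zero_right h2
    rw [this]; simp

theorem commute_sub_pow_pred {R : Type*} [Ring R] (p : ℕ) (hp : p.Prime) [CharP R p]
    (x y : R) (h : Commute x y) :
    (x - y) ^ (p - 1) = ∑ i ∈ range p, x ^ i * y ^ (p - 1 - i) := by
  have hc : Commute x (-y) := h.neg_right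
  rw [sub_eq_add_neg, hc.add_pow]
  obtain ⟨q, rfl⟩ : ∃ q, p = q + 1 := ⟨p - 1, by have := hp.pos; omega⟩
  have hq : q + 1 - 1 = q := by omega
  rw [hq]
  refine Finset.sum_congr rfl fun i hi => ?_
  have hi' : i ≤ q := by simpa [Nat.lt_succ_iff] using hi
  have h1 := choose_pred_char (R := R) (q + 1) hp i (by omega)
  rw [hq] at h1
  rw [h1, neg_pow y, mul_assoc, mul_assoc]
  have h2 : (-1 : R) ^ (q - i) * (y ^ (q - i) * (-1) ^ i) = y ^ (q - i) := by
    have : y ^ (q - i) * (-1 : R) ^ i = (-1) ^ i * y ^ (q - i) :=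
      ((Commute.neg_one_right (y ^ (q - i))).pow_right i).eq
    rw [this, ← mul_assoc, ← pow_add, Nat.sub_add_cancel hi']
    have h3 : (-1 : R) ^ q = 1 := by
      have := choose_pred_char (R := R) (q + 1) hp q (by omega)
      simpa [hq] using this.symm
    rw [h3, one_mul]
  rw [h2]

/-- commutator operator -/
def adOp {R : Type*} [Ring R] (x : R) (v : R) : R := x * v - v * x

theorem adOp_iter_eq {R : Type*} [Ring R] (x c : R) (n : ℕ) :
    (adOp x)^[n] c = ((LinearMap.mulLeft ℤ x - LinearMap.mulRight ℤ x) ^ n) c := by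
  induction n with
  | zero => simp
  | succ n ih =>
    rw [Function.iterate_succ_apply', ih, pow_succ', Module.End.mul_apply]
    rfl

theorem charP_End (M : Type*) [Ring M] (p : ℕ) [CharP M p] :
    CharP (Module.End ℤ M) p := by
  have h : Function.Injective (algebraMap ℤ (Module.End ℤ M) : ℤ → _) ∨ True := Or.inr trivial
  constructor
  intro k
  rw [← CharP.cast_eq_zero_iff M p]
  constructor
  · intro hk
    have := congrArg (fun f : Module.End ℤ M => f 1) hk
    simpa using this
  · intro hk
    ext x
    simp [hk]

theorem commute_LR {R : Type*} [Ring R] (x : R) :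
    Commute (LinearMap.mulLeft ℤ x) (LinearMap.mulRight ℤ x) := by
  refine LinearMap.ext fun y => ?_
  simp [mul_assoc]

theorem sum_adOp {R : Type*} [Ring R] (p : ℕ) (hp : p.Prime) [CharP R p] (x c : R) :
    ∑ i ∈ range p, x ^ i * c * x ^ (p - 1 - i) = (adOp x)^[p - 1] c := by
  haveI := charP_End R p
  rw [adOp_iter_eq, commute_sub_pow_pred p hp _ _ (commute_LR x)]
  simp [LinearMap.sum_apply, LinearMap.pow_mulLeft, LinearMap.pow_mulRight, mul_assoc]

theorem adOp_iter_p {R : Type*} [Ring R] (p : ℕ) (hp : p.Prime) [CharP R p] (x c : R) :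
    (adOp x)^[p] c = x ^ p * c - c * x ^ p := by
  haveI := charP_End R p
  haveI := Fact.mk hp
  rw [adOp_iter_eq, sub_pow_char_of_commute _ (commute_LR x)]
  simp [LinearMap.pow_mulLeft, LinearMap.pow_mulRight]

theorem derivative_pow_nc {R : Type*} [Ring R] (P : R[X]) (n : ℕ) :
    derivative (P ^ n) = ∑ i ∈ range n, P ^ i * derivative P * P ^ (n - 1 - i) := by
  induction n with
  | zero => simp
  | succ n ih =>
    rw [pow_succ, derivative_mul, ih, Finset.sum_range_succ, Finset.sum_mul]
    congr 1
    · refine Finset.sum_congr rfl fun i hi => ?_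
      have hi' : i < n := by simpa using hi
      have : n + 1 - 1 - i = (n - 1 - i) + 1 := by omega
      rw [this, pow_succ]; simp [mul_assoc]
    · simp

theorem hochschild {R : Type*} [Ring R] (p : ℕ) (hp : p.Prime) [CharP R p] (x v : R)
    (h : ∀ n, Commute v ((adOp x)^[n] v)) :
    (x + v) ^ p = x ^ p + v ^ p + (adOp x)^[p - 1] v := by
  set P : R[X] := C x + X * C v with hP
  have hdP : derivative P = C v := by simp [hP]
  have h1 : ∀ n, (adOp P)^[n] (C v) = C ((adOp x)^[n] v) := by
    intro n
    induction n with
    | zero => rfl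
    | succ n ih =>
      rw [Function.iterate_succ_apply', Function.iterate_succ_apply', ih]
      simp only [adOp, hP, add_mul, mul_add]
      have e1 : X * C v * C ((adOp x)^[n] v) = C ((adOp x)^[n] v) * (X * C v) := by
        rw [← mul_assoc, ← X_mul_C, mul_assoc, mul_assoc, ← C_mul, ← C_mul, (h n).eq]
      rw [e1]; simp [adOp]
  have h2 : derivative (P ^ p) = C ((adOp x)^[p - 1] v) := by
    rw [derivative_pow_nc, hdP, sum_adOp p hp, h1]
  have hnd : P.natDegree ≤ 1 := by
    rw [hP]
    refine natDegree_add_le_of_degree_le (by simp) ?_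
    refine natDegree_mul_le.trans ?_
    simpa using natDegree_X_le
  have hdeg : (P ^ p).natDegree < p + 1 := by
    have := natDegree_pow_le_of_le p hnd
    omega
  have hc0 : (P ^ p).coeff 0 = x ^ p := by
    have := map_pow (constantCoeff (R := R)) P p
    simpa [hP] using this
  have hcp : (P ^ p).coeff p = v ^ p := by
    have := coeff_pow_of_natDegree_le hnd (m := p)
    simpa [hP, coeff_C] using this
  have hcs : ∀ n, (P ^ p).coeff (n + 1) * ((n : R) + 1) = if n = 0 then (adOp x)^[p - 1] v else 0 := by
    intro n
    rw [← coeff_derivative, h2, coeff_C]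
  have hev : (x + v) ^ p = (P ^ p).eval 1 := by
    have : ∀ n, (P ^ n).eval 1 = (x + v) ^ n := by
      intro n
      induction n with
      | zero => simp
      | succ n ih =>
        have hC : ∀ (Q : R[X]) (a : R), (Q * C a).eval 1 = Q.eval 1 * a := fun Q a => by
          have := eval₂_mul_C' (p := Q) (f := RingHom.id R) (x := 1) (a := a) (Commute.one_right _)
          exact this
        have e1 : P ^ n * P = P ^ n * C x + P ^ n * C v * X := by
          rw [hP, mul_add, X_mul_C, mul_assoc]
        rw [pow_succ, pow_succ, ← ih, e1, eval_add, eval_mul_X, hC, hC]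
        simp [mul_add]
    rw [this]
  rw [hev, eval_eq_sum_range' hdeg]
  simp only [one_pow, mul_one]
  have hp2 := hp.two_le
  rw [Finset.sum_range_succ, hcp]
  obtain ⟨q, rfl⟩ : ∃ q, p = q + 2 := ⟨p - 2, by omega⟩
  rw [Finset.sum_range_succ', hc0, Finset.sum_range_succ']
  have hz : ∑ k ∈ range q, (P ^ (q + 2)).coeff (k + 1 + 1) = 0 := by
    refine Finset.sum_eq_zero fun k hk => ?_
    have hk' : k < q := by simpa using hk
    have h3 := hcs (k + 1)
    simp only [Nat.succ_ne_zero, if_false, Nat.add_eq_zero_iff, one_ne_zero, and_false] at h3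
    have hcop : Nat.Coprime (k + 2) (q + 2) :=
      (Nat.coprime_of_lt_prime (by omega) (by omega) hp).symm
    have hcop' : IsCoprime ((k + 2 : ℕ) : ℤ) ((q + 2 : ℕ) : ℤ) := Nat.isCoprime_iff_coprime.2 hcop
    obtain ⟨a, b, hab⟩ := hcop'
    have h4 : ((a * ((k + 2 : ℕ) : ℤ) + b * ((q + 2 : ℕ) : ℤ) : ℤ) : R) = 1 := by rw [hab]; simp
    have h5 : (((q + 2 : ℕ)) : R) = 0 := CharP.cast_eq_zero R (q + 2)
    rw [Int.cast_add, Int.cast_mul, Int.cast_mul, Int.cast_natCast, Int.cast_natCast, h5, mul_zero,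
      add_zero] at h4
    have h6 : (P ^ (q + 2)).coeff (k + 1 + 1) * (((k + 2 : ℕ) : R)) = 0 := by
      rw [← h3]; push_cast; congr 1; rw [add_assoc]; norm_num
    calc (P ^ (q + 2)).coeff (k + 1 + 1)
        = (P ^ (q + 2)).coeff (k + 1 + 1) * ((a : R) * ((k + 2 : ℕ) : R)) := by rw [h4, mul_one]
      _ = (P ^ (q + 2)).coeff (k + 1 + 1) * (((k + 2 : ℕ) : R) * (a : R)) := by
          rw [(Int.cast_commute a _).eq]
      _ = 0 := by rw [← mul_assoc, h6, zero_mul]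
  have h10 : (P ^ (q + 2)).coeff (0 + 1) = (adOp x)^[q + 2 - 1] v := by
    have := hcs 0
    simpa using this
  rw [hz, h10]
  abel
end Part1

section Part2
set_option linter.all false
open Finset

theorem sum_range_pow_zmod (p : ℕ) [Fact p.Prime] (j : ℕ) :
    ∑ k ∈ range p, ((k : ℕ) : ZMod p) ^ j = ∑ x : ZMod p, x ^ j := by
  refine Finset.sum_bij (fun k _ => (k : ZMod p)) (by simp) ?_ ?_ (by simp)
  · intro a ha b hb h
    have ha' : a < p := by simpa using ha
    have hb' : b < p := by simpa using hb
    have := congrArg ZMod.val h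
    rwa [ZMod.val_natCast_of_lt ha', ZMod.val_natCast_of_lt hb'] at this
  · intro x _
    exact ⟨x.val, by simpa using ZMod.val_lt x, by simp⟩

theorem sum_range_pow_char {R : Type*} [Ring R] (p : ℕ) (hp : p.Prime) [CharP R p] (j : ℕ)
    (hj : j ≤ p - 1) :
    ∑ k ∈ range p, ((k : ℕ) : R) ^ j = if j = p - 1 then -1 else 0 := by
  have := Fact.mk hp
  have h1 : ∑ k ∈ range p, ((k : ℕ) : ZMod p) ^ j = if j = p - 1 then -1 else 0 := by
    rw [sum_range_pow_zmod p]
    split_ifs with h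
    · have h2 := FiniteField.sum_pow_units (ZMod p) j
      rw [FiniteField.sum_pow_units] at h2
      have h3 : ∑ x : ZMod p, x ^ j = ∑ x : (ZMod p)ˣ, ((x : ZMod p) ^ j) := by
        have hj0 : j ≠ 0 := by have := hp.two_le; omega
        have := FiniteField.sum_pow_units (ZMod p) j
        rw [← Finset.sum_subset (Finset.subset_univ (Finset.univ.erase (0 : ZMod p)))]
        · symm
          refine Finset.sum_bij (fun x _ => (x : ZMod p)) (by simp) (fun a _ b _ h => Units.ext h) ?_
            (fun _ _ => rfl)
          intro x hx
          have hx' : x ≠ 0 := by simpa using hx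
          exact ⟨Units.mk0 x hx', by simp, rfl⟩
        · intro x _ hx
          have : x = 0 := by simpa using hx
          simp [this, hj0]
      rw [h3, FiniteField.sum_pow_units, ZMod.card, h, if_pos (dvd_refl _)]
    · exact FiniteField.sum_pow_lt_card_sub_one (ZMod p) j (by rw [ZMod.card]; omega)
  have h2 := congrArg (ZMod.castHom (dvd_refl p) R) h1
  rw [map_sum] at h2
  simp only [map_pow, map_natCast] at h2
  rw [h2]
  split_ifs <;> simp

/-- spectral projector of an operator with `T ^ p = T`. -/
def eproj {R : Type*} [Ring R] (p : ℕ) (T : R) (k : ℕ) : R := 1 - (T - (k : R)) ^ (p - 1)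

theorem eproj_sum {R : Type*} [Ring R] (p : ℕ) (hp : p.Prime) [CharP R p] (T : R) :
    ∑ k ∈ range p, eproj p T k = 1 := by
  have h : ∑ k ∈ range p, (T - (k : R)) ^ (p - 1) = -1 := by
    have : ∀ k ∈ range p, (T - (k : R)) ^ (p - 1) =
        ∑ i ∈ range p, T ^ i * (k : R) ^ (p - 1 - i) := fun k _ =>
      commute_sub_pow_pred p hp _ _ (Nat.cast_commute k T).symm
    rw [Finset.sum_congr rfl this, Finset.sum_comm]
    have h2 : ∀ i ∈ range p, ∑ k ∈ range p, T ^ i * (k : R) ^ (p - 1 - i) =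
        if i = 0 then -1 else 0 := by
      intro i hi
      have hi' : i < p := by simpa using hi
      rw [← Finset.mul_sum, sum_range_pow_char p hp _ (by omega)]
      by_cases h0 : i = 0
      · simp [h0]
      · rw [if_neg h0, if_neg (by omega), mul_zero]
    rw [Finset.sum_congr rfl h2]
    simp [hp.pos]
  simp only [eproj, Finset.sum_sub_distrib, h]
  simp

theorem eproj_mul {R : Type*} [Ring R] (p : ℕ) (hp : p.Prime) [CharP R p] (T : R)
    (hT : T ^ p = T) (k : ℕ) : T * eproj p T k = (k : R) * eproj p T k := by
  have := Fact.mk hp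
  have h1 : (T - (k : R)) ^ p = T - (k : R) := by
    rw [sub_pow_char_of_commute _ (Nat.cast_commute k T).symm, hT]
    congr 1
    have h3 : ((k : ZMod p)) ^ p = k := ZMod.pow_card _
    have h2 := congrArg (ZMod.castHom (dvd_refl p) R) h3
    rw [map_pow, map_natCast] at h2
    exact h2
  have h2 : (T - (k : R)) * eproj p T k = 0 := by
    rw [eproj, mul_sub, mul_one, ← pow_succ', Nat.sub_add_cancel hp.one_le, h1, sub_self]
  rw [sub_mul] at h2
  exact sub_eq_zero.1 h2

section
variable {E : Type*} [Field E] {p : ℕ}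

abbrev mop (v : E) : Module.End ℤ E := Algebra.lmul ℤ E v

theorem mop_apply (v x : E) : mop v x = v * x := rfl

abbrev dop (D : Derivation ℤ E E) : Module.End ℤ E := D.toLinearMap

theorem dop_pow (D : Derivation ℤ E E) (n : ℕ) (x : E) : (dop D ^ n) x = D^[n] x := by
  rw [Module.End.pow_apply]; rfl

theorem adOp_dop_mop (D : Derivation ℤ E E) (v : E) : adOp (dop D) (mop v) = mop (D v) := by
  refine LinearMap.ext fun x => ?_
  simp [adOp, mop_apply]
  ring

theorem adOp_iter_dop_mop (D : Derivation ℤ E E) (v : E) (n : ℕ) :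
    (adOp (dop D))^[n] (mop v) = mop (D^[n] v) := by
  induction n with
  | zero => rfl
  | succ n ih => rw [Function.iterate_succ_apply', Function.iterate_succ_apply', ih, adOp_dop_mop]

theorem hochschild_der (hp : p.Prime) [CharP E p] (D : Derivation ℤ E E) (v x : E) :
    ((dop D + mop v) ^ p) x = D^[p] x + v ^ p * x + D^[p - 1] v * x := by
  have := charP_End E p
  rw [hochschild p hp]
  · rw [adOp_iter_dop_mop, ← map_pow]
    simp only [LinearMap.add_apply, dop_pow]
    rfl
  · intro n
    rw [adOp_iter_dop_mop]
    exact Commute.map (mul_comm _ _) (Algebra.lmul ℤ E)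

/-- the `p`-th iterate of a derivation is a derivation -/
def derPow (hp : p.Prime) [CharP E p] (D : Derivation ℤ E E) : Derivation ℤ E E :=
  Derivation.mk' (dop D ^ p) (by
    intro a b
    have := charP_End E p
    have h := adOp_iter_p p hp (dop D) (mop a)
    rw [adOp_iter_dop_mop] at h
    have h2 := congrArg (fun f : Module.End ℤ E => f b) h
    simp only [LinearMap.sub_apply, Module.End.mul_apply, mop_apply] at h2
    rw [dop_pow _ _ a, smul_eq_mul, smul_eq_mul, mul_comm b, h2]
    ring)

theorem derPow_apply (hp : p.Prime) [CharP E p] (D : Derivation ℤ E E) (x : E) :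
    derPow hp D x = D^[p] x := by
  rw [← dop_pow]; rfl

/-- commutator derivation -/
theorem der_pow_p [CharP E p] (D : Derivation ℤ E E) (x : E) : D (x ^ p) = 0 := by
  rw [Derivation.leibniz_pow]; simp

theorem der_mul (D : Derivation ℤ E E) (a b : E) : D (a * b) = a * D b + D a * b := by
  rw [Derivation.leibniz]; simp; ring

/-- degree-zero projection -/
def rho (p : ℕ) (D : Derivation ℤ E E) (x : E) : E := x - D^[p - 1] x

theorem der_iter_add (D : Derivation ℤ E E) (n : ℕ) (x y : E) :
    D^[n] (x + y) = D^[n] x + D^[n] y := by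
  rw [← dop_pow, ← dop_pow, ← dop_pow, map_add]

theorem der_iter_neg (D : Derivation ℤ E E) (n : ℕ) (x : E) : D^[n] (-x) = -D^[n] x := by
  rw [← dop_pow, ← dop_pow, map_neg]

theorem der_iter_sub (D : Derivation ℤ E E) (n : ℕ) (x y : E) :
    D^[n] (x - y) = D^[n] x - D^[n] y := by
  rw [← dop_pow, ← dop_pow, ← dop_pow, map_sub]

theorem der_iter_const_mul (D : Derivation ℤ E E) (n : ℕ) (c x : E) (hc : D c = 0) :
    D^[n] (c * x) = c * D^[n] x := by
  induction n with
  | zero => rfl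
  | succ n ih => rw [Function.iterate_succ_apply', Function.iterate_succ_apply', ih, der_mul, hc]; ring

theorem der_iter_comm (D D' : Derivation ℤ E E) (h : ∀ x, D (D' x) = D' (D x)) (n : ℕ) (x : E) :
    D (D'^[n] x) = D'^[n] (D x) := by
  induction n with
  | zero => rfl
  | succ n ih => rw [Function.iterate_succ_apply', Function.iterate_succ_apply', h, ih]

theorem rho_add (D : Derivation ℤ E E) (x y : E) : rho p D (x + y) = rho p D x + rho p D y := by
  simp only [rho, der_iter_add]; ring

theorem rho_neg (D : Derivation ℤ E E) (x : E) : rho p D (-x) = -rho p D x := by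
  simp only [rho, der_iter_neg]; ring

theorem rho_sub (D : Derivation ℤ E E) (x y : E) : rho p D (x - y) = rho p D x - rho p D y := by
  simp only [rho, der_iter_sub]; ring

/-- `rho` as an additive map. -/
def rhoHom (p : ℕ) (D : Derivation ℤ E E) : E →+ E := AddMonoidHom.mk' (rho p D) (rho_add D)

theorem rho_zero (D : Derivation ℤ E E) : rho p D 0 = 0 := map_zero (rhoHom p D)

theorem rho_sum {ι : Type*} (D : Derivation ℤ E E) (s : Finset ι) (f : ι → E) :
    rho p D (∑ i ∈ s, f i) = ∑ i ∈ s, rho p D (f i) := map_sum (rhoHom p D) f s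

theorem rho_const_mul (D : Derivation ℤ E E) (c x : E) (hc : D c = 0) :
    rho p D (c * x) = c * rho p D x := by
  simp only [rho, der_iter_const_mul D _ _ _ hc]; ring

theorem der_rho (hp : p.Prime) (D : Derivation ℤ E E) (h : ∀ x, D^[p] x = D x) (x : E) :
    D (rho p D x) = 0 := by
  rw [rho, map_sub, ← Function.iterate_succ_apply' D, Nat.succ_eq_add_one,
    Nat.sub_add_cancel hp.one_le, h, sub_self]

theorem rho_der (hp : p.Prime) (D : Derivation ℤ E E) (h : ∀ x, D^[p] x = D x) (x : E) :
    rho p D (D x) = 0 := by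
  rw [rho, ← Function.iterate_succ_apply D, Nat.succ_eq_add_one,
    Nat.sub_add_cancel hp.one_le, h, sub_self]

theorem rho_of_const (hp : p.Prime) (D : Derivation ℤ E E) (x : E) (hx : D x = 0) :
    rho p D x = x := by
  obtain ⟨q, hq⟩ : ∃ q, p - 1 = q + 1 := ⟨p - 2, by have := hp.two_le; omega⟩
  rw [rho, hq, Function.iterate_succ_apply, hx]
  have : D^[q] 0 = 0 := by
    rw [← dop_pow, map_zero]
  rw [this, sub_zero]

theorem der_rho_comm (D D' : Derivation ℤ E E) (h : ∀ x, D (D' x) = D' (D x)) (x : E) :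
    D (rho p D' x) = rho p D' (D x) := by
  rw [rho, map_sub, der_iter_comm D D' h]; rfl

/-- Jacobson's lemma: logarithmic derivatives. -/
theorem jacobson (hp : p.Prime) [CharP E p] (D : Derivation ℤ E E) (h : ∀ x, D^[p] x = D x)
    (K : Subring E) (hK : ∀ x ∈ K, D x ∈ K) (v : E) (hv : v ∈ K) (hv2 : v ^ p = rho p D v)
    (y : E) (hy : y ∈ K) (hy0 : y ≠ 0) (hDy : D y = y) :
    ∃ a ∈ K, a ≠ 0 ∧ D a = v * a := by
  have := charP_End E p
  have hF := Fact.mk hp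
  set T : Module.End ℤ E := dop D + mop (-v) with hTdef
  have hT : T ^ p = T := by
    refine LinearMap.ext fun x => ?_
    rw [hTdef, hochschild_der hp, h, der_iter_neg]
    have h1 : (-v) ^ p = - v ^ p := by
      have := sub_pow_char (p := p) (0 : E) v
      simpa [hp.ne_zero, zero_pow] using this
    rw [h1, hv2, rho]
    simp [mop_apply]
    ring
  have hTK : ∀ x ∈ K, T x ∈ K := by
    intro x hx
    have : T x = D x - v * x := by simp [hTdef, mop_apply]; ring
    rw [this]
    exact K.sub_mem (hK x hx) (K.mul_mem hv hx)
  have hPK : ∀ (k n : ℕ), ∀ x ∈ K, ((T - (k : Module.End ℤ E)) ^ n) x ∈ K := by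
    intro k n
    induction n with
    | zero => intro x hx; simpa using hx
    | succ n ih =>
      intro x hx
      rw [pow_succ, Module.End.mul_apply]
      refine ih _ ?_
      rw [LinearMap.sub_apply]
      refine K.sub_mem (hTK x hx) ?_
      have : ((k : Module.End ℤ E)) x = (k : E) * x := by simp
      rw [this]
      exact K.mul_mem (natCast_mem K k) hx
  have hex : ∃ k ∈ range p, (eproj p T k) 1 ≠ 0 := by
    by_contra hcon
    push Not at hcon
    have h1 := congrArg (fun f : Module.End ℤ E => f 1) (eproj_sum p hp T)
    simp only [LinearMap.sum_apply] at h1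
    rw [Finset.sum_eq_zero hcon] at h1
    simp at h1
  obtain ⟨k, hk, hne⟩ := hex
  have hk' : k < p := by simpa using hk
  set a := (eproj p T k) 1 with ha
  have haK : a ∈ K := by
    rw [ha, eproj, LinearMap.sub_apply]
    exact K.sub_mem K.one_mem (hPK k _ 1 K.one_mem)
  have hTa : T a = k * a := by
    have h1 := congrArg (fun f : Module.End ℤ E => f 1) (eproj_mul p hp T hT k)
    simpa [Module.End.mul_apply] using h1
  have hDa : D a = (v + k) * a := by
    have : T a = D a - v * a := by simp [hTdef, mop_apply]; ring
    rw [this] at hTa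
    linear_combination hTa
  refine ⟨y ^ (p - k) * a, K.mul_mem (K.pow_mem hy _) haK, mul_ne_zero (pow_ne_zero _ hy0) hne, ?_⟩
  have hyp : D (y ^ (p - k)) = ((p - k : ℕ) : E) * y ^ (p - k) := by
    rw [Derivation.leibniz_pow, hDy]
    obtain ⟨q, hq⟩ : ∃ q, p - k = q + 1 := ⟨p - k - 1, by omega⟩
    simp [hq, pow_succ]
  rw [der_mul, hyp, hDa, Nat.cast_sub hk'.le, CharP.cast_eq_zero E p]
  ring

end
end Part2

section Part3
set_option linter.all false
open Finset

section
variable {E : Type*} [Field E] {p : ℕ}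

theorem divided_binomial (hp : p.Prime) [CharP E p] (x y : E) :
    ∃ B : E, ∀ D : Derivation ℤ E E,
      (x + y) ^ (p - 1) * D (x + y) = x ^ (p - 1) * D x + y ^ (p - 1) * D y + D B := by
  obtain ⟨q, rfl⟩ : ∃ q, p = q + 1 := ⟨p - 1, by have := hp.pos; omega⟩
  simp only [Nat.add_sub_cancel]
  set c : ℕ → ℕ := fun i => (q + 1).choose (i + 1) / (q + 1) with hc
  have hdvd : ∀ i ∈ range q, (q + 1) * c i = (q + 1).choose (i + 1) := by
    intro i hi
    have hi' : i < q := by simpa using hi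
    exact Nat.mul_div_cancel' (hp.dvd_choose_self (by omega) (by omega))
  have h1 : ∀ i ∈ range q, c i * (i + 1) = q.choose i := by
    intro i hi
    have := Nat.add_one_mul_choose_eq q i
    rw [← hdvd i hi, mul_assoc] at this
    exact (Nat.eq_of_mul_eq_mul_left hp.pos this).symm
  have h2 : ∀ i ∈ range q, c i * (q - i) = q.choose (i + 1) := by
    intro i hi
    have hi' : i < q := by simpa using hi
    have e1 := Nat.choose_mul_succ_eq q (i + 1)
    rw [← hdvd i hi] at e1
    have e2 : q + 1 - (i + 1) = q - i := by omega
    rw [e2, mul_assoc, mul_comm] at e1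
    exact (Nat.eq_of_mul_eq_mul_left hp.pos e1).symm
  refine ⟨∑ i ∈ range q, (c i : E) * (x ^ (i + 1) * y ^ (q - i)), fun D => ?_⟩
  have hD : ∀ i ∈ range q, D ((c i : E) * (x ^ (i + 1) * y ^ (q - i))) =
      ((q.choose i : ℕ) : E) * (x ^ i * y ^ (q - i)) * D x +
        ((q.choose (i + 1) : ℕ) : E) * (x ^ (i + 1) * y ^ (q - (i + 1))) * D y := by
    intro i hi
    have e3 : q - i - 1 = q - (i + 1) := by omega
    rw [← h1 i hi, ← h2 i hi, der_mul, der_mul, Derivation.leibniz_pow, Derivation.leibniz_pow,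
      Derivation.map_natCast, e3]
    simp only [nsmul_eq_mul, smul_eq_mul, Nat.add_sub_cancel]
    push_cast
    ring
  rw [map_sum, Finset.sum_congr rfl hD, Finset.sum_add_distrib, ← Finset.sum_mul, ← Finset.sum_mul,
    map_add]
  have e4 := add_pow x y q
  have e5 := e4
  rw [Finset.sum_range_succ] at e4
  rw [Finset.sum_range_succ'] at e5
  simp only [Nat.sub_self, pow_zero, mul_one, Nat.choose_self, Nat.cast_one, Nat.choose_zero_right,
    Nat.sub_zero, one_mul] at e4 e5
  have s1 : ∑ i ∈ range q, ((q.choose i : ℕ) : E) * (x ^ i * y ^ (q - i)) =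
    (x + y) ^ q - x ^ q := by
    rw [e4, add_sub_cancel_right]
    exact Finset.sum_congr rfl fun i _ => by ring
  have s2 : ∑ i ∈ range q, ((q.choose (i + 1) : ℕ) : E) * (x ^ (i + 1) * y ^ (q - (i + 1))) =
    (x + y) ^ q - y ^ q := by
    rw [e5, add_sub_cancel_right]
    exact Finset.sum_congr rfl fun i _ => by ring
  rw [s1, s2]
  ring

theorem cartier_one (hp : p.Prime) [CharP E p] {ι : Type*} (D : ι → Derivation ℤ E E)
    (hcomm : ∀ i j x, D i (D j x) = D j (D i x)) (hpow : ∀ i x, (D i)^[p] x = D i x)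
    (hfin : ∀ x, {i | D i x ≠ 0}.Finite) (x : E) :
    ∃ η, ∀ j, (D j x) ^ p = x ^ (p - 1) * D j x + D j η := by
  classical
  have := charP_End E p
  have hF := Fact.mk hp
  have key : ∀ S : Finset ι, ∀ x, (∀ j ∉ S, ∃ k : ℕ, D j x = k * x) →
      ∃ η, ∀ j, (D j x) ^ p = x ^ (p - 1) * D j x + D j η := by
    intro S
    induction S using Finset.induction_on with
    | empty =>
      intro x hx
      refine ⟨0, fun j => ?_⟩
      obtain ⟨k, hk⟩ := hx j (by simp)
      rw [hk, map_zero, add_zero, mul_pow]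
      have h3 : ((k : ZMod p)) ^ p = k := ZMod.pow_card _
      have h2 := congrArg (ZMod.castHom (dvd_refl p) E) h3
      rw [map_pow, map_natCast] at h2
      rw [h2]
      obtain ⟨q, rfl⟩ : ∃ q, p = q + 1 := ⟨p - 1, by have := hp.pos; omega⟩
      simp only [Nat.add_sub_cancel]
      ring
    | insert i S hi ih =>
      intro x hx
      have hsum : x = ∑ k ∈ range p, (eproj p (dop (D i)) k) x := by
        have h1 := congrArg (fun f : Module.End ℤ E => f x) (eproj_sum p hp (dop (D i)))
        simp only [LinearMap.sum_apply] at h1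
        rw [h1]; rfl
      have hT : dop (D i) ^ p = dop (D i) := LinearMap.ext fun z => by
        rw [dop_pow, hpow]; rfl
      have heig : ∀ k, ∀ j ∉ S, ∃ l : ℕ, D j ((eproj p (dop (D i)) k) x) =
          l * ((eproj p (dop (D i)) k) x) := by
        intro k j hj
        by_cases hji : j = i
        · subst hji
          refine ⟨k, ?_⟩
          have h1 := congrArg (fun f : Module.End ℤ E => f x) (eproj_mul p hp _ hT k)
          simp only [Module.End.mul_apply] at h1
          exact h1.trans (by simp)
        · obtain ⟨l, hl⟩ := hx j (by simp [hji, hj])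
          refine ⟨l, ?_⟩
          have hc : Commute (dop (D j)) (eproj p (dop (D i)) k) := by
            have h0 : Commute (dop (D j)) (dop (D i)) := LinearMap.ext fun z => hcomm j i z
            exact (Commute.one_right _).sub_right
              ((h0.sub_right (Nat.cast_commute k _).symm).pow_right _)
          have h1 := congrArg (fun f : Module.End ℤ E => f x) hc.eq
          simp only [Module.End.mul_apply] at h1
          refine h1.trans ?_
          have h2 : dop (D j) x = (l : Module.End ℤ E) x := by
            refine (show dop (D j) x = (l : E) * x from hl).trans (by simp)
          rw [h2, ← Module.End.mul_apply, ← (Nat.cast_commute l (eproj p (dop (D i)) k)).eq]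
          simp
      have hall : ∀ T : Finset ℕ, ∃ η, ∀ j, (D j (∑ k ∈ T, (eproj p (dop (D i)) k) x)) ^ p =
          (∑ k ∈ T, (eproj p (dop (D i)) k) x) ^ (p - 1) *
            D j (∑ k ∈ T, (eproj p (dop (D i)) k) x) + D j η := by
        intro T
        induction T using Finset.induction_on with
        | empty => exact ⟨0, fun j => by simp [hp.ne_zero]⟩
        | insert k T hk ihT =>
          obtain ⟨η1, h1⟩ := ihT
          obtain ⟨η2, h2⟩ := ih _ (heig k)
          obtain ⟨B, hB⟩ := divided_binomial hp ((eproj p (dop (D i)) k) x)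
            (∑ k ∈ T, (eproj p (dop (D i)) k) x)
          refine ⟨η1 + η2 - B, fun j => ?_⟩
          rw [Finset.sum_insert hk, hB, map_add, add_pow_char, h1, h2, map_sub, map_add]
          ring
      obtain ⟨η, hη⟩ := hall (range p)
      rw [← hsum] at hη
      exact ⟨η, hη⟩
  exact key (hfin x).toFinset x fun j hj => ⟨0, by
    have : D j x = 0 := by simpa using hj
    simp [this]⟩

theorem cartier_log (hp : p.Prime) [CharP E p] {ι : Type*} (D : ι → Derivation ℤ E E)
    (hcomm : ∀ i j x, D i (D j x) = D j (D i x)) (hpow : ∀ i x, (D i)^[p] x = D i x)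
    (hfin : ∀ x, {i | D i x ≠ 0}.Finite) (x : E) :
    ∃ η, ∀ j, (x⁻¹ * D j x) ^ p = x⁻¹ * D j x + D j η := by
  by_cases hx : x = 0
  · exact ⟨0, fun j => by simp [hx, hp.ne_zero]⟩
  obtain ⟨η, hη⟩ := cartier_one hp D hcomm hpow hfin x
  refine ⟨(x⁻¹) ^ p * η, fun j => ?_⟩
  rw [der_mul, der_pow_p, zero_mul, add_zero, mul_pow, hη, mul_add]
  congr 1
  obtain ⟨q, rfl⟩ : ∃ q, p = q + 1 := ⟨p - 1, by have := hp.pos; omega⟩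
  simp only [Nat.add_sub_cancel, pow_succ, inv_pow]
  field_simp

end
end Part3

section Part4
set_option linter.all false
open Finset

section Forms
variable {I : Type*} [LinearOrder I]

def eps (j : I) (σ : Finset I) : ℤ := (-1) ^ (#(σ.filter (· < j)))

theorem eps_anti_lt {σ : Finset I} {i j : I} (hi : i ∈ σ) (hj : j ∈ σ) (h : i < j) :
    eps j σ * eps i (σ.erase j) = -(eps i σ * eps j (σ.erase i)) := by
  have h1 : (σ.erase j).filter (· < i) = σ.filter (· < i) := by
    ext k; simp only [mem_filter, mem_erase]
    constructor
    · rintro ⟨⟨_, a⟩, b⟩; exact ⟨a, b⟩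
    · rintro ⟨a, b⟩; exact ⟨⟨(b.trans h).ne, a⟩, b⟩
  have h2 : (σ.erase i).filter (· < j) = (σ.filter (· < j)).erase i := by
    ext k; simp only [mem_filter, mem_erase]; tauto
  have h3 : #(σ.filter (· < j)) = #((σ.erase i).filter (· < j)) + 1 := by
    rw [h2, Finset.card_erase_add_one]
    simp [hi, h]
  simp only [eps, h1, h3, pow_succ]
  ring

theorem eps_anti {σ : Finset I} {i j : I} (hi : i ∈ σ) (hj : j ∈ σ) (h : i ≠ j) :
    eps j σ * eps i (σ.erase j) = -(eps i σ * eps j (σ.erase i)) := by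
  rcases lt_or_gt_of_ne h with h | h
  · exact eps_anti_lt hi hj h
  · rw [eps_anti_lt hj hi h, neg_neg]

variable {E : Type*} [Field E]

theorem double_swap (σ : Finset I) (G : I → I → E) :
    ∑ j ∈ σ, ∑ i ∈ σ.erase j, (eps j σ * eps i (σ.erase j)) • G j i =
      -∑ j ∈ σ, ∑ i ∈ σ.erase j, (eps j σ * eps i (σ.erase j)) • G i j := by
  rw [Finset.sum_comm' (t' := σ) (s' := fun i => σ.erase i)]
  · rw [← Finset.sum_neg_distrib]
    refine Finset.sum_congr rfl fun j hj => ?_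
    rw [← Finset.sum_neg_distrib]
    refine Finset.sum_congr rfl fun i hi => ?_
    have hi' := Finset.mem_erase.1 hi
    rw [eps_anti hj hi'.2 hi'.1.symm, neg_smul]
  · intro x y
    simp only [mem_erase]
    constructor
    · rintro ⟨a, b, c⟩; exact ⟨⟨Ne.symm b, a⟩, c⟩
    · rintro ⟨⟨a, b⟩, c⟩; exact ⟨b, Ne.symm a, c⟩

theorem double_symm (σ : Finset I) (G : I → I → E) (hG : ∀ i j, G i j = G j i) :
    ∑ j ∈ σ, ∑ i ∈ σ.erase j, (eps j σ * eps i (σ.erase j)) • G j i = 0 := by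
  rw [Finset.sum_sigma']
  refine Finset.sum_involution (fun a _ => ⟨a.2, a.1⟩) ?_ ?_ ?_ ?_
  · rintro ⟨j, i⟩ h
    simp only [mem_sigma, mem_erase] at h
    rw [eps_anti h.2.2 h.1 h.2.1, hG j i, neg_smul]
    simp
  · rintro ⟨j, i⟩ h _ heq
    simp only [mem_sigma, mem_erase] at h
    simp only [Sigma.mk.injEq] at heq
    exact h.2.1 heq.1
  · rintro ⟨j, i⟩ h
    simp only [mem_sigma, mem_erase] at h ⊢
    exact ⟨h.2.2, Ne.symm h.2.1, h.1⟩
  · rintro ⟨j, i⟩ h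
    rfl

/-- wedge with a 1-form -/
def wd (α : I → E) (x : Finset I → E) : Finset I → E :=
  fun σ => ∑ j ∈ σ, eps j σ • (α j * x (σ.erase j))

/-- exterior derivative in coordinates -/
def dd (D : I → Derivation ℤ E E) (x : Finset I → E) : Finset I → E :=
  fun σ => ∑ j ∈ σ, eps j σ • D j (x (σ.erase j))

/-- log derivative -/
def dl (D : I → Derivation ℤ E E) (a : E) : I → E := fun j => a⁻¹ * D j a

theorem wd_add (α : I → E) (x y : Finset I → E) : wd α (x + y) = wd α x + wd α y := by
  funext σ
  simp only [wd, Pi.add_apply, ← Finset.sum_add_distrib]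
  exact Finset.sum_congr rfl fun j _ => by rw [mul_add, smul_add]

theorem wd_sub (α : I → E) (x y : Finset I → E) : wd α (x - y) = wd α x - wd α y := by
  funext σ
  simp only [wd, Pi.sub_apply, ← Finset.sum_sub_distrib]
  exact Finset.sum_congr rfl fun j _ => by rw [mul_sub, smul_sub]

theorem wd_add_left (α β : I → E) (x : Finset I → E) : wd (α + β) x = wd α x + wd β x := by
  funext σ
  simp only [wd, Pi.add_apply, ← Finset.sum_add_distrib]
  exact Finset.sum_congr rfl fun j _ => by rw [add_mul, smul_add]

theorem wd_zero (α : I → E) : wd α (0 : Finset I → E) = 0 := by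
  funext σ
  simp [wd]

theorem wd_smul (α : I → E) (c : E) (x : Finset I → E) : wd α (c • x) = c • wd α x := by
  funext σ
  simp only [wd, Pi.smul_apply, smul_eq_mul, Finset.mul_sum]
  exact Finset.sum_congr rfl fun j _ => by rw [mul_smul_comm]; congr 1; ring

theorem wd_smul_left (α : I → E) (c : E) (x : Finset I → E) : wd (c • α) x = c • wd α x := by
  funext σ
  simp only [wd, Pi.smul_apply, smul_eq_mul, Finset.mul_sum]
  exact Finset.sum_congr rfl fun j _ => by rw [mul_smul_comm]; congr 1; ring

theorem dd_add (D : I → Derivation ℤ E E) (x y : Finset I → E) :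
    dd D (x + y) = dd D x + dd D y := by
  funext σ
  simp only [dd, Pi.add_apply, ← Finset.sum_add_distrib]
  exact Finset.sum_congr rfl fun j _ => by rw [map_add, smul_add]

theorem dd_sub (D : I → Derivation ℤ E E) (x y : Finset I → E) :
    dd D (x - y) = dd D x - dd D y := by
  funext σ
  simp only [dd, Pi.sub_apply, ← Finset.sum_sub_distrib]
  exact Finset.sum_congr rfl fun j _ => by rw [map_sub, smul_sub]

theorem dd_zero (D : I → Derivation ℤ E E) : dd D (0 : Finset I → E) = 0 := by
  funext σ
  simp [dd]

theorem dd_neg (D : I → Derivation ℤ E E) (x : Finset I → E) : dd D (-x) = -dd D x := by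
  rw [← zero_sub, dd_sub, dd_zero, zero_sub]

theorem dd_smul (D : I → Derivation ℤ E E) (c : E) (x : Finset I → E) :
    dd D (c • x) = wd (fun j => D j c) x + c • dd D x := by
  funext σ
  simp only [dd, wd, Pi.smul_apply, Pi.add_apply, smul_eq_mul, Finset.mul_sum,
    ← Finset.sum_add_distrib]
  exact Finset.sum_congr rfl fun j _ => by
    rw [der_mul, mul_smul_comm, ← smul_add, add_comm]

theorem dd_dd (D : I → Derivation ℤ E E) (hcomm : ∀ i j x, D i (D j x) = D j (D i x))
    (x : Finset I → E) : dd D (dd D x) = 0 := by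
  funext σ
  simp only [dd, map_sum, map_zsmul, Finset.smul_sum, smul_smul]
  exact double_symm σ (fun j i => D j (D i (x ((σ.erase j).erase i)))) fun i j => by
    rw [hcomm, Finset.erase_right_comm]

theorem dd_wd (D : I → Derivation ℤ E E) (α : I → E) (hα : ∀ i j, D i (α j) = D j (α i))
    (x : Finset I → E) : dd D (wd α x) = -wd α (dd D x) := by
  funext σ
  simp only [dd, wd, map_sum, map_zsmul, Finset.smul_sum, smul_smul, der_mul, smul_add,
    Finset.sum_add_distrib, Pi.neg_apply, Finset.mul_sum, mul_smul_comm]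
  have h1 := double_symm σ (fun j i => D j (α i) * x ((σ.erase j).erase i)) fun i j => by
    rw [hα, Finset.erase_right_comm]
  have h2 := double_swap σ (fun j i => α i * D j (x ((σ.erase j).erase i)))
  rw [h1, add_zero, h2]
  simp only [Finset.erase_right_comm]

theorem dl_closed (D : I → Derivation ℤ E E) (hcomm : ∀ i j x, D i (D j x) = D j (D i x))
    (a : E) (i j : I) : D i (dl D a j) = D j (dl D a i) := by
  by_cases ha : a = 0
  · simp [dl, ha]
  have h : ∀ k, D k a⁻¹ = -(a⁻¹ * a⁻¹ * D k a) := by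
    intro k
    have h1 : D k (a * a⁻¹) = 0 := by rw [mul_inv_cancel₀ ha]; simp
    rw [der_mul] at h1
    have h2 : a * (D k a⁻¹ + a⁻¹ * a⁻¹ * D k a) = 0 := by
      rw [mul_add, ← h1]; congr 1; field_simp
    have := (mul_eq_zero.1 h2).resolve_left ha
    exact eq_neg_of_add_eq_zero_left this
  simp only [dl, der_mul, h, hcomm i j]
  ring

/-- coordinatewise `p`-th power -/
def sc (p : ℕ) (x : Finset I → E) : Finset I → E := fun σ => x σ ^ p

section charp
variable {p : ℕ} [Fact p.Prime] [CharP E p]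

theorem zsmul_pow_char (n : ℤ) (a : E) : (n • a) ^ p = n • a ^ p := by
  have := map_zsmul (frobenius E p) n a
  simpa [frobenius_def] using this

theorem sc_add (x y : Finset I → E) : sc p (x + y) = sc p x + sc p y := by
  funext σ; exact add_pow_char (p := p) (x σ) (y σ)

theorem sc_sub (x y : Finset I → E) : sc p (x - y) = sc p x - sc p y := by
  funext σ; exact sub_pow_char (p := p) (x σ) (y σ)

theorem sc_smul (c : E) (x : Finset I → E) : sc p (c • x) = c ^ p • sc p x := by
  funext σ; exact mul_pow _ _ _

theorem sc_wd (α : I → E) (x : Finset I → E) :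
    sc p (wd α x) = wd (fun j => α j ^ p) (sc p x) := by
  funext σ
  simp only [sc, wd]
  rw [sum_pow_char]
  exact Finset.sum_congr rfl fun j _ => by rw [zsmul_pow_char, mul_pow]

theorem dd_sc (D : I → Derivation ℤ E E) (x : Finset I → E) : dd D (sc p x) = 0 := by
  funext σ
  simp [dd, sc, der_pow_p]

end charp

theorem dd_map {E' : Type*} [Field E'] (D : I → Derivation ℤ E E) (D' : I → Derivation ℤ E' E')
    (f : E →+ E') (hf : ∀ j a, f (D j a) = D' j (f a)) (x : Finset I → E) :
    dd D' (fun σ => f (x σ)) = fun σ => f (dd D x σ) := by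
  funext σ
  simp only [dd, map_sum, map_zsmul, hf]

/-- finite support -/
def FS (x : Finset I → E) : Prop := (Function.support x).Finite

theorem FS.add {x y : Finset I → E} (hx : FS x) (hy : FS y) : FS (x + y) :=
  (hx.union hy).subset (Function.support_add x y)

theorem FS.neg {x : Finset I → E} (hx : FS x) : FS (-x) := by
  rw [FS, Function.support_neg]; exact hx

theorem FS.sub {x y : Finset I → E} (hx : FS x) (hy : FS y) : FS (x - y) := by
  rw [sub_eq_add_neg]; exact hx.add hy.neg

theorem FS.zero : FS (0 : Finset I → E) := by simp [FS]

theorem FS.map {E' : Type*} [Field E'] {x : Finset I → E} (hx : FS x) (f : Finset I → E → E')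
    (hf : ∀ σ, f σ 0 = 0) : FS (fun σ => f σ (x σ)) := by
  refine Set.Finite.subset hx fun σ hσ => ?_
  rw [Function.mem_support] at hσ ⊢
  intro h; exact hσ (by rw [h, hf])

theorem FS.smul {x : Finset I → E} (c : E) (hx : FS x) : FS (c • x) :=
  hx.map (fun _ a => c * a) (by simp)

theorem FS.sc {p : ℕ} (hp : p ≠ 0) {x : Finset I → E} (hx : FS x) : FS (sc p x) :=
  hx.map (fun _ a => a ^ p) (by simp [hp])

theorem FS.wd {x : Finset I → E} (hx : FS x) {α : I → E} (hα : {j | α j ≠ 0}.Finite) :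
    FS (wd α x) := by
  refine Set.Finite.subset (Set.Finite.image2 (fun j τ => insert j τ) hα hx) ?_
  intro σ hσ
  rw [Function.mem_support] at hσ
  obtain ⟨j, hj, hne⟩ := Finset.exists_ne_zero_of_sum_ne_zero hσ
  refine ⟨j, ?_, σ.erase j, ?_, Finset.insert_erase hj⟩
  · intro h; exact hne (by simp [h])
  · rw [Function.mem_support]; intro h; exact hne (by simp [h])

theorem FS.dd {x : Finset I → E} (hx : FS x) {D : I → Derivation ℤ E E}
    (hD : ∀ a, {j | D j a ≠ 0}.Finite) : FS (dd D x) := by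
  have hfin : (⋃ τ ∈ Function.support x, {j | D j (x τ) ≠ 0}).Finite :=
    Set.Finite.biUnion hx fun τ _ => hD _
  refine Set.Finite.subset (Set.Finite.image2 (fun j τ => insert j τ) hfin hx) ?_
  intro σ hσ
  rw [Function.mem_support] at hσ
  obtain ⟨j, hj, hne⟩ := Finset.exists_ne_zero_of_sum_ne_zero hσ
  have hx0 : x (σ.erase j) ≠ 0 := by intro h; exact hne (by simp [h])
  refine ⟨j, ?_, σ.erase j, hx0, Finset.insert_erase hj⟩
  simp only [Set.mem_iUnion]
  exact ⟨σ.erase j, hx0, fun h => hne (by rw [h]; simp)⟩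

theorem dl_fin {D : I → Derivation ℤ E E} (hD : ∀ a, {j | D j a ≠ 0}.Finite) (a : E) :
    {j | dl D a j ≠ 0}.Finite :=
  (hD a).subset fun j hj h => hj (by simp [dl, h])

end Forms
end Part4

section Part5
set_option linter.all false
open Finset

section RootExtension
universe w

theorem lift_der {A B : Type*} [CommRing A] [CommRing B] (f : A →+* B)
    (hf : Function.Surjective f) (D : A → A) (hadd : ∀ x y, D (x + y) = D x + D y)
    (hmul : ∀ x y, D (x * y) = x * D y + y * D x) (hk : ∀ x, f x = 0 → f (D x) = 0) :
    ∃ D' : Derivation ℤ B B, ∀ x, D' (f x) = f (D x) := by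
  have hD0 : D 0 = 0 := by have := hadd 0 0; simpa using this
  have hneg : ∀ x, D (-x) = - D x := fun x => by
    have := hadd x (-x)
    rw [add_neg_cancel, hD0] at this
    exact (neg_eq_of_add_eq_zero_right this.symm).symm
  have hwd : ∀ x y, f x = f y → f (D x) = f (D y) := by
    intro x y h
    have := hk (x + -y) (by simp [h])
    rw [hadd, hneg, map_add, map_neg] at this
    exact add_neg_eq_zero.1 this
  let g := Function.surjInv hf
  have hg : ∀ b, f (g b) = b := Function.surjInv_eq hf
  let D0 : B →+ B := AddMonoidHom.mk' (fun b => f (D (g b))) (by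
    intro a b
    rw [← map_add, ← hadd]
    exact hwd _ _ (by simp [hg]))
  refine ⟨Derivation.mk' D0.toIntLinearMap ?_, fun x => hwd _ _ (hg _)⟩
  intro a b
  change f (D (g (a * b))) = a * f (D (g b)) + b * f (D (g a))
  rw [hwd (g (a * b)) (g a * g b) (by simp [hg]), hmul]
  simp [hg]

open Polynomial in
theorem exists_root_ext (K : Type w) [Field K] (q : ℕ) (hq : q.Prime) (u : K)
    (hu : ∀ c : K, c ^ q ≠ u) :
    ∃ (L : Type w) (_ : Field L) (_ : Algebra K L) (h : L) (B : Module.Basis (Fin q) K L),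
      (∀ i, B i = h ^ (i : ℕ)) ∧ h ^ q = algebraMap K L u ∧
      ∀ (D : Derivation ℤ K K) (κ : K), D u = q * κ * u →
        ∃ D' : Derivation ℤ L L, (∀ a, D' (algebraMap K L a) = algebraMap K L (D a)) ∧
          D' h = algebraMap K L κ * h := by
  have hirr : Irreducible (X ^ q - C u) := X_pow_sub_C_irreducible_of_prime hq hu
  haveI : Fact (Irreducible (X ^ q - C u)) := ⟨hirr⟩
  have hdeg : (X ^ q - C u).natDegree = q := natDegree_X_pow_sub_C
  have hmon : (X ^ q - C u).Monic := monic_X_pow_sub_C u hq.ne_zero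
  refine ⟨AdjoinRoot (X ^ q - C u), inferInstance, inferInstance, AdjoinRoot.root _,
    (AdjoinRoot.powerBasis hirr.ne_zero).basis.reindex (finCongr hdeg), ?_, ?_, ?_⟩
  · intro i
    rw [Module.Basis.reindex_apply, PowerBasis.basis_eq_pow]
    rfl
  · have := AdjoinRoot.eval₂_root (X ^ q - C u)
    simp only [eval₂_sub, eval₂_X_pow, eval₂_C, sub_eq_zero] at this
    exact this
  · intro D κ hD
    letI : Differential K := ⟨D⟩
    have hder : ∀ x : K[X], AdjoinRoot.mk (X ^ q - C u) x = 0 → AdjoinRoot.mk (X ^ q - C u)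
        (Differential.implicitDeriv (C κ * X) x) = 0 := by
      intro x hx
      rw [AdjoinRoot.mk_eq_zero] at hx ⊢
      obtain ⟨g, rfl⟩ := hx
      rw [Derivation.leibniz, smul_eq_mul, smul_eq_mul]
      refine dvd_add (dvd_mul_right _ _) (dvd_mul_of_dvd_right ?_ _)
      rw [map_sub, Derivation.leibniz_pow, Differential.implicitDeriv_X,
        Differential.implicitDeriv_C]
      have : (Differential.deriv u : K) = D u := rfl
      rw [this, hD]
      refine ⟨C (q * κ), ?_⟩
      simp only [smul_eq_mul, nsmul_eq_mul, C_mul, C_eq_natCast]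
      obtain ⟨k, rfl⟩ : ∃ k, q = k + 1 := ⟨q - 1, by have := hq.pos; omega⟩
      simp only [Nat.add_sub_cancel]
      ring
    obtain ⟨D', hD'⟩ := lift_der (AdjoinRoot.mk (X ^ q - C u)) AdjoinRoot.mk_surjective
      (Differential.implicitDeriv (C κ * X)) (map_add _)
      (fun x y => by rw [Derivation.leibniz]; rfl) hder
    refine ⟨D', fun a => ?_, ?_⟩
    · have := hD' (C a)
      rw [Differential.implicitDeriv_C] at this
      exact this
    · have := hD' X
      rw [Differential.implicitDeriv_X, map_mul] at this
      exact this

end RootExtension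
end Part5

section Part6
set_option linter.all false
open Finset

section WDsec
universe w

/-- commuting derivations `D j` with `D j ^ p = D j` and eigenvectors `y j`. -/
structure WD (p : ℕ) (K : Type*) (E : Type*) [Field E] where
  D : K → Derivation ℤ E E
  y : K → E
  J : Set K
  comm : ∀ i j x, D i (D j x) = D j (D i x)
  pow : ∀ i x, (D i)^[p] x = D i x
  ynz : ∀ j ∈ J, y j ≠ 0
  yself : ∀ j ∈ J, D j (y j) = y j
  yother : ∀ j ∈ J, ∀ i, i ≠ j → D i (y j) = 0
  off : ∀ j, j ∉ J → D j = 0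
  fin : ∀ x, {j | D j x ≠ 0}.Finite

/-- An extension of `W` with a Frobenius-compatible retraction. -/
structure WDExt {p : ℕ} {K : Type*} {E E' : Type*} [Field E] [Field E']
    (W : WD p K E) (W' : WD p K E') where
  f : E →+* E'
  lam : E' →+ E
  J_eq : W'.J = W.J
  f_D : ∀ j a, W'.D j (f a) = f (W.D j a)
  lam_f : ∀ a, lam (f a) = a
  lam_pow : ∀ x, lam (x ^ p) = lam x ^ p
  lam_D : ∀ j x, lam (W'.D j x) = W.D j (lam x)

def WDExt.refl {p : ℕ} {K : Type*} {E : Type*} [Field E] (W : WD p K E) : WDExt W W where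
  f := RingHom.id E
  lam := AddMonoidHom.id E
  J_eq := rfl
  f_D _ _ := rfl
  lam_f _ := rfl
  lam_pow _ := rfl
  lam_D _ _ := rfl

def WDExt.trans {p : ℕ} {K : Type*} {E E' E'' : Type*} [Field E] [Field E'] [Field E'']
    {W : WD p K E} {W' : WD p K E'} {W'' : WD p K E''} (e : WDExt W W') (e' : WDExt W' W'') :
    WDExt W W'' where
  f := e'.f.comp e.f
  lam := e.lam.comp e'.lam
  J_eq := e'.J_eq.trans e.J_eq
  f_D j a := by simp [e'.f_D, e.f_D]
  lam_f a := by simp [e'.lam_f, e.lam_f]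
  lam_pow x := by simp [e'.lam_pow, e.lam_pow]
  lam_D j x := by simp [e'.lam_D, e.lam_D]

theorem der_zero_of_root {E L : Type*} [Field E] [Field L] [Algebra E L] {q : ℕ}
    (hqL : (q : L) ≠ 0) (h : L) (B : Module.Basis (Fin q) E L)
    (hB : ∀ i, B i = h ^ (i : ℕ)) (h0 : h ≠ 0) (u : E) (hu : h ^ q = algebraMap E L u)
    (D : Derivation ℤ L L) (hD : ∀ a, D (algebraMap E L a) = 0) (x : L) : D x = 0 := by
  have hh : D h = 0 := by
    have h1 := hD u
    rw [← hu, Derivation.leibniz_pow, nsmul_eq_mul, smul_eq_mul] at h1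
    rcases mul_eq_zero.1 h1 with h2 | h2
    · exact absurd h2 hqL
    · rcases mul_eq_zero.1 h2 with h3 | h3
      · exact absurd h3 (pow_ne_zero _ h0)
      · exact h3
  rw [← B.sum_repr x, map_sum]
  refine Finset.sum_eq_zero fun i _ => ?_
  rw [Algebra.smul_def, der_mul, hD, hB, Derivation.leibniz_pow, hh]
  simp

theorem WD.adjoin_prime {p : ℕ} (hp : p.Prime) {K : Type*} {E : Type w} [Field E] [CharP E p]
    (W : WD p K E) (q : ℕ) (hq : q.Prime) (hqp : q ∣ p - 1) (u : E) (hu0 : u ≠ 0)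
    (hu : ∀ c : E, c ^ q ≠ u) :
    ∃ (E' : Type w) (_ : Field E') (_ : CharP E' p) (W' : WD p K E') (e : WDExt W W') (h : E'),
      h ^ q = e.f u := by
  have hF := Fact.mk hp
  obtain ⟨L, iF, iA, h, B, hB, hh, hext⟩ := exists_root_ext E q hq u hu
  have iC : CharP L p := charP_of_injective_algebraMap (algebraMap E L).injective p
  have hqE : (q : E) ≠ 0 := by
    rw [Ne, CharP.cast_eq_zero_iff E p]
    intro hd
    have h1 := Nat.le_of_dvd hq.pos hd
    have h2 := Nat.le_of_dvd (by have := hp.two_le; omega) hqp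
    have := hp.two_le
    omega
  have hqL : (q : L) ≠ 0 := by
    have := (map_ne_zero (algebraMap E L)).2 hqE
    simpa using this
  have h0 : h ≠ 0 := by
    rintro rfl
    rw [zero_pow hq.ne_zero] at hh
    exact hu0 ((map_eq_zero _).1 hh.symm)
  have hk : ∀ j, W.D j u = q * (W.D j u / (q * u)) * u := by
    intro j; field_simp
  choose D' hD' hD'h using fun j => hext (W.D j) _ (hk j)
  have hz := fun D hD x => der_zero_of_root hqL h B hB h0 u hh D hD x
  have hDx : ∀ j x, D' j x = ∑ i : Fin q, (W.D j (B.repr x i) +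
      (i : ℕ) * (W.D j u / (q * u)) * B.repr x i) • B i := by
    intro j x
    conv_lhs => rw [← B.sum_repr x, map_sum]
    refine Finset.sum_congr rfl fun i _ => ?_
    rw [Algebra.smul_def, der_mul, hD', hB, Derivation.leibniz_pow, hD'h, nsmul_eq_mul, smul_eq_mul, Algebra.smul_def]
    simp only [map_add, map_mul, map_natCast]
    rcases Nat.eq_zero_or_pos (i : ℕ) with h | h
    · simp [h]
    · obtain ⟨k, hk⟩ : ∃ k, (i : ℕ) = k + 1 := ⟨i - 1, by omega⟩
      rw [hk]
      simp only [Nat.add_sub_cancel]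
      ring
  have hq0 : 0 < q := hq.pos
  let i0 : Fin q := ⟨0, hq0⟩
  have hB0 : B i0 = 1 := by rw [hB]; simp [i0]
  let W' : WD p K L :=
    { D := D'
      y := fun j => algebraMap E L (W.y j)
      J := W.J
      comm := by
        intro i j x
        have := hz ⁅D' i, D' j⁆ (fun a => by
          rw [Derivation.commutator_apply]
          simp [hD', W.comm i j]) x
        rw [Derivation.commutator_apply, sub_eq_zero] at this
        exact this
      pow := by
        intro i x
        have h1 : ∀ n a, (D' i)^[n] (algebraMap E L a) = algebraMap E L ((W.D i)^[n] a) := by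
          intro n
          induction n with
          | zero => intro a; rfl
          | succ n ih => intro a; simp [Function.iterate_succ_apply, hD', ih]
        have := hz (derPow hp (D' i) - D' i) (fun a => by
          rw [Derivation.sub_apply, derPow_apply, h1, W.pow, hD', sub_self]) x
        rw [Derivation.sub_apply, derPow_apply, sub_eq_zero] at this
        exact this
      ynz := fun j hj => (map_ne_zero _).2 (W.ynz j hj)
      yself := fun j hj => by rw [hD', W.yself j hj]
      yother := fun j hj i hij => by rw [hD', W.yother j hj i hij, map_zero]
      off := fun j hj => by
        ext x
        exact hz (D' j) (fun a => by rw [hD', W.off j hj]; simp) x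
      fin := by
        intro x
        have hfin : ((⋃ i : Fin q, {j | W.D j (B.repr x i) ≠ 0}) ∪ {j | W.D j u ≠ 0}).Finite :=
          (Set.finite_iUnion fun i => W.fin _).union (W.fin u)
        refine hfin.subset fun j hj => ?_
        by_contra hcon
        simp only [Set.mem_union, Set.mem_iUnion, Set.mem_setOf_eq, not_or, not_exists,
          not_not] at hcon
        apply hj
        rw [hDx]
        simp [hcon.1, hcon.2] }
  have hlf : ∀ a, B.repr (algebraMap E L a) i0 = a := by
    intro a
    rw [Algebra.algebraMap_eq_smul_one, ← hB0]
    simp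
  obtain ⟨k, hk'⟩ := hqp
  have hrepr : ∀ (c : Fin q → E), B.repr (∑ i, c i • B i) i0 = c i0 := by
    intro c
    rw [B.repr_sum_self]
  let e : WDExt W W' :=
    { f := algebraMap E L
      lam := AddMonoidHom.mk' (fun x => B.repr x i0) (fun x y => by simp)
      J_eq := rfl
      f_D := hD'
      lam_f := hlf
      lam_pow := by
        intro x
        change B.repr (x ^ p) i0 = (B.repr x i0) ^ p
        have : x ^ p = ∑ i : Fin q, ((B.repr x i) ^ p * u ^ (k * (i : ℕ))) • B i := by
          conv_lhs => rw [← B.sum_repr x, sum_pow_char]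
          refine Finset.sum_congr rfl fun i _ => ?_
          rw [smul_pow, mul_smul]
          congr 1
          rw [Algebra.smul_def, map_pow, ← hh, hB, ← pow_mul, ← pow_mul, ← pow_add]
          congr 1
          have hp' : p = q * k + 1 := by have := hp.two_le; omega
          rw [hp']; ring
        rw [this, hrepr]
        simp [i0]
      lam_D := by
        intro j x
        change B.repr (D' j x) i0 = W.D j (B.repr x i0)
        rw [hDx, hrepr]
        simp [i0] }
  exact ⟨L, iF, iC, W', e, h, hh⟩

theorem WD.adjoin_root {p : ℕ} (hp : p.Prime) {K : Type*} (N : ℕ) : ∀ (hN : N ∣ p - 1)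
    {E : Type w} [Field E] [CharP E p] (W : WD p K E) (u : E) (hu0 : u ≠ 0),
    ∃ (E' : Type w) (_ : Field E') (_ : CharP E' p) (W' : WD p K E') (e : WDExt W W') (h : E'),
      h ^ N = e.f u := by
  induction N using Nat.strong_induction_on with
  | _ N ih =>
    intro hN E _ _ W u hu0
    have hp1 : p - 1 ≠ 0 := by have := hp.two_le; omega
    have hN0 : N ≠ 0 := by rintro rfl; exact hp1 (zero_dvd_iff.1 hN)
    by_cases h1 : N = 1
    · subst h1
      exact ⟨E, inferInstance, inferInstance, W, WDExt.refl W, u, by simp [WDExt.refl]⟩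
    obtain ⟨q, hq, N', rfl⟩ := Nat.exists_prime_and_dvd h1
    have hlt : N' < q * N' := by
      have := hq.two_le
      have : 0 < N' := Nat.pos_of_ne_zero (by rintro rfl; simp at hN0)
      nlinarith
    by_cases hc : ∃ c : E, c ^ q = u
    · obtain ⟨c, rfl⟩ := hc
      obtain ⟨E', i1, i2, W', e, h, hh⟩ := ih N' hlt ((dvd_mul_left _ _).trans hN) W c
        (by rintro rfl; simp [hq.ne_zero] at hu0)
      exact ⟨E', i1, i2, W', e, h, by rw [mul_comm, pow_mul, hh, map_pow]⟩
    · push Not at hc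
      obtain ⟨E₁, i1, i2, W₁, e₁, c, hc1⟩ := W.adjoin_prime hp q hq ((dvd_mul_right _ _).trans hN)
        u hu0 hc
      obtain ⟨E', i1, i2, W', e, h, hh⟩ := ih N' hlt ((dvd_mul_left _ _).trans hN) W₁ c
        (by rintro rfl; rw [zero_pow hq.ne_zero] at hc1; exact hu0 ((map_eq_zero _).1 hc1.symm))
      exact ⟨E', i1, i2, W', e₁.trans e, h, by
        rw [mul_comm, pow_mul, hh, ← map_pow, hc1]; rfl⟩

theorem WD.adjoin_roots {p : ℕ} (hp : p.Prime) {K : Type*} {ι : Type*} (l : List ι) :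
    ∀ {E : Type w} [Field E] [CharP E p] (W : WD p K E) (u : ι → E) (hu0 : ∀ s, u s ≠ 0),
    ∃ (E' : Type w) (_ : Field E') (_ : CharP E' p) (W' : WD p K E') (e : WDExt W W'),
      ∀ s ∈ l, ∃ h : E', h ^ (p - 1) = e.f (u s) := by
  induction l with
  | nil =>
    intro E _ _ W u _
    exact ⟨E, inferInstance, inferInstance, W, WDExt.refl W, by simp⟩
  | cons s l ih =>
    intro E _ _ W u hu0
    obtain ⟨E₁, i1, i2, W₁, e₁, h, hh⟩ := W.adjoin_root hp (p - 1) dvd_rfl (u s) (hu0 s)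
    obtain ⟨E', i1, i2, W', e, hl⟩ := ih W₁ (fun s => e₁.f (u s)) (fun s => (map_ne_zero _).2 (hu0 s))
    refine ⟨E', i1, i2, W', e₁.trans e, fun s' hs' => ?_⟩
    rcases List.mem_cons.1 hs' with rfl | hs'
    · exact ⟨e.f h, by rw [← map_pow, hh]; rfl⟩
    · exact hl s' hs'

end WDsec
end Part6

section Part7
set_option linter.all false
open Finset

section ColexWF
variable {I : Type*} [LinearOrder I]

open Finset.Colex in
theorem colex_wf [WellFoundedLT I] : WellFounded (fun s t : Finset I => toColex s < toColex t) := by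
  classical
  have h := Finsupp.Lex.wellFounded' (α := I) (N := ℕ) (r := (· > ·)) (s := (· < ·))
    (fun n => Nat.not_lt_zero n) Nat.lt_wfRel.wf (wellFounded_lt (α := I))
  refine Subrelation.wf ?_ (InvImage.wf
    (fun s : Finset I => Finsupp.indicator s (fun _ _ => (1 : ℕ))) h)
  intro s t hst
  obtain ⟨w, hw, hfil⟩ := Finset.Colex.lt_iff_exists_filter_lt.1 hst
  rw [mem_sdiff] at hw
  refine ⟨w, fun d hd => ?_, ?_⟩
  · have : d ∈ s ↔ d ∈ t := by
      have := Finset.ext_iff.1 hfil d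
      simp only [mem_filter] at this
      have hd' : w < d := hd
      tauto
    simp only [Finsupp.indicator_apply, this]
  · simp [Finsupp.indicator_apply, hw.1, hw.2]

open Finset.Colex

theorem colex_swap {σ : Finset I} {i j : I} (hi : i ∉ σ) (hj : j ∈ σ) (hji : j < i) :
    toColex σ < toColex ((insert i σ).erase j) := by
  rw [toColex_lt_toColex_iff_exists_forall_lt]
  refine ⟨i, by simp [hji.ne'], hi, fun b hb hb' => ?_⟩
  simp only [mem_erase, mem_insert, not_and, not_or] at hb'
  by_contra hcon
  have : b ≠ j := by rintro rfl; exact hcon hji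
  exact (hb' this).2 hb

theorem colex_insert_le {σ τ : Finset I} {a j : I} (hσ : ∀ x ∈ σ, x < a) (hj : j ∈ τ)
    (hja : j ≤ a) (h : toColex (τ.erase j) ≤ toColex σ) : toColex τ ≤ toColex (insert a σ) := by
  rw [toColex_le_toColex] at h ⊢
  intro x hx hx'
  simp only [mem_insert, not_or] at hx'
  by_cases hxj : x = j
  · subst hxj
    refine ⟨a, by simp, fun ha => ?_, hja⟩
    have hax : a ≠ x := Ne.symm hx'.1
    have haσ : a ∉ σ := fun h => (hσ a h).false
    obtain ⟨b, hb, _, hab⟩ := h (mem_erase.2 ⟨hax, ha⟩) haσ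
    exact (hσ b hb).not_ge hab
  · obtain ⟨b, hb, hb', hxb⟩ := h (mem_erase.2 ⟨hxj, hx⟩) hx'.2
    by_cases hbj : b = j
    · refine ⟨a, by simp, fun ha => ?_, hxb.trans (hσ b hb).le⟩
      have haj : a ≠ j := by rw [← hbj]; exact (hσ b hb).ne'
      have haσ : a ∉ σ := fun h => (hσ a h).false
      obtain ⟨c, hc, _, hac⟩ := h (mem_erase.2 ⟨haj, ha⟩) haσ
      exact (hσ c hc).not_ge hac
    · exact ⟨b, mem_insert_of_mem hb, fun hbt => hb' (mem_erase.2 ⟨hbj, hbt⟩), hxb⟩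
end ColexWF

section PTsec
variable {I : Type*} [LinearOrder I] {E : Type*} [Field E] {p : ℕ}

theorem exists_PT (p : ℕ) (D : I → Derivation ℤ E E) (hcomm : ∀ i j x, D i (D j x) = D j (D i x)) :
    ∃ P : Finset I → E → E, (∀ x, P ∅ x = x) ∧
      ∀ s T x, s ∉ T → P (insert s T) x = rho p (D s) (P T x) := by
  have hc : ∀ i j x, rho p (D i) (rho p (D j) x) = rho p (D j) (rho p (D i) x) := by
    intro i j x
    have h1 : ∀ n x, (D i)^[n] (rho p (D j) x) = rho p (D j) ((D i)^[n] x) := by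
      intro n
      induction n with
      | zero => intro x; rfl
      | succ n ih =>
        intro x
        rw [Function.iterate_succ_apply, der_rho_comm _ _ (hcomm i j), ih]; rfl
    rw [rho, h1]
    rw [← rho_sub]; rfl
  let f : I → Function.End E := fun s => rho p (D s)
  have hf : ∀ i j, Commute (f i) (f j) := fun i j => funext fun x => hc i j x
  have hpw : ∀ T : Finset I, (T : Set I).Pairwise (Function.onFun Commute f) := by
    intro T i _ j _ _
    exact hf i j
  let Q : Finset I → Function.End E := fun T => T.noncommProd f (hpw T)
  have h0 : Q ∅ = 1 := Finset.noncommProd_empty f _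
  have h1 : ∀ s T, s ∉ T → Q (insert s T) = f s * Q T := fun s T hs =>
    Finset.noncommProd_insert_of_notMem _ _ _ _ hs
  exact ⟨Q, fun x => congrFun h0 x, fun s T x hs => congrFun (h1 s T hs) x⟩

variable {P : Finset I → E → E} {D : I → Derivation ℤ E E}

/-- all the properties of `P` -/
structure PTProp (p : ℕ) (D : I → Derivation ℤ E E) (P : Finset I → E → E) : Prop where
  empty : ∀ x, P ∅ x = x
  ins : ∀ s T x, s ∉ T → P (insert s T) x = rho p (D s) (P T x)
  hcomm : ∀ i j x, D i (D j x) = D j (D i x)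
  hpow : ∀ i x, (D i)^[p] x = D i x

theorem PTProp.add (h : PTProp p D P) (T : Finset I) (x y : E) : P T (x + y) = P T x + P T y := by
  induction T using Finset.induction_on with
  | empty => simp [h.empty]
  | insert s T hs ih => rw [h.ins _ _ _ hs, h.ins _ _ _ hs, h.ins _ _ _ hs, ih, rho_add]

theorem PTProp.zero (h : PTProp p D P) (T : Finset I) : P T 0 = 0 := by
  have := h.add T 0 0; simpa using this

theorem PTProp.comm (h : PTProp p D P) (d : Derivation ℤ E E) (hd : ∀ i x, d (D i x) = D i (d x))
    (T : Finset I) (x : E) : d (P T x) = P T (d x) := by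
  induction T using Finset.induction_on with
  | empty => simp [h.empty]
  | insert s T hs ih => rw [h.ins _ _ _ hs, h.ins _ _ _ hs, der_rho_comm _ _ (hd s), ih]

theorem PTProp.const (h : PTProp p D P) (hp : p.Prime) (T : Finset I) (x : E)
    (hx : ∀ i ∈ T, D i x = 0) : P T x = x := by
  induction T using Finset.induction_on with
  | empty => simp [h.empty]
  | insert s T hs ih =>
    rw [h.ins _ _ _ hs, ih (fun i hi => hx i (mem_insert_of_mem hi)), rho_of_const hp _ _
      (hx s (mem_insert_self _ _))]

theorem PTProp.der (h : PTProp p D P) (hp : p.Prime) (T : Finset I) (x : E) (j : I) (hj : j ∈ T) :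
    P T (D j x) = 0 := by
  rw [← h.comm (D j) (fun i x => h.hcomm j i x)]
  rw [← Finset.insert_erase hj, h.ins _ _ _ (Finset.notMem_erase j T), der_rho hp _ (h.hpow j)]

theorem PTProp.mono (h : PTProp p D P) (T T' : Finset I) (hT : T' ⊆ T) (x : E)
    (hx : P T' x = 0) : P T x = 0 := by
  obtain ⟨S, rfl⟩ : ∃ S, T = S ∪ T' := ⟨T, (Finset.union_eq_left.2 hT).symm⟩
  clear hT
  induction S using Finset.induction_on with
  | empty => simpa using hx
  | insert s S hs ih =>
    rw [Finset.insert_union]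
    by_cases h' : s ∈ S ∪ T'
    · rw [Finset.insert_eq_of_mem h', ih]
    · rw [h.ins _ _ _ h', ih, rho_zero]

theorem PTProp.telescope (h : PTProp p D P) (σ : Finset I) (f : E) (hf : P σ f ≠ 0) :
    (∏ s ∈ σ, rho p (D s) (P (σ.filter (s < ·)) f) / P (σ.filter (s < ·)) f) = P σ f / f := by
  induction σ using Finset.induction_on_min with
  | empty =>
    rw [h.empty] at hf ⊢
    simp [hf]
  | insert a σ ha ih =>
    have ha' : a ∉ σ := fun h => (ha a h).false
    have hσ : P σ f ≠ 0 := fun h' => hf (h.mono _ σ (Finset.subset_insert _ _) _ h')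
    have h1 : ∀ s ∈ σ, (insert a σ).filter (s < ·) = σ.filter (s < ·) := by
      intro s hs
      rw [Finset.filter_insert, if_neg (ha s hs).not_gt]
    have h2 : (insert a σ).filter (a < ·) = σ := by
      rw [Finset.filter_insert, if_neg (lt_irrefl a), Finset.filter_true_of_mem ha]
    rw [Finset.prod_insert ha', h2, h.ins _ _ _ ha']
    rw [Finset.prod_congr rfl fun s hs => by rw [h1 s hs], ih hσ]
    field_simp

end PTsec
end Part7

section Part8
set_option linter.all false
open Finset

section PropN
universe w
variable {I : Type*} [LinearOrder I] {E : Type w} [Field E] {p : ℕ}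

theorem wd_der (d : Derivation ℤ E E) (α : I → E) (x : Finset I → E) (σ : Finset I) :
    d (wd α x σ) = wd (fun j => d (α j)) x σ + wd α (fun τ => d (x τ)) σ := by
  simp only [wd, map_sum, map_zsmul, ← Finset.sum_add_distrib]
  exact Finset.sum_congr rfl fun j _ => by rw [der_mul, smul_add, add_comm, ]

theorem wd_zero_left (x : Finset I → E) : wd (fun _ => (0 : E)) x = 0 := by
  funext σ; simp [wd]

theorem wd_der_x (d : Derivation ℤ E E) (α : I → E) (x : Finset I → E) (hx : ∀ τ, d (x τ) = 0)
    (σ : Finset I) : d (wd α x σ) = wd (fun j => d (α j)) x σ := by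
  rw [wd_der]
  have : (fun τ => d (x τ)) = (0 : Finset I → E) := funext hx
  rw [this, wd_zero]; simp

theorem wd_const (d : Derivation ℤ E E) (α : I → E) (x : Finset I → E) (hα : ∀ j, d (α j) = 0)
    (hx : ∀ τ, d (x τ) = 0) (σ : Finset I) : d (wd α x σ) = 0 := by
  rw [wd_der_x d α x hx]
  simp only [hα, wd_zero_left]; rfl

theorem dd_const (d : Derivation ℤ E E) (D : I → Derivation ℤ E E)
    (hd : ∀ j a, d (D j a) = D j (d a)) (x : Finset I → E)
    (hx : ∀ τ, d (x τ) = 0) (σ : Finset I) : d (dd D x σ) = 0 := by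
  have := congrFun (dd_map D D (d : E →+ E) hd x) σ
  have h2 : (fun σ => (d : E →+ E) (x σ)) = (0 : Finset I → E) := funext hx
  rw [h2, dd_zero] at this
  exact this.symm

theorem rho_wd (d : Derivation ℤ E E) (α : I → E) (x : Finset I → E)
    (hx : ∀ τ, d (x τ) = 0) (σ : Finset I) :
    rho p d (wd α x σ) = wd (fun j => rho p d (α j)) x σ := by
  simp only [wd]
  rw [rho_sum]
  refine Finset.sum_congr rfl fun j _ => ?_
  have h1 : ∀ (n : ℤ) (a : E), rho p d (n • a) = n • rho p d a := fun n a =>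
    map_zsmul (rhoHom p d) n a
  rw [h1, mul_comm, rho_const_mul _ _ _ (hx _), mul_comm]

theorem rho_dd (d : Derivation ℤ E E) (D : I → Derivation ℤ E E)
    (hd : ∀ j a, D j (d a) = d (D j a)) (x : Finset I → E) :
    dd D (fun σ => rho p d (x σ)) = fun σ => rho p d (dd D x σ) :=
  dd_map D D (rhoHom p d) (fun j a => (der_rho_comm (D j) d (hd j) a).symm) x

theorem dd_const_smul (D : I → Derivation ℤ E E) (c : E) (hc : ∀ j, D j c = 0) (x : Finset I → E) :
    dd D (c • x) = c • dd D x := by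
  rw [dd_smul]; simp only [hc, wd_zero_left, zero_add]

namespace WD
/-- the derivations `D i` -/
def Di (W : WD p (Option I) E) (i : I) : Derivation ℤ E E := W.D (some i)
/-- the special derivation -/
def dl0 (W : WD p (Option I) E) : Derivation ℤ E E := W.D none

def Hyp (W : WD p (Option I) E) (v : Finset I → E) : Prop :=
  ∃ z, FS z ∧ (∀ σ, W.dl0 (z σ) = 0) ∧ ∀ σ, rho p W.dl0 (v σ) - v σ ^ p = dd W.Di z σ

def Good (W : WD p (Option I) E) (v : Finset I → E) : Prop :=
  ∃ U z, FS U ∧ FS z ∧ (∀ σ, W.dl0 (z σ) = 0) ∧ (∀ σ, W.dl0 (U σ) = dd W.Di v σ) ∧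
    ∀ σ, U σ ^ p - rho p W.dl0 (U σ) = dd W.Di z σ

variable (W : WD p (Option I) E)

theorem Di_comm (i j : I) (x : E) : W.Di i (W.Di j x) = W.Di j (W.Di i x) := W.comm _ _ _
theorem Di_dl0 (i : I) (x : E) : W.Di i (W.dl0 x) = W.dl0 (W.Di i x) := W.comm _ _ _
theorem Di_fin (x : E) : {j | W.Di j x ≠ 0}.Finite :=
  (W.fin x).preimage (f := some) (Option.some_injective _).injOn
theorem dl0_pow (x : E) : (W.dl0)^[p] x = W.dl0 x := W.pow _ _

section
variable [Fact p.Prime] [CharP E p]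

theorem Hyp.sub {W : WD p (Option I) E} {v v' : Finset I → E} (h : W.Hyp v) (h' : W.Hyp v') :
    W.Hyp (v - v') := by
  obtain ⟨z, hz, hz1, hz2⟩ := h
  obtain ⟨z', hz', hz1', hz2'⟩ := h'
  refine ⟨z - z', hz.sub hz', fun σ => by simp [hz1, hz1'], fun σ => ?_⟩
  rw [dd_sub, Pi.sub_apply, Pi.sub_apply, ← hz2, ← hz2', rho_sub, sub_pow_char (p := p)]; ring

theorem Good.add {W : WD p (Option I) E} {v v' : Finset I → E} (h : W.Good v) (h' : W.Good v') :
    W.Good (v + v') := by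
  obtain ⟨U, z, hU, hz, hz1, hz2, hz3⟩ := h
  obtain ⟨U', z', hU', hz', hz1', hz2', hz3'⟩ := h'
  refine ⟨U + U', z + z', hU.add hU', hz.add hz', fun σ => by simp [hz1, hz1'],
    fun σ => by rw [dd_add, Pi.add_apply, Pi.add_apply, map_add, hz2, hz2'], fun σ => ?_⟩
  rw [dd_add, Pi.add_apply, Pi.add_apply, ← hz3, ← hz3', rho_add, add_pow_char (p := p)]; ring

theorem Good.zero : W.Good 0 :=
  ⟨0, 0, FS.zero, FS.zero, by simp, by simp [dd_zero], by
    intro σ; simp [dd_zero, rho_zero, (Fact.out : p.Prime).ne_zero]⟩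
end

theorem good_descent {E' : Type w} [Field E'] (W' : WD p (Option I) E') (e : WDExt W W')
    (v : Finset I → E) (h : W'.Good (fun σ => e.f (v σ))) : W.Good v := by
  obtain ⟨U, z, hU, hz, hz1, hz2, hz3⟩ := h
  have hit : ∀ n x, e.lam ((W'.dl0)^[n] x) = (W.dl0)^[n] (e.lam x) := by
    intro n
    induction n with
    | zero => intro x; rfl
    | succ n ih =>
      intro x; rw [Function.iterate_succ_apply, ih, Function.iterate_succ_apply]
      exact congrArg _ (e.lam_D _ _)
  have hl : ∀ x, e.lam (rho p W'.dl0 x) = rho p W.dl0 (e.lam x) := by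
    intro x; rw [rho, map_sub, hit]; rfl
  have hdd := fun x => dd_map W'.Di W.Di e.lam (fun j a => e.lam_D _ _) x
  refine ⟨fun σ => e.lam (U σ), fun σ => e.lam (z σ), hU.map (fun _ => e.lam) (by simp),
    hz.map (fun _ => e.lam) (by simp), fun σ => ?_, fun σ => ?_, fun σ => ?_⟩
  · have := e.lam_D none (z σ)
    rw [dl0, ← this]
    exact (congrArg _ (hz1 σ)).trans (map_zero _)
  · have := e.lam_D none (U σ)
    rw [dl0, ← this]
    refine (congrArg _ (hz2 σ)).trans ?_
    have h1 := congrFun (hdd (fun σ => e.f (v σ))) σ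
    rw [← h1]
    simp only [e.lam_f]
  · rw [← e.lam_pow, ← hl, ← map_sub, hz3, hdd]

theorem hyp_ext {E' : Type w} [Field E'] (W' : WD p (Option I) E') (e : WDExt W W')
    (v : Finset I → E) (h : W.Hyp v) : W'.Hyp (fun σ => e.f (v σ)) := by
  obtain ⟨z, hz, hz1, hz2⟩ := h
  have hit : ∀ n x, e.f ((W.dl0)^[n] x) = (W'.dl0)^[n] (e.f x) := by
    intro n
    induction n with
    | zero => intro x; rfl
    | succ n ih =>
      intro x; rw [Function.iterate_succ_apply, ih, Function.iterate_succ_apply]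
      exact congrArg _ (e.f_D _ _).symm
  have hl : ∀ x, e.f (rho p W.dl0 x) = rho p W'.dl0 (e.f x) := by
    intro x; rw [rho, map_sub, hit]; rfl
  refine ⟨fun σ => e.f (z σ), hz.map (fun _ => e.f) (by simp), fun σ => ?_, fun σ => ?_⟩
  · have := e.f_D none (z σ)
    rw [dl0, this]
    exact (congrArg _ (hz1 σ)).trans (map_zero _)
  · have hdd := dd_map W.Di W'.Di (e.f : E →+ E') (fun j a => (e.f_D _ _).symm) z
    have := congrFun hdd σ
    simp only [AddMonoidHom.coe_coe] at this
    rw [this, ← hl, ← map_pow, ← map_sub, hz2]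

/-- The log product form. -/
structure LogX (W : WD p (Option I) E) (σ : Finset I) (h : I → E) (X : Finset I → E) : Prop where
  fs : FS X
  top : ∃ ε : E, ε * ε = 1 ∧ W.dl0 ε = 0 ∧ X σ = ε * ∏ s ∈ σ, h s
  above : ∀ τ, toColex σ < toColex τ → X τ = 0
  closed : dd W.Di X = 0
  const : ∀ τ, W.dl0 (X τ) = 0
  cart : ∃ ξ, FS ξ ∧ (∀ τ, W.dl0 (ξ τ) = 0) ∧ sc p X = X + dd W.Di ξ
  supp : ∀ τ, X τ ≠ 0 → ∀ i ∈ τ, some i ∈ W.J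

theorem exists_logX (hp : p.Prime) [CharP E p] (h c : I → E) (σ : Finset I)
    (hc0 : ∀ s ∈ σ, c s ≠ 0) (hcd : ∀ s ∈ σ, W.dl0 (c s) = 0)
    (hcs : ∀ s ∈ σ, W.Di s (c s) = h s * c s) (hcgt : ∀ s ∈ σ, ∀ i, s < i → W.Di i (c s) = 0) :
    ∃ X, LogX W σ h X := by
  have hF := Fact.mk hp
  induction σ using Finset.induction_on_max with
  | empty =>
    refine ⟨Pi.single ∅ 1, ?_, ⟨1, by simp, by simp, by simp⟩, ?_, ?_, ?_, ⟨0, FS.zero, by simp, ?_⟩, ?_⟩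
    · exact (Set.finite_singleton ∅).subset (by
        intro τ hτ
        by_contra hcon
        exact hτ (by rw [Pi.single_eq_of_ne hcon]))
    · intro τ hτ
      exact Pi.single_eq_of_ne (by rintro rfl; exact lt_irrefl _ hτ) _
    · funext τ
      simp only [dd, Pi.zero_apply]
      refine Finset.sum_eq_zero fun j _ => ?_
      by_cases hj : τ.erase j = ∅
      · rw [hj]; simp
      · rw [Pi.single_eq_of_ne hj]; simp
    · intro τ
      by_cases hj : τ = ∅
      · rw [hj]; simp
      · rw [Pi.single_eq_of_ne hj]; simp
    · rw [dd_zero, add_zero]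
      funext τ
      by_cases hj : τ = ∅
      · rw [hj]; simp [sc]
      · rw [sc, Pi.single_eq_of_ne hj, zero_pow hp.ne_zero]
    · intro τ hτ i hi
      rw [Pi.single_eq_of_ne (by rintro rfl; simp at hi)] at hτ
      exact absurd rfl hτ
  | insert a σ ha ih =>
    obtain ⟨X, hX⟩ := ih (fun s hs => hc0 s (mem_insert_of_mem hs))
      (fun s hs => hcd s (mem_insert_of_mem hs)) (fun s hs => hcs s (mem_insert_of_mem hs))
      (fun s hs => hcgt s (mem_insert_of_mem hs))
    have haσ : a ∉ σ := fun h => (ha a h).false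
    have ham := mem_insert_self a σ
    have hc0 := hc0 a ham
    have hcd := hcd a ham
    have hcs := hcs a ham
    have hcgt := hcgt a ham
    set α := dl W.Di (c a) with hα
    have hαa : α a = h a := by rw [hα, dl, hcs]; field_simp
    have hαgt : ∀ i, a < i → α i = 0 := fun i hi => by rw [hα, dl, hcgt i hi, mul_zero]
    have hαd : ∀ i, W.dl0 (α i) = 0 := by
      intro i
      have h1 : W.dl0 (c a)⁻¹ = 0 := by
        rw [Derivation.leibniz_inv, hcd]; simp
      rw [hα, dl, der_mul, h1, ← W.Di_dl0, hcd]; simp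
    have hαcl : ∀ i j, W.Di i (α j) = W.Di j (α i) := dl_closed _ W.Di_comm _
    obtain ⟨η, hη⟩ := cartier_log hp W.D W.comm W.pow W.fin (c a)
    have hηd : W.dl0 η = 0 := by
      have h1 := hη none
      change ((c a)⁻¹ * W.dl0 (c a)) ^ p = (c a)⁻¹ * W.dl0 (c a) + W.dl0 η at h1
      rw [hcd] at h1
      simpa [hp.ne_zero] using h1.symm
    have hηα : (fun j => α j ^ p) = α + fun j => W.Di j η := funext fun j => hη (some j)
    obtain ⟨ξ, hξ, hξd, hξc⟩ := hX.cart
    obtain ⟨ε, hε, hεd, hεX⟩ := hX.top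
    refine ⟨wd α X, hX.fs.wd (dl_fin W.Di_fin _), ?_, ?_, ?_, ?_, ?_, ?_⟩
    · refine ⟨(eps a (insert a σ) : ℤ) * ε, ?_, ?_, ?_⟩
      · have : ((eps a (insert a σ) : ℤ) : E) * (eps a (insert a σ) : ℤ) = 1 := by
          rw [← Int.cast_mul, eps, ← pow_add, ← two_mul, pow_mul]; simp
        linear_combination ε * ε * this + hε
      · rw [der_mul, hεd]; simp
      · rw [wd, Finset.sum_eq_single a]
        · rw [Finset.erase_insert haσ, hεX, hαa, Finset.prod_insert haσ, zsmul_eq_mul]; ring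
        · intro j hj hja
          have hjσ : j ∈ σ := (mem_insert.1 hj).resolve_left hja
          rw [hX.above _ (colex_swap haσ hjσ (ha j hjσ))]; simp
        · intro h; exact absurd ham h
    · intro τ hτ
      rw [wd]
      refine Finset.sum_eq_zero fun j hj => ?_
      by_cases hja : j ≤ a
      · have : toColex σ < toColex (τ.erase j) := by
          by_contra hcon
          exact hτ.not_ge (colex_insert_le ha hj hja (not_lt.1 hcon))
        rw [hX.above _ this]; simp
      · rw [hαgt j (not_le.1 hja)]; simp
    · rw [dd_wd _ _ hαcl, hX.closed, wd_zero, neg_zero]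
    · exact wd_const _ _ _ hαd hX.const
    · refine ⟨-wd α ξ + η • (X + dd W.Di ξ), ?_, ?_, ?_⟩
      · exact (hξ.wd (dl_fin W.Di_fin _)).neg.add ((hX.fs.add (hξ.dd W.Di_fin)).smul η)
      · intro τ
        have h1 := wd_const W.dl0 α ξ hαd hξd τ
        have h2 := dd_const W.dl0 W.Di (fun j a => (W.Di_dl0 j a).symm) ξ hξd τ
        simp only [Pi.add_apply, Pi.neg_apply, Pi.smul_apply, smul_eq_mul, map_add, map_neg,
          der_mul, h1, h2, hηd, hX.const]
        simp
      · rw [sc_wd, hηα, hξc, wd_add_left, dd_add, dd_neg, dd_smul, dd_wd _ _ hαcl, dd_add,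
          hX.closed, dd_dd _ W.Di_comm, wd_add]
        simp only [add_zero, smul_zero, neg_neg]
        abel
    · intro τ hτ i hi
      obtain ⟨j, hj, hne⟩ := Finset.exists_ne_zero_of_sum_ne_zero hτ
      by_cases hij : i = j
      · subst hij
        by_contra hcon
        apply hne
        rw [hα, dl, Di, W.off _ hcon]; simp
      · refine hX.supp (τ.erase j) ?_ i (mem_erase.2 ⟨hij, hi⟩)
        intro h0; apply hne; rw [h0]; simp

/-- log forms are good -/
theorem good_logX (hp : p.Prime) [CharP E p] (σ : Finset I) (h : I → E) (X : Finset I → E)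
    (hX : LogX W σ h X) (a w : E) (ha : a ≠ 0) (hw : W.dl0 a = w * a) : W.Good (w • X) := by
  have hF := Fact.mk hp
  obtain ⟨ξ, hξ, hξd, hξc⟩ := hX.cart
  set α := dl W.Di a with hα
  have hαcl : ∀ i j, W.Di i (α j) = W.Di j (α i) := dl_closed _ W.Di_comm _
  obtain ⟨η, hη⟩ := cartier_log hp W.D W.comm W.pow W.fin a
  have hηα : ∀ j, α j ^ p = α j + W.Di j η := fun j => hη (some j)
  set κ := rho p W.dl0 η with hκ
  have hκd : W.dl0 κ = 0 := der_rho hp _ W.dl0_pow _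
  set β : I → E := fun j => rho p W.dl0 (α j) with hβ
  have hβd : ∀ j, W.dl0 (β j) = 0 := fun j => der_rho hp _ W.dl0_pow _
  have hβcl : ∀ i j, W.Di i (β j) = W.Di j (β i) := fun i j => by
    rw [hβ]; simp only
    rw [der_rho_comm _ _ (W.Di_dl0 i), der_rho_comm _ _ (W.Di_dl0 j), hαcl]
  have hαβ : (fun j => α j ^ p) = β + fun j => W.Di j κ := by
    funext j
    have h1 := congrArg (rho p W.dl0) (hηα j)
    rw [rho_of_const hp _ _ (der_pow_p _ _), rho_add, ← der_rho_comm _ _ (W.Di_dl0 j)] at h1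
    exact h1
  have hw' : a⁻¹ * W.dl0 a = w := by rw [hw]; field_simp
  have hwα : ∀ j, W.dl0 (α j) = W.Di j w := by
    intro j
    have h1 : W.dl0 a⁻¹ = -(a⁻¹ * a⁻¹ * W.dl0 a) := by
      rw [Derivation.leibniz_inv]; simp [pow_two]
    have h2 : W.Di j a⁻¹ = -(a⁻¹ * a⁻¹ * W.Di j a) := by
      rw [Derivation.leibniz_inv]; simp [pow_two]
    rw [hα, dl, ← hw', der_mul, der_mul, h1, h2, W.Di_dl0]; ring
  refine ⟨wd α X, -wd β ξ + κ • (X + dd W.Di ξ), hX.fs.wd (dl_fin W.Di_fin _), ?_, ?_, ?_, ?_⟩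
  · refine FS.add (FS.neg (hξ.wd ?_)) ((hX.fs.add (hξ.dd W.Di_fin)).smul κ)
    exact (dl_fin W.Di_fin a).subset fun j hj h0 => hj (by
      rw [hβ]; simp only; rw [hα, h0, rho_zero])
  · intro τ
    have h1 := wd_const W.dl0 β ξ hβd hξd τ
    have h2 := dd_const W.dl0 W.Di (fun j a => (W.Di_dl0 j a).symm) ξ hξd τ
    simp only [Pi.add_apply, Pi.neg_apply, Pi.smul_apply, smul_eq_mul, map_add, map_neg,
      der_mul, h1, h2, hκd, hX.const]
    simp
  · intro τ
    rw [wd_der_x _ _ _ hX.const, dd_smul, hX.closed]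
    simp only [hwα, smul_zero, add_zero]
  · intro τ
    rw [rho_wd _ _ _ hX.const]
    have h1 := congrFun (sc_wd (p := p) α X) τ
    rw [sc] at h1
    rw [h1, hαβ, hξc, wd_add_left, dd_add, dd_neg, dd_smul, dd_wd _ _ hβcl, dd_add,
          hX.closed, dd_dd _ W.Di_comm, wd_add]
    simp only [add_zero, smul_zero, neg_neg, Pi.add_apply]
    ring

theorem hyp_logX (hp : p.Prime) [CharP E p] (σ : Finset I) (h : I → E) (X : Finset I → E)
    (hX : LogX W σ h X) (w : E) (hw : w ^ p = rho p W.dl0 w) : W.Hyp (w • X) := by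
  obtain ⟨ξ, hξ, hξd, hξc⟩ := hX.cart
  refine ⟨-(w ^ p • ξ), (hξ.smul _).neg, fun τ => ?_, fun τ => ?_⟩
  · simp [der_mul, hξd, der_pow_p]
  · rw [dd_neg, dd_const_smul _ _ (fun j => der_pow_p _ _)]
    have h1 := congrFun hξc τ
    rw [sc, Pi.add_apply] at h1
    simp only [Pi.smul_apply, smul_eq_mul, Pi.neg_apply, mul_pow, h1]
    rw [mul_comm w, rho_const_mul _ _ _ (hX.const τ), ← hw]
    ring

end WD
end PropN
end Part8

section Part9
set_option linter.all false
open Finset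

section PropN2
universe w
variable {I : Type*} [LinearOrder I] {E : Type w} [Field E] {p : ℕ}

theorem der_div_const (d : Derivation ℤ E E) (a b : E) (ha : d a = 0) (hb : d b = 0) :
    d (a / b) = 0 := by
  rw [div_eq_mul_inv, der_mul, ha, Derivation.leibniz_inv, hb]; simp

namespace WD
variable (W : WD p (Option I) E)

theorem top_facts (hp : p.Prime) [CharP E p] (v : Finset I → E) (hv : W.Hyp v) (σ : Finset I)
    (hσ : ∀ τ, toColex σ < toColex τ → v τ = 0) (P : Finset I → E → E) (hP : PTProp p W.Di P) :
    P σ (rho p W.dl0 (v σ)) = v σ ^ p ∧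
    (∀ T, W.dl0 (P T (rho p W.dl0 (v σ))) = 0) ∧
    ∀ s i, s < i → W.Di i (P (σ.filter (s < ·)) (rho p W.dl0 (v σ))) = 0 := by
  have hF := Fact.mk hp
  obtain ⟨z, hz, hzd, hz2⟩ := hv
  set g : Finset I → E := fun τ => rho p W.dl0 (v τ) with hg
  have hPz : ∀ T n x, P T ((n : ℤ) • x) = n • P T x := fun T n x =>
    map_zsmul (AddMonoidHom.mk' (P T) (hP.add T)) n x
  have hPs : ∀ T (S : Finset I) (φ : I → E), P T (∑ j ∈ S, φ j) = ∑ j ∈ S, P T (φ j) :=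
    fun T S φ => map_sum (AddMonoidHom.mk' (P T) (hP.add T)) φ S
  have hdg : dd W.Di g = 0 := by
    have : g = sc p v + dd W.Di z := by
      funext τ
      rw [Pi.add_apply, ← hz2, sc]; ring
    rw [this, dd_add, dd_sc, dd_dd _ W.Di_comm, add_zero]
  have hgσ : ∀ τ, toColex σ < toColex τ → g τ = 0 := fun τ h => by
    rw [hg]; simp only; rw [hσ τ h, rho_zero]
  refine ⟨?_, ?_, ?_⟩
  · have h1 : g σ = v σ ^ p + dd W.Di z σ := by rw [← hz2]; ring
    change P σ (g σ) = _
    rw [h1, hP.add, hP.const hp σ _ (fun i _ => der_pow_p _ _), dd, hPs]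
    rw [Finset.sum_eq_zero, add_zero]
    intro j hj
    rw [hPz, hP.der hp _ _ _ hj, smul_zero]
  · intro T
    rw [hP.comm W.dl0 (fun i x => (W.Di_dl0 i x).symm), der_rho hp _ W.dl0_pow, hP.zero]
  · intro s i hsi
    by_cases hi : i ∈ σ
    · rw [hP.comm (W.Di i) (fun j x => W.Di_comm i j x), hP.der hp _ _ _]
      simp [hi, hsi]
    · have h1 : P (σ.filter (i < ·)) (W.Di i (g σ)) = 0 := by
        have h2 := congrFun hdg (insert i σ)
        rw [dd, Finset.sum_insert hi, Finset.erase_insert hi] at h2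
        have h3 := congrArg (P (σ.filter (i < ·))) h2
        rw [hP.add, hPs, Pi.zero_apply, hP.zero, Finset.sum_eq_zero, add_zero, hPz] at h3
        · have h4 : eps i (insert i σ) * eps i (insert i σ) = 1 := by
            rw [eps, ← pow_add, ← two_mul, pow_mul]; simp
          have h5 := congrArg (fun x => eps i (insert i σ) • x) h3
          simp only [smul_smul, h4, one_smul, smul_zero] at h5
          exact h5
        · intro j hj
          rw [hPz]
          have hij : i ≠ j := by rintro rfl; exact hi hj
          rcases lt_or_gt_of_ne hij with h | h
          · rw [hP.der hp _ _ _ (by simp [hj, h]), smul_zero]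
          · rw [hgσ _ (colex_swap hi hj h), map_zero, hP.zero, smul_zero]
      rw [hP.comm (W.Di i) (fun j x => W.Di_comm i j x)]
      refine hP.mono _ _ ?_ _ h1
      intro j hj
      simp only [mem_filter] at hj ⊢
      exact ⟨hj.1, hsi.trans hj.2⟩

theorem step_roots (hp : p.Prime) [CharP E p] (hnone : none ∈ W.J) (v : Finset I → E)
    (hv : W.Hyp v) (σ : Finset I) (hvσ : v σ ≠ 0)
    (hσ : ∀ τ, toColex σ < toColex τ → v τ = 0) (hJ : ∀ i ∈ σ, some i ∈ W.J)
    (P : Finset I → E → E) (hP : PTProp p W.Di P)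
    (hroot : ∀ s ∈ σ, ∃ h : E, h ^ (p - 1) =
      rho p (W.Di s) (P (σ.filter (s < ·)) (rho p W.dl0 (v σ))) /
        P (σ.filter (s < ·)) (rho p W.dl0 (v σ))) :
    ∃ v1, FS v1 ∧ W.Hyp v1 ∧ W.Good v1 ∧ v1 σ = v σ ∧ (∀ τ, toColex σ < toColex τ → v1 τ = 0) ∧
      (∀ τ, v1 τ ≠ 0 → ∀ i ∈ τ, some i ∈ W.J) := by
  have hF := Fact.mk hp
  obtain ⟨h1, h2, h3⟩ := W.top_facts hp v hv σ hσ P hP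
  set f := rho p W.dl0 (v σ) with hf
  have hPf : P σ f ≠ 0 := by rw [h1]; exact pow_ne_zero _ hvσ
  have hfs : ∀ s, P (σ.filter (s < ·)) f ≠ 0 := fun s h0 =>
    hPf (hP.mono _ _ (filter_subset _ _) _ h0)
  have hrfs : ∀ s ∈ σ, rho p (W.Di s) (P (σ.filter (s < ·)) f) ≠ 0 := by
    intro s hs h0
    rw [← hP.ins _ _ _ (by simp)] at h0
    refine hPf (hP.mono _ _ ?_ _ h0)
    intro j hj
    rcases mem_insert.1 hj with rfl | hj
    · exact hs
    · exact filter_subset _ _ hj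
  have hf0 : f ≠ 0 := fun h0 => hPf (by rw [h0, hP.zero])
  have hroot' : ∃ h : I → E, ∀ s ∈ σ, h s ^ (p - 1) =
      rho p (W.Di s) (P (σ.filter (s < ·)) f) / P (σ.filter (s < ·)) f := by
    classical
    choose! h hh using hroot
    exact ⟨h, hh⟩
  obtain ⟨h, hh⟩ := hroot'
  have hh0 : ∀ s ∈ σ, h s ≠ 0 := by
    intro s hs h0
    have := hh s hs
    rw [h0, zero_pow (by have := hp.two_le; omega)] at this
    exact div_ne_zero (hrfs s hs) (hfs s) this.symm
  have hhp : ∀ s ∈ σ, h s ^ p = h s *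
      (rho p (W.Di s) (P (σ.filter (s < ·)) f) / P (σ.filter (s < ·)) f) := by
    intro s hs
    rw [← hh s hs, ← pow_succ']
    congr 1; have := hp.two_le; omega
  have hheq : ∀ s ∈ σ, h s = (h s ^ p / rho p (W.Di s) (P (σ.filter (s < ·)) f)) *
      P (σ.filter (s < ·)) f := by
    intro s hs
    have a1 := hrfs s hs
    have a2 := hfs s
    rw [hhp s hs]
    field_simp
  have hconst : ∀ d : Derivation ℤ E E, ∀ s ∈ σ, (∀ i x, d (W.Di i x) = W.Di i (d x)) →
      d (P (σ.filter (s < ·)) f) = 0 → d (h s) = 0 := by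
    intro d s hs hd h0
    rw [hheq s hs, der_mul, h0, der_div_const d _ _ (der_pow_p d _)]
    · simp
    · rw [der_rho_comm _ _ (hd s), h0, rho_zero]
  have hrho : ∀ s ∈ σ, h s ^ p = rho p (W.Di s) (h s) := by
    intro s hs
    conv_rhs => rw [hheq s hs]
    rw [rho_const_mul]
    · have a1 := hrfs s hs
      field_simp
    · exact der_div_const _ _ _ (der_pow_p _ _) (der_rho hp _ (fun x => W.pow _ x) _)
  have hjac : ∀ s ∈ σ, ∃ c, c ≠ 0 ∧ W.dl0 c = 0 ∧ W.Di s c = h s * c ∧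
      ∀ i, s < i → W.Di i c = 0 := by
    intro s hs
    let K : Subring E :=
      { carrier := {x | W.dl0 x = 0 ∧ ∀ i, s < i → W.Di i x = 0}
        mul_mem' := by
          rintro a b ⟨a1, a2⟩ ⟨b1, b2⟩
          exact ⟨by rw [der_mul, a1, b1]; simp, fun i hi => by rw [der_mul, a2 i hi, b2 i hi]; simp⟩
        one_mem' := by simp
        add_mem' := by
          rintro a b ⟨a1, a2⟩ ⟨b1, b2⟩
          exact ⟨by rw [map_add, a1, b1]; simp, fun i hi => by rw [map_add, a2 i hi, b2 i hi]; simp⟩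
        zero_mem' := by simp
        neg_mem' := by
          rintro a ⟨a1, a2⟩
          exact ⟨by rw [map_neg, a1]; simp, fun i hi => by rw [map_neg, a2 i hi]; simp⟩ }
    obtain ⟨c, hcK, hc0, hc⟩ := jacobson hp (W.Di s) (fun x => W.pow _ x) K
      (by
        rintro x ⟨x1, x2⟩
        exact ⟨by rw [← W.Di_dl0, x1, map_zero], fun i hi => by
          rw [W.Di_comm, x2 i hi, map_zero]⟩) (h s)
      ⟨hconst _ s hs (fun i x => (W.Di_dl0 i x).symm) (h2 _),
        fun i hi => hconst _ s hs (fun j x => W.Di_comm i j x) (h3 s i hi)⟩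
      (hrho s hs) (W.y (some s))
      ⟨W.yother _ (hJ s hs) none (by simp), fun i hi => W.yother _ (hJ s hs) (some i) (by
        simp [hi.ne'])⟩ (W.ynz _ (hJ s hs)) (W.yself _ (hJ s hs))
    exact ⟨c, hc0, hcK.1, hc, hcK.2⟩
  choose! c hc0 hcd hcs hcgt using hjac
  obtain ⟨X, hX⟩ := W.exists_logX hp h c σ hc0 hcd hcs hcgt
  obtain ⟨ε, hε, hεd, hεX⟩ := hX.top
  have hprod0 : (∏ s ∈ σ, h s) ≠ 0 := Finset.prod_ne_zero_iff.2 hh0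
  have hprodd : W.dl0 (∏ s ∈ σ, h s) = 0 := by
    refine Finset.prod_induction (p := fun x => W.dl0 x = 0) h
      (fun a b ha hb => by rw [der_mul, ha, hb]; simp) (by simp)
      (fun s hs => hconst _ s hs (fun i x => (W.Di_dl0 i x).symm) (h2 _))
  set w0 := v σ / ∏ s ∈ σ, h s with hw0
  have hw0p : w0 ^ p = rho p W.dl0 w0 := by
    have e1 : (∏ s ∈ σ, h s) ^ p = (∏ s ∈ σ, h s) * (P σ f / f) := by
      rw [← Finset.prod_pow, Finset.prod_congr rfl hhp, Finset.prod_mul_distrib,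
        hP.telescope σ f hPf]
    have e2 : rho p W.dl0 w0 = (∏ s ∈ σ, h s)⁻¹ * f := by
      rw [hw0, div_eq_mul_inv, mul_comm, rho_const_mul]
      have := der_div_const W.dl0 1 _ (by simp) hprodd
      simpa using this
    rw [e2, hw0, div_pow, e1, ← h1]
    field_simp
  obtain ⟨a, -, ha0, ha⟩ := jacobson hp W.dl0 W.dl0_pow ⊤ (by simp) w0 (by simp) hw0p
    (W.y none) (by simp) (W.ynz _ hnone) (W.yself _ hnone)
  -- sign
  have hε1 : ε = 1 ∨ ε = -1 := mul_self_eq_one_iff.1 hε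
  have key : ∀ w : E, w = ε * w0 → (∃ a, a ≠ 0 ∧ W.dl0 a = w * a) → w ^ p = rho p W.dl0 w →
      ∃ v1, FS v1 ∧ W.Hyp v1 ∧ W.Good v1 ∧ v1 σ = v σ ∧
        (∀ τ, toColex σ < toColex τ → v1 τ = 0) ∧
      (∀ τ, v1 τ ≠ 0 → ∀ i ∈ τ, some i ∈ W.J) := by
    rintro w hw ⟨a, ha0, ha⟩ hwp
    refine ⟨w • X, hX.fs.smul w, W.hyp_logX hp σ h X hX w hwp, W.good_logX hp σ h X hX a w ha0 ha,
      ?_, ?_, ?_⟩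
    · rw [Pi.smul_apply, hεX, hw, hw0, smul_eq_mul]
      field_simp
      linear_combination hε
    · intro τ hτ; rw [Pi.smul_apply, hX.above τ hτ, smul_zero]
    · intro τ hτ; exact hX.supp τ (fun h0 => hτ (by rw [Pi.smul_apply, h0, smul_zero]))
  rcases hε1 with rfl | rfl
  · exact key w0 (by ring) ⟨a, ha0, ha⟩ hw0p
  · refine key (-w0) (by ring) ⟨a⁻¹, inv_ne_zero ha0, ?_⟩ ?_
    · rw [Derivation.leibniz_inv, ha]; simp only [smul_eq_mul]; field_simp
    · rw [rho_neg, ← hw0p]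
      have := sub_pow_char (p := p) (0 : E) w0
      simpa [hp.ne_zero] using this

theorem propN_aux (hp : p.Prime) [WellFoundedLT I] (σ : Finset I) :
    ∀ {E : Type w} [Field E] [CharP E p] (W : WD p (Option I) E) (hnone : none ∈ W.J)
      (v : Finset I → E), FS v → W.Hyp v → (∀ τ, toColex σ < toColex τ → v τ = 0) →
      (∀ τ, v τ ≠ 0 → ∀ i ∈ τ, some i ∈ W.J) → W.Good v := by
  have hF := Fact.mk hp
  induction σ using (colex_wf (I := I)).induction with
  | _ σ ih =>
  -- reduction when the value at σ vanishes
  have red : ∀ {E : Type w} [Field E] [CharP E p] (W : WD p (Option I) E) (hnone : none ∈ W.J)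
      (v : Finset I → E), FS v → W.Hyp v → (∀ τ, toColex σ < toColex τ → v τ = 0) →
      (∀ τ, v τ ≠ 0 → ∀ i ∈ τ, some i ∈ W.J) → v σ = 0 → W.Good v := by
    intro E _ _ W hnone v hfs hv hσ hJ h0
    by_cases hne : hfs.toFinset.Nonempty
    · obtain ⟨τ, hτ, hmax⟩ := Finset.exists_max_image hfs.toFinset (fun τ => toColex τ) hne
      have hτ0 : v τ ≠ 0 := hfs.mem_toFinset.1 hτ
      have hlt : toColex τ < toColex σ := by
        rcases lt_trichotomy (toColex τ) (toColex σ) with h | h | h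
        · exact h
        · have : τ = σ := h
          exact absurd h0 (this ▸ hτ0)
        · exact absurd (hσ τ h) hτ0
      refine ih τ hlt W hnone v hfs hv (fun τ' hτ' => ?_) hJ
      by_contra hcon
      exact (hmax τ' (hfs.mem_toFinset.2 hcon)).not_gt hτ'
    · have : v = 0 := by
        funext τ
        by_contra hcon
        exact hne ⟨τ, hfs.mem_toFinset.2 hcon⟩
      rw [this]; exact Good.zero W
  intro E _ _ W hnone v hfs hv hσ hJ
  by_cases h0 : v σ = 0
  · exact red W hnone v hfs hv hσ hJ h0
  obtain ⟨P, hP0, hP1⟩ := exists_PT p W.Di W.Di_comm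
  have hP : PTProp p W.Di P := ⟨hP0, hP1, W.Di_comm, fun i x => W.pow _ x⟩
  obtain ⟨h1, h2, h3⟩ := W.top_facts hp v hv σ hσ P hP
  have hPf : P σ (rho p W.dl0 (v σ)) ≠ 0 := by rw [h1]; exact pow_ne_zero _ h0
  let u : I → E := fun s => if s ∈ σ then
    rho p (W.Di s) (P (σ.filter (s < ·)) (rho p W.dl0 (v σ))) /
        P (σ.filter (s < ·)) (rho p W.dl0 (v σ)) else 1
  have hu : ∀ s, u s ≠ 0 := by
    intro s
    by_cases hs : s ∈ σ
    · simp only [u, if_pos hs]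
      refine div_ne_zero (fun h0 => ?_) (fun h0 => hPf (hP.mono _ _ (filter_subset _ _) _ h0))
      rw [← hP.ins _ _ _ (by simp)] at h0
      refine hPf (hP.mono _ _ ?_ _ h0)
      intro j hj
      rcases mem_insert.1 hj with rfl | hj
      · exact hs
      · exact filter_subset _ _ hj
    · simp [u, hs]
  obtain ⟨E', i1, i2, W', e, hroots⟩ := W.adjoin_roots hp σ.toList u hu
  refine W.good_descent W' e v ?_
  have hv' := W.hyp_ext W' e v hv
  have hnone' : none ∈ W'.J := by rw [e.J_eq]; exact hnone
  obtain ⟨P', hP0', hP1'⟩ := exists_PT p W'.Di W'.Di_comm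
  have hP' : PTProp p W'.Di P' := ⟨hP0', hP1', W'.Di_comm, fun i x => W'.pow _ x⟩
  have hrho : ∀ k x, e.f (rho p (W.D k) x) = rho p (W'.D k) (e.f x) := by
    intro k x
    have hit : ∀ n x, e.f ((W.D k)^[n] x) = (W'.D k)^[n] (e.f x) := by
      intro n
      induction n with
      | zero => intro x; rfl
      | succ n ih =>
        intro x; rw [Function.iterate_succ_apply, ih, Function.iterate_succ_apply, e.f_D]
    rw [rho, map_sub, hit]; rfl
  have hPP : ∀ T x, e.f (P T x) = P' T (e.f x) := by
    intro T x
    induction T using Finset.induction_on with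
    | empty => rw [hP0, hP0']
    | insert s T hs ih =>
      rw [hP1 _ _ _ hs, hP1' _ _ _ hs, ← ih]
      exact hrho _ _
  have hfs' : FS (fun σ => e.f (v σ)) := hfs.map (fun _ => e.f) (by simp)
  have hσ' : ∀ τ, toColex σ < toColex τ → e.f (v τ) = 0 := fun τ h => by rw [hσ τ h, map_zero]
  have hJ' : ∀ τ, e.f (v τ) ≠ 0 → ∀ i ∈ τ, some i ∈ W'.J := fun τ h => by
    rw [e.J_eq]; exact hJ τ (fun h0 => h (by rw [h0, map_zero]))
  obtain ⟨v1, hv1fs, hv1, hg1, hv1σ, hv1above, hv1J⟩ := W'.step_roots hp hnone' _ hv' σ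
    ((map_ne_zero e.f).2 h0) hσ' (by rw [e.J_eq]; exact hJ σ h0) P' hP' (by
      intro s hs
      obtain ⟨h, hh⟩ := hroots s (by simpa using hs)
      refine ⟨h, ?_⟩
      rw [hh]
      simp only [u, if_pos hs, map_div₀, hPP]
      have e1 : e.f (rho p (W.Di s) (P (σ.filter (s < ·)) (rho p W.dl0 (v σ)))) =
        rho p (W'.Di s) (e.f (P (σ.filter (s < ·)) (rho p W.dl0 (v σ)))) := hrho _ _
      have e2 : e.f (rho p W.dl0 (v σ)) = rho p W'.dl0 (e.f (v σ)) := hrho _ _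
      rw [e1, hPP, e2])
  have hred := red W' hnone' ((fun σ => e.f (v σ)) - v1) (hfs'.sub hv1fs) (hv'.sub hv1)
    (fun τ h => by rw [Pi.sub_apply, hσ' τ h, hv1above τ h, sub_zero])
    (fun τ h => by
      by_cases h4 : e.f (v τ) = 0
      · by_cases h5 : v1 τ = 0
        · exact absurd (by rw [Pi.sub_apply, h4, h5, sub_zero]) h
        · exact hv1J τ h5
      · exact hJ' τ h4)
    (by rw [Pi.sub_apply, hv1σ, sub_self])
  have := hred.add hg1
  rwa [sub_add_cancel] at this

theorem propN (hp : p.Prime) [CharP E p] [WellFoundedLT I] (W : WD p (Option I) E)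
    (hnone : none ∈ W.J)
    (v : Finset I → E) (hfs : FS v) (hv : W.Hyp v)
    (hJ : ∀ τ, v τ ≠ 0 → ∀ i ∈ τ, some i ∈ W.J) : W.Good v := by
  have hF := Fact.mk hp
  by_cases hne : hfs.toFinset.Nonempty
  · obtain ⟨τ, hτ, hmax⟩ := Finset.exists_max_image hfs.toFinset (fun τ => toColex τ) hne
    refine propN_aux hp τ W hnone v hfs hv (fun τ' hτ' => ?_) hJ
    by_contra hcon
    exact (hmax τ' (hfs.mem_toFinset.2 hcon)).not_gt hτ'
  · have : v = 0 := by
      funext τ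
      by_contra hcon
      exact hne ⟨τ, hfs.mem_toFinset.2 hcon⟩
    rw [this]; exact Good.zero W

end WD
end PropN2
end Part9

section Part10
set_option linter.all false
open Finset

noncomputable section PBsec

/-- `p`-basis coordinates. -/
structure PB (I : Type*) (F : Type*) [Field F] where
  y : I → F
  ynz : ∀ i, y i ≠ 0
  B : Module.Basis I F (KaehlerDifferential ℤ F)
  hB : ∀ i, B i = (y i)⁻¹ • KaehlerDifferential.D ℤ F (y i)

namespace PB
variable {I : Type*} {F : Type*} [Field F] (P : PB I F)

def D (j : I) : Derivation ℤ F F := (P.B.coord j).compDer (KaehlerDifferential.D ℤ F)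

theorem D_apply (j : I) (x : F) : P.D j x = P.B.repr (KaehlerDifferential.D ℤ F x) j := rfl

theorem D_self (j : I) : P.D j (P.y j) = P.y j := by
  have h : KaehlerDifferential.D ℤ F (P.y j) = P.y j • P.B j := by
    rw [P.hB, smul_smul, mul_inv_cancel₀ (P.ynz j), one_smul]
  rw [D_apply, h]; simp

theorem D_other (i j : I) (hij : i ≠ j) : P.D i (P.y j) = 0 := by
  have h : KaehlerDifferential.D ℤ F (P.y j) = P.y j • P.B j := by
    rw [P.hB, smul_smul, mul_inv_cancel₀ (P.ynz j), one_smul]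
  rw [D_apply, h]; simp [Finsupp.single_apply, hij.symm]

theorem der_ext (d : Derivation ℤ F F) (hd : ∀ i, d (P.y i) = 0) (x : F) : d x = 0 := by
  have h1 : d.liftKaehlerDifferential = 0 := by
    apply P.B.ext
    intro i
    rw [P.hB, map_smul, Derivation.liftKaehlerDifferential_comp_D, hd]; simp
  rw [← Derivation.liftKaehlerDifferential_comp_D, h1]; rfl

theorem comm (i j : I) (x : F) : P.D i (P.D j x) = P.D j (P.D i x) := by
  have := P.der_ext ⁅P.D i, P.D j⁆ (fun k => by
    rw [Derivation.commutator_apply]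
    by_cases h1 : i = k <;> by_cases h2 : j = k
    · subst h1; subst h2; simp
    · subst h1; rw [D_other _ _ _ h2, D_self, D_other _ _ _ h2]; simp
    · subst h2; rw [D_other _ _ _ h1, D_self, D_other _ _ _ h1]; simp
    · rw [D_other _ _ _ h1, D_other _ _ _ h2]; simp) x
  rw [Derivation.commutator_apply] at this
  exact sub_eq_zero.1 this

theorem pow {p : ℕ} (hp : p.Prime) [CharP F p] (i : I) (x : F) : (P.D i)^[p] x = P.D i x := by
  have := P.der_ext (derPow hp (P.D i) - P.D i) (fun k => by
    rw [Derivation.sub_apply, derPow_apply]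
    by_cases h1 : i = k
    · subst h1
      rw [Function.iterate_fixed (D_self _ _), D_self, sub_self]
    · rw [D_other _ _ _ h1, sub_zero]
      obtain ⟨q, rfl⟩ : ∃ q, p = q + 1 := ⟨p - 1, by have := hp.pos; omega⟩
      rw [Function.iterate_succ_apply, D_other _ _ _ h1, Function.iterate_fixed (map_zero _)]) x
  rw [Derivation.sub_apply, derPow_apply] at this
  exact sub_eq_zero.1 this

theorem fin (x : F) : {j | P.D j x ≠ 0}.Finite := by
  have := (P.B.repr (KaehlerDifferential.D ℤ F x)).finite_support
  exact this.subset fun j hj => hj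

variable [LinearOrder I]

theorem wd_wd_self (α : I → F) (x : Finset I → F) : wd α (wd α x) = 0 := by
  funext σ
  simp only [wd, Finset.smul_sum, Finset.mul_sum, mul_smul_comm, smul_smul]
  exact double_symm σ (fun j i => α j * (α i * x ((σ.erase j).erase i))) fun i j => by
    rw [Finset.erase_right_comm]; ring

/-- wedge operators -/
def wdL : (KaehlerDifferential ℤ F) →ₗ[F] Module.End F (Finset I → F) where
  toFun α := { toFun := wd (fun j => P.B.repr α j)
               map_add' := wd_add _
               map_smul' := wd_smul _ }
  map_add' α β := by
    ext1 x
    have : (fun j => P.B.repr (α + β) j) = (fun j => P.B.repr α j) + fun j => P.B.repr β j := by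
      funext j; simp
    simp only [LinearMap.coe_mk, AddHom.coe_mk, LinearMap.add_apply, this, wd_add_left]
  map_smul' c α := by
    ext1 x
    have : (fun j => P.B.repr (c • α) j) = c • (fun j => P.B.repr α j) := by
      funext j; simp
    simp only [LinearMap.coe_mk, AddHom.coe_mk, LinearMap.smul_apply, this, wd_smul_left]
    rfl

theorem wdL_apply (α) (x) : P.wdL α x = wd (fun j => P.B.repr α j) x := rfl

def PhiA : DF F →ₐ[F] Module.End F (Finset I → F) :=
  ExteriorAlgebra.lift F ⟨P.wdL, fun α => by
    ext1 x
    rw [Module.End.mul_apply, wdL_apply, wdL_apply, wd_wd_self]; rfl⟩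

def dlt (σ : Finset I) : Finset I → F := fun τ => if τ = σ then 1 else 0

/-- coordinates of a form -/
def Phi : DF F →ₗ[F] (Finset I → F) := (LinearMap.applyₗ (dlt ∅)) ∘ₗ P.PhiA.toLinearMap

theorem Phi_one : P.Phi 1 = dlt ∅ := by
  simp [Phi]

theorem Phi_ι_mul (α) (ω : DF F) :
    P.Phi (ExteriorAlgebra.ι F α * ω) = wd (fun j => P.B.repr α j) (P.Phi ω) := by
  have : P.PhiA (ExteriorAlgebra.ι F α) = P.wdL α := by
    rw [PhiA, ExteriorAlgebra.lift_ι_apply]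
  simp only [Phi, LinearMap.comp_apply, AlgHom.toLinearMap_apply, LinearMap.applyₗ_apply_apply,
    map_mul, Module.End.mul_apply, this]
  rfl

theorem Phi_dForm_mul (a : F) (ω : DF F) :
    P.Phi (dForm F a * ω) = wd (fun j => P.D j a) (P.Phi ω) := Phi_ι_mul _ _ _

theorem Phi_dLog_mul (a : F) (ω : DF F) :
    P.Phi (dLog F a * ω) = wd (dl P.D a) (P.Phi ω) := by
  rw [dLog, Phi_ι_mul]
  congr 1
  funext j
  rw [map_smul]; rfl

theorem eps_min (j : I) (σ : Finset I) (h : ∀ i ∈ σ, j ≤ i) : eps j σ = 1 := by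
  rw [eps, Finset.filter_eq_empty_iff.2]
  · simp
  · intro i hi; exact not_lt.2 (h i hi)

/-- basis forms -/
def e (σ : Finset I) : DF F := ((σ.sort (· ≤ ·)).map (fun j => ExteriorAlgebra.ι F (P.B j))).prod

theorem e_empty : P.e ∅ = 1 := by simp [e]

theorem e_insert (j : I) (σ : Finset I) (h : ∀ i ∈ σ, j < i) :
    P.e (insert j σ) = ExteriorAlgebra.ι F (P.B j) * P.e σ := by
  have hj : j ∉ σ := fun h1 => lt_irrefl _ (h j h1)
  rw [e, Finset.sort_insert (· ≤ ·) (fun i hi => (h i hi).le) hj]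
  simp [e]

theorem wd_single (j : I) (x : Finset I → F) (σ : Finset I) :
    wd (fun i => P.B.repr (P.B j) i) x σ = if j ∈ σ then eps j σ • x (σ.erase j) else 0 := by
  simp only [wd, Module.Basis.repr_self, Finsupp.single_apply]
  split_ifs with h
  · rw [Finset.sum_eq_single j]
    · simp
    · intro i _ hi; simp [hi.symm]
    · intro h'; exact absurd h h'
  · refine Finset.sum_eq_zero fun i hi => ?_
    have : j ≠ i := by rintro rfl; exact h hi
    simp [this]

theorem Phi_e (σ : Finset I) : P.Phi (P.e σ) = dlt σ := by
  induction σ using Finset.induction_on_min with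
  | empty => rw [e_empty, Phi_one]
  | insert j σ hj ih =>
    rw [e_insert _ _ _ hj, Phi_ι_mul, ih]
    have hjσ : j ∉ σ := fun h1 => lt_irrefl _ (hj j h1)
    funext τ
    rw [wd_single]
    by_cases hτ : τ = insert j σ
    · subst hτ
      rw [if_pos (Finset.mem_insert_self _ _), Finset.erase_insert hjσ, eps_min]
      · simp [dlt]
      · intro i hi
        rcases Finset.mem_insert.1 hi with rfl | h
        · exact le_rfl
        · exact (hj i h).le
    · simp only [dlt, if_neg hτ]
      split_ifs with h1 h2
      · exact absurd (by rw [← h2, Finset.insert_erase h1]) hτ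
      · simp
      · rfl

theorem e_eq_basis (σ : Finset I) : P.e σ = P.B.ExteriorAlgebra σ := by
  rw [ExteriorAlgebra.basis_apply, e]
  change _ = ExteriorAlgebra.ιMulti F _ _
  rw [ExteriorAlgebra.ιMulti_apply]
  congr 1
  apply List.ext_getElem
  · simp
  · intro i h1 h2
    simp
    rfl

theorem e_span (ω : DF F) : ω ∈ Submodule.span F (Set.range P.e) := by
  have : Set.range P.e = Set.range P.B.ExteriorAlgebra := by
    congr 1; funext σ; exact P.e_eq_basis σ
  rw [this, P.B.ExteriorAlgebra.span_eq]; trivial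

theorem dlt_FS (σ : Finset I) : FS (dlt σ : Finset I → F) := by
  refine (Set.finite_singleton σ).subset fun τ hτ => ?_
  by_contra h
  exact hτ (if_neg h)

theorem Phi_FS (ω : DF F) : FS (P.Phi ω) := by
  induction P.e_span ω using Submodule.span_induction with
  | mem x h => obtain ⟨σ, rfl⟩ := h; rw [Phi_e]; exact dlt_FS σ
  | zero => rw [map_zero]; exact FS.zero
  | add x y _ _ hx hy => rw [map_add]; exact hx.add hy
  | smul a x _ hx => rw [map_smul]; exact hx.smul a

/-- inverse -/
def inv (x : Finset I → F) (hx : FS x) : DF F := ∑ σ ∈ hx.toFinset, x σ • P.e σ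

theorem Phi_inv (x : Finset I → F) (hx : FS x) : P.Phi (P.inv x hx) = x := by
  rw [inv, map_sum]
  simp only [map_smul, Phi_e]
  funext τ
  simp only [Finset.sum_apply, Pi.smul_apply, smul_eq_mul, dlt, mul_ite, mul_one, mul_zero]
  rw [Finset.sum_ite_eq]
  split_ifs with h
  · rfl
  · by_contra h1
    exact h (hx.mem_toFinset.2 (Ne.symm h1))

theorem Phi_injective : Function.Injective P.Phi := by
  rw [← LinearMap.ker_eq_bot, LinearMap.ker_eq_bot']
  intro ω h
  have key : ∀ l : Finset I →₀ F, P.Phi (Finsupp.linearCombination F P.e l) = l := by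
    intro l
    rw [Finsupp.linearCombination_apply, Finsupp.sum, map_sum]
    simp only [map_smul, Phi_e]
    funext τ
    simp only [Finset.sum_apply, Pi.smul_apply, smul_eq_mul, dlt, mul_ite, mul_one, mul_zero]
    rw [Finset.sum_ite_eq]
    split_ifs with h
    · rfl
    · by_contra h1
      exact h (Finsupp.mem_support_iff.2 (Ne.symm h1))
  obtain ⟨l, rfl⟩ := (Finsupp.mem_span_range_iff_exists_finsupp).1 (P.e_span ω)
  change P.Phi (Finsupp.linearCombination F P.e l) = 0 at h
  rw [key] at h
  have : l = 0 := by ext τ; exact congrFun h τ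
  rw [this]; simp

theorem eq_inv (ω : DF F) : ω = P.inv (P.Phi ω) (P.Phi_FS ω) :=
  P.Phi_injective (by rw [Phi_inv])

theorem e_mem (σ : Finset I) : P.e σ ∈ omegaPow F #σ := by
  induction σ using Finset.induction_on_min with
  | empty => rw [e_empty]; simp [omegaPow]
  | insert j σ hj ih =>
    have hjσ : j ∉ σ := fun h1 => lt_irrefl _ (hj j h1)
    rw [e_insert _ _ _ hj, Finset.card_insert_of_notMem hjσ, omegaPow, pow_succ']
    exact Submodule.mul_mem_mul ⟨_, rfl⟩ ih

theorem mem_omegaPow_iff (n : ℕ) (ω : DF F) :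
    ω ∈ omegaPow F n ↔ ∀ σ, P.Phi ω σ ≠ 0 → #σ = n := by
  constructor
  · intro h
    induction h using Submodule.pow_induction_on_left' with
    | algebraMap r =>
      intro σ hσ
      rw [Algebra.algebraMap_eq_smul_one, map_smul, Phi_one] at hσ
      have : σ = ∅ := by
        by_contra h; exact hσ (by simp [dlt, h])
      simp [this]
    | add x y i hx hy h1 h2 =>
      intro σ hσ
      rw [map_add] at hσ
      by_cases h : P.Phi x σ = 0
      · exact h2 σ (fun h' => hσ (by rw [Pi.add_apply, h, h', add_zero]))
      · exact h1 σ h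
    | mem_mul m hm i x hx ih =>
      obtain ⟨α, rfl⟩ := hm
      intro σ hσ
      rw [Phi_ι_mul] at hσ
      obtain ⟨j, hj, hne⟩ := Finset.exists_ne_zero_of_sum_ne_zero hσ
      have := ih (σ.erase j) (fun h => hne (by rw [h]; simp))
      rw [← this, Nat.succ_eq_add_one, Finset.card_erase_add_one hj]
  · intro h
    rw [P.eq_inv ω, inv]
    refine Submodule.sum_mem _ fun σ hσ => Submodule.smul_mem _ _ ?_
    rw [← h σ ((P.Phi_FS ω).mem_toFinset.1 hσ)]
    exact P.e_mem σ

end PB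
end PBsec
end Part10

section Part11
set_option linter.all false
open Finset

noncomputable section PBS
namespace PB
variable {I : Type*} {F : Type*} [Field F] (P : PB I F) [LinearOrder I]

theorem mem_omegaPred_iff (n : ℕ) (ω : DF F) :
    ω ∈ omegaPred F n ↔ ∀ σ, P.Phi ω σ ≠ 0 → #σ + 1 = n := by
  cases n with
  | zero =>
    simp only [omegaPred, Submodule.mem_bot]
    constructor
    · rintro rfl σ h; exact absurd (by simp) h
    · intro h
      apply P.Phi_injective
      rw [map_zero]; funext σ
      by_contra h1
      have := h σ h1
      omega
  | succ n =>
    simp only [omegaPred, P.mem_omegaPow_iff, add_left_inj]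

theorem dd_card (D : I → Derivation ℤ F F) (x : Finset I → F) (n : ℕ)
    (h : ∀ σ, x σ ≠ 0 → #σ = n) : ∀ σ, dd D x σ ≠ 0 → #σ = n + 1 := by
  intro σ hσ
  obtain ⟨j, hj, hne⟩ := Finset.exists_ne_zero_of_sum_ne_zero hσ
  have := h (σ.erase j) (fun h => hne (by rw [h]; simp))
  rw [← this, Finset.card_erase_add_one hj]

theorem wd_card (α : I → F) (x : Finset I → F) (n : ℕ)
    (h : ∀ σ, x σ ≠ 0 → #σ = n) : ∀ σ, wd α x σ ≠ 0 → #σ = n + 1 := by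
  intro σ hσ
  obtain ⟨j, hj, hne⟩ := Finset.exists_ne_zero_of_sum_ne_zero hσ
  have := h (σ.erase j) (fun h => hne (by rw [h]; simp))
  rw [← this, Finset.card_erase_add_one hj]

theorem logForm_cons {n : ℕ} (x : Fin (n + 1) → F) :
    logForm F x = dLog F (x 0) * logForm F (fun i => x i.succ) := by
  simp [logForm, List.ofFn_succ]

variable {p : ℕ}

theorem Phi_logForm_closed {n : ℕ} (x : Fin n → F) :
    dd P.D (P.Phi (logForm F x)) = 0 := by
  induction n with
  | zero =>
    simp only [logForm, List.ofFn_zero, List.prod_nil, Phi_one]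
    funext σ
    simp only [dd, dlt]
    refine Finset.sum_eq_zero fun j _ => ?_
    split_ifs <;> simp
  | succ n ih =>
    rw [logForm_cons, Phi_dLog_mul, dd_wd _ _ (dl_closed _ P.comm _), ih, wd_zero, neg_zero]

theorem sc_logForm (hp : p.Prime) [CharP F p] {n : ℕ} (x : Fin n → F) :
    ∃ ζ, FS ζ ∧ (∀ σ, ζ σ ≠ 0 → #σ + 1 = n) ∧
      sc p (P.Phi (logForm F x)) = P.Phi (logForm F x) + dd P.D ζ := by
  have hF := Fact.mk hp
  induction n with
  | zero =>
    refine ⟨0, FS.zero, by simp, ?_⟩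
    simp only [logForm, List.ofFn_zero, List.prod_nil, Phi_one, dd_zero, add_zero]
    funext σ
    simp only [sc, dlt]
    split_ifs <;> simp [hp.ne_zero]
  | succ n ih =>
    obtain ⟨ζ, hζ, hζ1, hζ2⟩ := ih (fun i => x i.succ)
    obtain ⟨η, hη⟩ := cartier_log hp P.D P.comm (P.pow hp) P.fin (x 0)
    set X := P.Phi (logForm F (fun i : Fin n => x i.succ)) with hX
    have hXc : dd P.D X = 0 := P.Phi_logForm_closed _
    have hXn : ∀ σ, X σ ≠ 0 → #σ = n := by
      apply (P.mem_omegaPow_iff n _).1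
      clear * -
      generalize (fun i : Fin n => x i.succ) = x'
      clear x
      induction n with
      | zero => simp [logForm, omegaPow]
      | succ n ih =>
        rw [logForm_cons, omegaPow, pow_succ']
        exact Submodule.mul_mem_mul ⟨_, rfl⟩ (ih _)
    have hZ : dd P.D (X + dd P.D ζ) = 0 := by
      rw [dd_add, dd_dd _ P.comm, hXc, add_zero]
    refine ⟨η • (X + dd P.D ζ) - wd (dl P.D (x 0)) ζ, ?_, ?_, ?_⟩
    · exact (((P.Phi_FS _).add (hζ.dd P.fin)).smul _).sub (hζ.wd (dl_fin P.fin _))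
    · intro σ hσ
      simp only [Pi.sub_apply, Pi.smul_apply, Pi.add_apply] at hσ
      by_cases h1 : X σ = 0
      · by_cases h2 : dd P.D ζ σ = 0
        · rw [h1, h2] at hσ
          have hne : wd (dl P.D (x 0)) ζ σ ≠ 0 := fun h => hσ (by rw [h]; simp)
          obtain ⟨j, hj, hne⟩ := Finset.exists_ne_zero_of_sum_ne_zero hne
          have := hζ1 (σ.erase j) (fun h => hne (by rw [h]; simp))
          rw [Finset.card_erase_add_one hj] at this
          omega
        · obtain ⟨j, hj, hne⟩ := Finset.exists_ne_zero_of_sum_ne_zero h2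
          have := hζ1 (σ.erase j) (fun h => hne (by rw [h]; simp))
          rw [Finset.card_erase_add_one hj] at this
          omega
      · rw [hXn σ h1]
    · rw [logForm_cons, Phi_dLog_mul, ← hX, sc_wd, hζ2]
      have h1 : (fun j => dl P.D (x 0) j ^ p) = dl P.D (x 0) + fun j => P.D j η := by
        funext j; exact hη j
      rw [h1, wd_add_left, wd_add (dl P.D (x 0)), dd_sub, dd_smul, hZ,
        dd_wd _ _ (dl_closed _ P.comm _)]
      simp only [smul_zero, add_zero]
      abel

/-- the differential structure associated with a `p`-basis -/
def S (hp : p.Prime) [CharP F p] : DiffStr p F :=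
  have hF := Fact.mk hp
  { d := AddMonoidHom.mk' (fun ω => P.inv (dd P.D (P.Phi ω)) ((P.Phi_FS ω).dd P.fin)) (by
      intro a b
      apply P.Phi_injective
      simp only [map_add, Phi_inv, dd_add])
    sp := AddMonoidHom.mk' (fun ω => P.inv (sc p (P.Phi ω)) ((P.Phi_FS ω).sc hp.ne_zero)) (by
      intro a b
      apply P.Phi_injective
      simp only [map_add, Phi_inv, sc_add])
    d_grade := by
      intro n ω h
      rw [P.mem_omegaPow_iff] at h ⊢
      simp only [AddMonoidHom.mk'_apply, Phi_inv]
      exact dd_card _ _ _ h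
    d_d := by
      intro ω
      apply P.Phi_injective
      simp only [AddMonoidHom.mk'_apply, Phi_inv, dd_dd _ P.comm, map_zero]
    d_one := by
      apply P.Phi_injective
      simp only [AddMonoidHom.mk'_apply, Phi_inv, map_zero]
      have := P.Phi_logForm_closed (n := 0) (fun i => 0)
      simpa [logForm] using this
    d_smul := by
      intro a ω
      apply P.Phi_injective
      simp only [AddMonoidHom.mk'_apply, Phi_inv, map_add, map_smul, Phi_dForm_mul, dd_smul]
    sp_grade := by
      intro n ω h
      rw [P.mem_omegaPow_iff] at h ⊢
      simp only [AddMonoidHom.mk'_apply, Phi_inv]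
      intro σ hσ
      exact h σ (fun h0 => hσ (by simp [sc, h0, hp.ne_zero]))
    sp_log := by
      intro n a x
      obtain ⟨ζ, hζ, hζ1, hζ2⟩ := P.sc_logForm hp x
      refine ⟨P.inv (a ^ p • ζ) (hζ.smul _), ?_, ?_⟩
      · rw [P.mem_omegaPred_iff, Phi_inv]
        intro σ hσ
        exact hζ1 σ (fun h => hσ (by rw [Pi.smul_apply, h, smul_zero]))
      · apply P.Phi_injective
        simp only [AddMonoidHom.mk'_apply, Phi_inv, map_add, map_smul, sc_smul, hζ2, smul_add]
        rw [dd_const_smul _ _ (fun j => der_pow_p _ _)] }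

theorem Phi_d (hp : p.Prime) [CharP F p] (ω : DF F) : P.Phi ((P.S hp).d ω) = dd P.D (P.Phi ω) :=
  Phi_inv _ _ _

theorem Phi_sp (hp : p.Prime) [CharP F p] (ω : DF F) : P.Phi ((P.S hp).sp ω) = sc p (P.Phi ω) :=
  Phi_inv _ _ _

end PB

/-- existence of adapted bases -/
theorem exists_PB (F : Type*) [Field F] (s : Set F)
    (hs : LinearIndepOn F (KaehlerDifferential.D ℤ F) s) (h0 : (0 : F) ∉ s) :
    ∃ (t : Set F) (P : PB t F), s ⊆ t ∧ ∀ i : t, P.y i = i := by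
  have hs' : s ⊆ Set.univ := Set.subset_univ s
  set t := hs.extend hs' with ht
  have hli : LinearIndepOn F (KaehlerDifferential.D ℤ F) t := hs.linearIndepOn_extend hs'
  have hsp : ⊤ ≤ Submodule.span F (Set.range fun i : t => KaehlerDifferential.D ℤ F (i : F)) := by
    rw [← KaehlerDifferential.span_range_derivation, Submodule.span_le]
    rintro _ ⟨a, rfl⟩
    have := hs.image_subset_span_image_extend hs' ⟨a, trivial, rfl⟩
    rwa [← ht, Set.image_eq_range] at this
  have hnz : ∀ i : t, (i : F) ≠ 0 := by
    intro i h
    have := hli.ne_zero i.2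
    rw [h] at this; simp at this
  let B := Module.Basis.mk hli hsp
  refine ⟨t, ⟨fun i => i, hnz, B.unitsSMul (fun i => Units.mk0 ((i : F)⁻¹) (inv_ne_zero (hnz i))), ?_⟩,
    hs.subset_extend hs', fun i => rfl⟩
  intro i
  rw [Module.Basis.unitsSMul_apply, Units.smul_def, Units.val_mk0]
  congr 1
  exact Module.Basis.mk_apply _ _ _

end PBS
end Part11

section Part12
set_option linter.all false
open Finset

section DB
open Polynomial IntermediateField in
theorem exists_der {p : ℕ} (hp : p.Prime) {F : Type*} [Field F] [CharP F p] (b : F)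
    (hb : ∀ c, c ^ p ≠ b) : ∃ D : Derivation ℤ F F, D b = b := by
  have hFact := Fact.mk hp
  let S : Set (Subfield F) := {K | (∀ x, x ^ p ∈ K) ∧ b ∉ K}
  obtain ⟨K, -, hK⟩ := zorn_le_nonempty₀ S (by
    intro c hc hch y hy
    have hne : c.Nonempty := ⟨y, hy⟩
    refine ⟨sSup c, ⟨fun x => ?_, ?_⟩, fun z hz => le_sSup hz⟩
    · exact (Subfield.mem_sSup_of_directedOn hne hch.directedOn).2 ⟨y, hy, (hc hy).1 x⟩
    · rw [Subfield.mem_sSup_of_directedOn hne hch.directedOn]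
      rintro ⟨s, hs, hbs⟩
      exact (hc hs).2 hbs) (frobenius F p).fieldRange
    ⟨fun x => ⟨x, rfl⟩, fun ⟨c, hc⟩ => hb c hc⟩
  have hKp : ∀ x, x ^ p ∈ K := hK.prop.1
  have hKb : b ∉ K := hK.prop.2
  have hirr : ∀ x, x ∉ K → Irreducible (X ^ p - C (⟨x ^ p, hKp x⟩ : K)) := by
    intro x hx
    refine X_pow_sub_C_irreducible_of_prime hp fun d hd => hx ?_
    have h1 : (d : F) ^ p = x ^ p := congrArg Subtype.val hd
    have h2 : (d : F) = x := frobenius_inj F p h1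
    rw [← h2]; exact d.2
  have hmon : ∀ x, (X ^ p - C (⟨x ^ p, hKp x⟩ : K)).Monic := fun x => monic_X_pow_sub_C _ hp.ne_zero
  have hroot : ∀ x, aeval x (X ^ p - C (⟨x ^ p, hKp x⟩ : K)) = 0 := by
    intro x
    rw [map_sub, map_pow, aeval_X, aeval_C]
    exact sub_self _
  have hinteg : ∀ x : F, IsIntegral K x := fun x => ⟨_, hmon x, hroot x⟩
  have hmin : ∀ x, x ∉ K → minpoly K x = X ^ p - C (⟨x ^ p, hKp x⟩ : K) := fun x hx =>
    (minpoly.eq_of_irreducible_of_monic (hirr x hx) (hroot x) (hmon x)).symm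
  have hfr : ∀ x, x ∉ K → Module.finrank K K⟮x⟯ = p := by
    intro x hx
    rw [IntermediateField.adjoin.finrank (hinteg x), hmin x hx, natDegree_X_pow_sub_C]
  have hgen : ∀ x, x ∈ K⟮b⟯ := by
    intro x
    by_cases hx : x ∈ K
    · exact K⟮b⟯.algebraMap_mem ⟨x, hx⟩
    have hbx : b ∈ K⟮x⟯ := by
      by_contra h
      have hle : K ≤ K⟮x⟯.toSubfield := fun a ha => K⟮x⟯.algebraMap_mem ⟨a, ha⟩
      have := hK.le_of_ge (y := K⟮x⟯.toSubfield) ⟨fun a => hle (hKp a), h⟩ hle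
      exact hx (this (mem_adjoin_simple_self K x))
    have hfd : FiniteDimensional K K⟮x⟯ := IntermediateField.adjoin.finiteDimensional (hinteg x)
    have := IntermediateField.eq_of_le_of_finrank_eq (F := K⟮b⟯) (E := K⟮x⟯)
      (by rw [adjoin_simple_le_iff]; exact hbx) (by rw [hfr b hKb, hfr x hx])
    rw [this]; exact mem_adjoin_simple_self K x
  have hsurj : Function.Surjective (aeval (R := K) b) := by
    intro x
    have h1 := hgen x
    rw [← IntermediateField.mem_toSubalgebra,
      IntermediateField.adjoin_simple_toSubalgebra_of_isAlgebraic (hinteg b).isAlgebraic,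
      Algebra.adjoin_singleton_eq_range_aeval] at h1
    exact h1
  obtain ⟨D, hD⟩ := lift_der (aeval (R := K) b).toRingHom hsurj (fun f => X * derivative f)
    (fun x y => by rw [derivative_add, mul_add])
    (fun x y => by rw [derivative_mul]; ring) (fun f hf => by
      have h1 : minpoly K b ∣ f := minpoly.dvd K b hf
      obtain ⟨g, rfl⟩ := h1
      have h2 : derivative (minpoly K b) = 0 := by
        have h0 : ((p : ℕ) : K) = 0 := Subtype.ext (by
          have h1 := map_natCast K.subtype p
          rw [CharP.cast_eq_zero F p] at h1
          exact h1)
        rw [hmin b hKb, derivative_sub, derivative_C, sub_zero, derivative_X_pow, h0, C_0, zero_mul]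
      have h3 : (aeval b) (X * derivative (minpoly K b * g)) = 0 := by
        rw [derivative_mul, h2, zero_mul, zero_add, map_mul, map_mul, minpoly.aeval]; simp
      exact h3)
  refine ⟨D, ?_⟩
  have := hD X
  simpa using this

theorem D_ne_zero {p : ℕ} (hp : p.Prime) {F : Type*} [Field F] [CharP F p] (b : F)
    (hb : ∀ c, c ^ p ≠ b) : KaehlerDifferential.D ℤ F b ≠ 0 := by
  obtain ⟨D, hD⟩ := exists_der hp b hb
  intro h
  have h1 := Derivation.liftKaehlerDifferential_comp_D D b
  rw [h, map_zero, hD] at h1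
  exact hb 0 (by rw [zero_pow hp.ne_zero, h1])

/-- every field has a `p`-basis -/
theorem exists_PB_any (F : Type*) [Field F] : ∃ (t : Set F), Nonempty (PB t F) := by
  obtain ⟨t, P, -, -⟩ := exists_PB F ∅ (by simp) (by simp)
  exact ⟨t, ⟨P⟩⟩

theorem exists_DiffStr {p : ℕ} (hp : p.Prime) (F : Type*) [Field F] [CharP F p] :
    Nonempty (DiffStr p F) := by
  obtain ⟨t, ⟨P⟩⟩ := exists_PB_any F
  classical
  letI : LinearOrder t := linearOrderOfSTO WellOrderingRel
  exact ⟨P.S hp⟩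

end DB
end Part12

section Part13
set_option linter.all false
open Finset

noncomputable section LStep

theorem DF_induct {F : Type*} [Field F] {C : DF F → Prop} (one : C 1)
    (add : ∀ x y, C x → C y → C (x + y)) (smul : ∀ (a : F) x, C x → C (a • x))
    (dform : ∀ (a : F) x, C x → C (dForm F a * x)) (ω : DF F) : C ω := by
  have zero : C 0 := by have := smul 0 1 one; rwa [zero_smul] at this
  induction ω using CliffordAlgebra.left_induction with
  | algebraMap r => rw [Algebra.algebraMap_eq_smul_one]; exact smul r 1 one
  | add x y hx hy => exact add x y hx hy
  | ι_mul x m hx =>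
    have hm : m ∈ Submodule.span F (Set.range (KaehlerDifferential.D ℤ F)) := by
      rw [KaehlerDifferential.span_range_derivation]; trivial
    change C (ExteriorAlgebra.ι F m * x)
    induction hm using Submodule.span_induction with
    | mem y h => obtain ⟨a, rfl⟩ := h; exact dform a x hx
    | zero => rw [map_zero, zero_mul]; exact zero
    | add u v _ _ h1 h2 => rw [map_add, add_mul]; exact add _ _ h1 h2
    | smul a u _ h => rw [map_smul, smul_mul_assoc]; exact smul a _ h

universe w
variable {p : ℕ} {I : Type*} {F : Type w} [Field F]

structure LExt (p : ℕ) (P : PB I F) (i0 : I) (L : Type*) [Field L] [Algebra F L] where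
  γ : L
  Bγ : Module.Basis (Fin p) F L
  hBγ : ∀ i, Bγ i = γ ^ (i : ℕ)
  hγ : γ ^ p = algebraMap F L (P.y i0)
  Q : PB I L
  y0 : Q.y i0 = γ
  yi : ∀ i, i ≠ i0 → Q.y i = algebraMap F L (P.y i)
  Di : ∀ j, j ≠ i0 → ∀ a, Q.D j (algebraMap F L a) = algebraMap F L (P.D j a)
  D0 : ∀ a, Q.D i0 (algebraMap F L a) = 0

theorem exists_LExt (hp : p.Prime) [CharP F p] (P : PB I F) (i0 : I)
    (hb : ∀ c, c ^ p ≠ P.y i0) :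
    ∃ (L : Type w) (_ : Field L) (_ : Algebra F L), Nonempty (LExt p P i0 L) := by
  classical
  obtain ⟨L, _, _, γ, B, hB, hγ, hD⟩ := exists_root_ext F p hp (P.y i0) hb
  refine ⟨L, inferInstance, inferInstance, ?_⟩
  have hpL : (p : L) = 0 := by
    have := CharP.cast_eq_zero F p
    have h := congrArg (algebraMap F L) this
    rwa [map_natCast, map_zero] at h
  have hpF := CharP.cast_eq_zero F p
  have hγ0 : γ ≠ 0 := by
    rintro rfl
    rw [zero_pow hp.ne_zero] at hγ
    exact hb 0 (by rw [zero_pow hp.ne_zero]; exact (algebraMap F L).injective (by rw [← hγ, map_zero]))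
  let y : I → L := fun i => if i = i0 then γ else algebraMap F L (P.y i)
  have ynz : ∀ i, y i ≠ 0 := by
    intro i
    simp only [y]
    split_ifs
    · exact hγ0
    · exact (map_ne_zero _).2 (P.ynz i)
  have y0 : y i0 = γ := if_pos rfl
  have yi : ∀ i, i ≠ i0 → y i = algebraMap F L (P.y i) := fun i hi => if_neg hi
  -- derivations
  have hder : ∀ j, ∃ D' : Derivation ℤ L L, (∀ a, D' (algebraMap F L a) =
      if j = i0 then 0 else algebraMap F L (P.D j a)) ∧ ∀ i, D' (y i) = if i = j then y i else 0 := by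
    intro j
    by_cases hj : j = i0
    · subst hj
      obtain ⟨D', h1, h2⟩ := hD 0 1 (by simp [hpF])
      refine ⟨D', fun a => by rw [h1]; simp, fun i => ?_⟩
      by_cases hi : i = j
      · subst hi; rw [y0, h2]; simp
      · rw [yi i hi, h1, if_neg hi]; simp
    · obtain ⟨D', h1, h2⟩ := hD (P.D j) 0 (by rw [P.D_other _ _ hj]; simp)
      refine ⟨D', fun a => by rw [h1, if_neg hj], fun i => ?_⟩
      by_cases hi : i = i0
      · subst hi; rw [y0, h2, if_neg (Ne.symm hj)]; simp
      · rw [yi i hi, h1]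
        split_ifs with hij
        · subst hij; rw [P.D_self]
        · rw [P.D_other _ _ (Ne.symm hij), map_zero]
  choose D' hD'1 hD'2 using hder
  let v : I → KaehlerDifferential ℤ L := fun i => (y i)⁻¹ • KaehlerDifferential.D ℤ L (y i)
  have hDy : ∀ j i, (D' j).liftKaehlerDifferential (v i) = if i = j then 1 else 0 := by
    intro j i
    rw [map_smul, Derivation.liftKaehlerDifferential_comp_D, hD'2]
    split_ifs
    · exact inv_mul_cancel₀ (ynz i)
    · simp
  have hli : LinearIndependent L v := by
    rw [linearIndependent_iff]
    intro l hl
    ext j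
    have := congrArg (D' j).liftKaehlerDifferential hl
    rw [Finsupp.linearCombination_apply, Finsupp.sum, map_sum, map_zero] at this
    simp only [map_smul, hDy, smul_eq_mul, mul_ite, mul_one, mul_zero] at this
    rw [Finset.sum_ite_eq'] at this
    split_ifs at this with h
    · exact this
    · simpa using h
  have hsp : ⊤ ≤ Submodule.span L (Set.range v) := by
    set N := Submodule.span L (Set.range v) with hN
    have hDyN : ∀ i, KaehlerDifferential.D ℤ L (y i) ∈ N := by
      intro i
      have : KaehlerDifferential.D ℤ L (y i) = y i • v i := by
        simp only [v]; rw [smul_smul, mul_inv_cancel₀ (ynz i), one_smul]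
      rw [this]
      exact N.smul_mem _ (Submodule.subset_span ⟨i, rfl⟩)
    have hFN : ∀ ω, KaehlerDifferential.map ℤ ℤ F L ω ∈ N := by
      intro ω
      have h := P.B.mem_span ω
      induction h using Submodule.span_induction with
      | mem x h =>
        obtain ⟨i, rfl⟩ := h
        rw [P.hB, map_smul, KaehlerDifferential.map_D, ← algebraMap_smul L]
        apply N.smul_mem
        by_cases hi : i = i0
        · subst hi
          rw [← hγ, Derivation.leibniz_pow, ← y0, ← Nat.cast_smul_eq_nsmul L, hpL, zero_smul]
          exact N.zero_mem
        · rw [← yi i hi]; exact hDyN i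
      | zero => rw [map_zero]; exact N.zero_mem
      | add x y _ _ h1 h2 => rw [map_add]; exact N.add_mem h1 h2
      | smul a x _ h => rw [map_smul, ← algebraMap_smul L]; exact N.smul_mem _ h
    have hγN : KaehlerDifferential.D ℤ L γ ∈ N := y0 ▸ hDyN i0
    rw [← KaehlerDifferential.span_range_derivation ℤ L, Submodule.span_le]
    rintro _ ⟨x, rfl⟩
    rw [← B.sum_repr x, map_sum]
    refine N.sum_mem fun i _ => ?_
    rw [hB, Algebra.smul_def, Derivation.leibniz, Derivation.leibniz_pow]
    refine N.add_mem (N.smul_mem _ (N.smul_of_tower_mem _ (N.smul_mem _ hγN))) (N.smul_mem _ ?_)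
    have := hFN (KaehlerDifferential.D ℤ F (B.repr x i))
    rwa [KaehlerDifferential.map_D] at this
  let Q : PB I L := ⟨y, ynz, Module.Basis.mk hli hsp, fun i => Module.Basis.mk_apply _ _ _⟩
  have hQD : ∀ j x, Q.D j x = D' j x := by
    intro j x
    have := Q.der_ext (Q.D j - D' j) (fun i => by
      rw [Derivation.sub_apply]
      change _ - D' j (y i) = 0
      rw [hD'2]
      split_ifs with h
      · subst h; rw [Q.D_self]; exact sub_self _
      · rw [Q.D_other _ _ (Ne.symm h), sub_zero]) x
    rw [Derivation.sub_apply] at this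
    exact sub_eq_zero.1 this
  exact ⟨⟨γ, B, hB, hγ, Q, y0, yi, fun j hj a => by rw [hQD, hD'1, if_neg hj],
    fun a => by rw [hQD, hD'1, if_pos rfl]⟩⟩

namespace LExt
variable {P : PB I F} {i0 : I} {L : Type w} [Field L] [Algebra F L] (X : LExt p P i0 L)

theorem D_gamma : X.Q.D i0 X.γ = X.γ := by
  have := X.Q.D_self i0; rwa [X.y0] at this

theorem D_gamma_i (j : I) (hj : j ≠ i0) : X.Q.D j X.γ = 0 := by
  have := X.Q.D_other j i0 hj; rwa [X.y0] at this

theorem pos (X : LExt p P i0 L) : 0 < p := by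
  by_contra h
  have : p = 0 := by omega
  subst this
  have := X.Bγ.sum_repr (1 : L)
  simp at this

theorem ker_D0 [CharP F p] (x : L) (hx : X.Q.D i0 x = 0) : ∃ a, algebraMap F L a = x := by
  have h1 : ∑ i : Fin p, (((i : ℕ) : F) * X.Bγ.repr x i) • X.Bγ i = 0 := by
    rw [← X.Bγ.sum_repr x, map_sum] at hx
    rw [← hx]
    refine Finset.sum_congr rfl fun i _ => ?_
    rw [X.hBγ, Algebra.smul_def (X.Bγ.repr x i), der_mul, X.D0, zero_mul, add_zero,
      Derivation.leibniz_pow, X.D_gamma, Algebra.smul_def, map_mul, map_natCast]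
    simp only [smul_eq_mul, nsmul_eq_mul]
    rcases Nat.eq_zero_or_pos (i : ℕ) with h | h
    · simp [h]
    · obtain ⟨k, hk⟩ : ∃ k, (i : ℕ) = k + 1 := ⟨i - 1, by omega⟩
      rw [hk]; simp only [Nat.add_sub_cancel]; ring
  have h2 := Fintype.linearIndependent_iff.1 X.Bγ.linearIndependent _ h1
  have hp0 : 0 < p := X.pos
  refine ⟨X.Bγ.repr x ⟨0, hp0⟩, ?_⟩
  conv_rhs => rw [← X.Bγ.sum_repr x]
  rw [Finset.sum_eq_single ⟨0, hp0⟩]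
  · rw [X.hBγ, Algebra.smul_def]; simp
  · intro i _ hi
    rcases mul_eq_zero.1 (h2 i) with h | h
    · rw [CharP.cast_eq_zero_iff F p] at h
      have h3 : (i : ℕ) ≠ 0 := fun h4 => hi (Fin.ext h4)
      have := Nat.le_of_dvd (by omega) h
      have := i.2
      omega
    · rw [h, zero_smul]
  · intro h; exact absurd (Finset.mem_univ _) h

theorem Phi_res [LinearOrder I] (res : DF F →+ DF L) (h1 : res 1 = 1)
    (hmul : ∀ x y : DF F, res (x * y) = res x * res y)
    (hsmul : ∀ (a : F) (ω : DF F), res (a • ω) = algebraMap F L a • res ω)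
    (hd : ∀ a : F, res (dForm F a) = dForm L (algebraMap F L a)) (ω : DF F) :
    X.Q.Phi (res ω) = fun σ => if i0 ∈ σ then 0 else algebraMap F L (P.Phi ω σ) := by
  induction ω using DF_induct with
  | one =>
    rw [h1, PB.Phi_one, PB.Phi_one]
    funext σ
    simp only [PB.dlt]
    by_cases h : σ = ∅
    · subst h; simp
    · simp [h]
  | add x y hx hy => 
    rw [map_add, map_add, hx, hy, map_add]
    funext σ
    simp only [Pi.add_apply, map_add]
    split_ifs <;> simp
  | smul a x hx =>
    rw [hsmul, map_smul, hx, map_smul]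
    funext σ
    simp only [Pi.smul_apply, smul_eq_mul, map_mul]
    split_ifs <;> simp
  | dform a x hx =>
    rw [hmul, hd, PB.Phi_dForm_mul, hx, PB.Phi_dForm_mul]
    funext σ
    simp only [wd]
    by_cases h : i0 ∈ σ
    · rw [if_pos h]
      refine Finset.sum_eq_zero fun j hj => ?_
      by_cases hji : j = i0
      · subst hji; rw [X.D0]; simp
      · rw [if_pos (Finset.mem_erase.2 ⟨Ne.symm hji, h⟩)]; simp
    · rw [if_neg h, map_sum]
      refine Finset.sum_congr rfl fun j hj => ?_
      have hji : j ≠ i0 := fun h1 => h (h1 ▸ hj)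
      rw [X.Di j hji, if_neg (fun h2 => h (Finset.mem_of_mem_erase h2)), map_zsmul, map_mul]

end LExt
end LStep
end Part13

section Part14
set_option linter.all false
open Finset

noncomputable section Gen
variable {p : ℕ} {F : Type*} [Field F]

theorem dForm_mul_self (a : F) : dForm F a * dForm F a = 0 := ExteriorAlgebra.ι_sq_zero _

theorem dForm_add (a b : F) : dForm F (a + b) = dForm F a + dForm F b := by
  simp [dForm]

theorem dForm_mul (a b : F) : dForm F (a * b) = a • dForm F b + b • dForm F a := by
  simp [dForm]

theorem dForm_pow_p [CharP F p] (a : F) : dForm F (a ^ p) = 0 := by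
  rw [dForm, Derivation.leibniz_pow, ← Nat.cast_smul_eq_nsmul F, CharP.cast_eq_zero, zero_smul, map_zero]

theorem dLog_eq (a : F) : dLog F a = a⁻¹ • dForm F a := by
  simp [dLog, dForm]

theorem dForm_eq (a : F) : dForm F a = a • dLog F a := by
  by_cases h : a = 0
  · subst h; simp [dForm]
  · rw [dLog_eq, smul_smul, mul_inv_cancel₀ h, one_smul]

theorem logForm_cons' {n : ℕ} (a : F) (x : Fin n → F) :
    logForm F (Fin.cons a x : Fin (n + 1) → F) = dLog F a * logForm F x := by
  simp [logForm, List.ofFn_succ]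

theorem log_induct {C : DF F → Prop} (add : ∀ x y, C x → C y → C (x + y))
    (log : ∀ (n : ℕ) (a : F) (x : Fin n → F), C (a • logForm F x)) (ω : DF F) : C ω := by
  let N : AddSubmonoid (DF F) := AddSubmonoid.closure {y | ∃ (n : ℕ) (a : F) (x : Fin n → F), y = a • logForm F x}
  have hN : ω ∈ N := by
    induction ω using DF_induct with
    | one => exact AddSubmonoid.subset_closure ⟨0, 1, Fin.elim0, by simp [logForm]⟩
    | add x y hx hy => exact N.add_mem hx hy
    | smul a x hx =>
      induction hx using AddSubmonoid.closure_induction with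
      | mem y h =>
        obtain ⟨n, c, x, rfl⟩ := h
        rw [smul_smul]
        exact AddSubmonoid.subset_closure ⟨_, _, _, rfl⟩
      | zero => rw [smul_zero]; exact N.zero_mem
      | add y z _ _ h1 h2 => rw [smul_add]; exact N.add_mem h1 h2
    | dform a x hx =>
      induction hx using AddSubmonoid.closure_induction with
      | mem y h =>
        obtain ⟨n, c, x, rfl⟩ := h
        refine AddSubmonoid.subset_closure ⟨n + 1, a * c, Fin.cons a x, ?_⟩
        rw [logForm_cons', dForm_eq, smul_mul_assoc, mul_smul_comm, smul_smul]
      | zero => rw [mul_zero]; exact N.zero_mem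
      | add y z _ _ h1 h2 => rw [mul_add]; exact N.add_mem h1 h2
  induction hN using AddSubmonoid.closure_induction with
  | mem y h => obtain ⟨n, c, x, rfl⟩ := h; exact log _ _ _
  | zero => have := log 0 0 Fin.elim0; rwa [zero_smul] at this
  | add y z _ _ h1 h2 => exact add _ _ h1 h2

namespace DiffStr
variable (S : DiffStr p F)

theorem d_dForm_mul (a : F) (ω : DF F) : S.d (dForm F a * ω) = -(dForm F a * S.d ω) := by
  have h := S.d_d (a • ω)
  rw [S.d_smul, map_add, S.d_smul, S.d_d, smul_zero, add_zero] at h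
  exact eq_neg_of_add_eq_zero_left h

theorem d_dLog_mul (a : F) (ω : DF F) : S.d (dLog F a * ω) = -(dLog F a * S.d ω) := by
  have h : dForm F (a⁻¹) = (-(a⁻¹ ^ 2)) • dForm F a := by
    simp only [dForm]; rw [Derivation.leibniz_inv]; simp
  rw [dLog_eq, smul_mul_assoc, S.d_smul, d_dForm_mul, h, smul_mul_assoc, ← mul_assoc,
    dForm_mul_self, zero_mul, smul_zero, zero_add, smul_mul_assoc, smul_neg]

theorem d_logForm {n : ℕ} (x : Fin n → F) : S.d (logForm F x) = 0 := by
  induction n with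
  | zero => simp [logForm, S.d_one]
  | succ n ih =>
    rw [PB.logForm_cons, d_dLog_mul, ih, mul_zero, neg_zero]

theorem d_unique (S' : DiffStr p F) (ω : DF F) : S.d ω = S'.d ω := by
  induction ω using DF_induct with
  | one => rw [S.d_one, S'.d_one]
  | add x y hx hy => rw [map_add, map_add, hx, hy]
  | smul a x hx => rw [S.d_smul, S'.d_smul, hx]
  | dform a x hx => rw [S.d_dForm_mul, S'.d_dForm_mul, hx]

theorem d_pow_smul [CharP F p] (a : F) (ω : DF F) : S.d (a ^ p • ω) = a ^ p • S.d ω := by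
  rw [S.d_smul, dForm_pow_p, zero_mul, zero_add]

theorem smul_d_mem [CharP F p] (a : F) {ω : DF F} (h : ω ∈ S.d.range) : a ^ p • ω ∈ S.d.range := by
  obtain ⟨η, rfl⟩ := h
  exact ⟨_, S.d_pow_smul a η⟩

theorem sp_log' (n : ℕ) (a : F) (x : Fin n → F) :
    S.sp (a • logForm F x) - a ^ p • logForm F x ∈ S.d.range := by
  obtain ⟨η, _, h⟩ := S.sp_log n a x
  exact ⟨η, by rw [h]; abel⟩

theorem sp_smul [CharP F p] (a : F) (ω : DF F) : S.sp (a • ω) - a ^ p • S.sp ω ∈ S.d.range := by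
  induction ω using log_induct with
  | add x y hx hy =>
    have := S.d.range.add_mem hx hy
    convert this using 1
    rw [smul_add, map_add, map_add, smul_add]; abel
  | log n c x =>
    have h1 := S.sp_log' n (a * c) x
    have h2 := S.smul_d_mem a (S.sp_log' n c x)
    convert S.d.range.sub_mem h1 h2 using 1
    rw [smul_smul, smul_sub, mul_pow, smul_smul]; abel

theorem sp_dLog_mul (b : F) (ω : DF F) :
    S.sp (dLog F b * ω) - dLog F b * S.sp ω ∈ S.d.range := by
  induction ω using log_induct with
  | add x y hx hy =>
    have := S.d.range.add_mem hx hy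
    convert this using 1
    rw [mul_add, map_add, map_add, mul_add]; abel
  | log n c x =>
    have h1 := S.sp_log' (n + 1) c (Fin.cons b x)
    obtain ⟨η, h2⟩ := S.sp_log' n c x
    have h3 : dLog F b * (S.sp (c • logForm F x) - c ^ p • logForm F x) ∈ S.d.range :=
      ⟨-(dLog F b * η), by rw [map_neg, S.d_dLog_mul, neg_neg, h2]⟩
    convert S.d.range.sub_mem h1 h3 using 1
    rw [logForm_cons', mul_sub, mul_smul_comm, mul_smul_comm]; abel

theorem sp_unique (S' : DiffStr p F) (ω : DF F) : S.sp ω - S'.sp ω ∈ S'.d.range := by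
  induction ω using log_induct with
  | add x y hx hy =>
    convert S'.d.range.add_mem hx hy using 1
    rw [map_add, map_add]; abel
  | log n c x =>
    have h1 := S.sp_log' n c x
    have h2 := S'.sp_log' n c x
    obtain ⟨η, h1⟩ := h1
    have h1 : S.sp (c • logForm F x) - c ^ p • logForm F x ∈ S'.d.range :=
      ⟨η, by rw [← S.d_unique S', h1]⟩
    convert S'.d.range.sub_mem h1 h2 using 1
    abel

/-- `Ex t` : span of `sp^s (dη)`, `s < t`. -/
def Ex (t : ℕ) : AddSubgroup (DF F) :=
  AddSubgroup.closure {x | ∃ s < t, ∃ η, x = spIter S s (S.d η)}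

theorem spIter_succ (t : ℕ) (x : DF F) : spIter S (t + 1) x = S.sp (spIter S t x) :=
  Function.iterate_succ_apply' _ _ _

theorem spIter_succ' (t : ℕ) (x : DF F) : spIter S (t + 1) x = spIter S t (S.sp x) :=
  Function.iterate_succ_apply _ _ _

theorem Ex_mono {s t : ℕ} (h : s ≤ t) : S.Ex s ≤ S.Ex t :=
  AddSubgroup.closure_mono fun x ⟨r, hr, η, hx⟩ => ⟨r, by omega, η, hx⟩

theorem spIter_mem_Ex {s t : ℕ} (h : s < t) (η) : spIter S s (S.d η) ∈ S.Ex t :=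
  AddSubgroup.subset_closure ⟨s, h, η, rfl⟩

theorem range_le_Ex (t : ℕ) : S.d.range ≤ S.Ex (t + 1) := by
  rintro _ ⟨η, rfl⟩
  exact S.spIter_mem_Ex (s := 0) (by omega) η

theorem sp_Ex {t : ℕ} {x : DF F} (h : x ∈ S.Ex t) : S.sp x ∈ S.Ex (t + 1) := by
  induction h using AddSubgroup.closure_induction with
  | mem y h =>
    obtain ⟨s, hs, η, rfl⟩ := h
    rw [← spIter_succ]
    exact S.spIter_mem_Ex (by omega) _
  | zero => rw [map_zero]; exact zero_mem _
  | add y z _ _ h1 h2 => rw [map_add]; exact add_mem h1 h2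
  | neg y _ h => rw [map_neg]; exact neg_mem h

/-- ungraded version of the group `K`. -/
def KK (A : ℕ → Subring F) : AddSubgroup (DF F) :=
  AddSubgroup.closure (Set.range (asMap S) ∪ Set.range S.d ∪
    {x | ∃ t, ∃ M ∈ A t, ∃ v, x = M • spIter S t (S.d v)})

variable (A A' : ℕ → Subring F)

theorem asMap_mem (x : DF F) : S.sp x - x ∈ S.KK A :=
  AddSubgroup.subset_closure (Or.inl (Or.inl ⟨x, rfl⟩))

theorem d_mem (x : DF F) : S.d x ∈ S.KK A :=
  AddSubgroup.subset_closure (Or.inl (Or.inr ⟨x, rfl⟩))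

theorem range_le : S.d.range ≤ S.KK A := by rintro _ ⟨x, rfl⟩; exact S.d_mem A x

theorem gen_mem {t : ℕ} {M : F} (hM : M ∈ A t) (v) : M • spIter S t (S.d v) ∈ S.KK A :=
  AddSubgroup.subset_closure (Or.inr ⟨t, M, hM, v, rfl⟩)

theorem KK_le {N : AddSubgroup (DF F)} (h1 : ∀ x, S.sp x - x ∈ N) (h2 : ∀ x, S.d x ∈ N)
    (h3 : ∀ t, ∀ M ∈ A t, ∀ v, M • spIter S t (S.d v) ∈ N) : S.KK A ≤ N := by
  rw [KK, AddSubgroup.closure_le]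
  rintro _ ((⟨x, rfl⟩ | ⟨x, rfl⟩) | ⟨t, M, hM, v, rfl⟩)
  · exact h1 x
  · exact h2 x
  · exact h3 t M hM v

theorem sp_mem_iff (x : DF F) : S.sp x ∈ S.KK A ↔ x ∈ S.KK A := by
  have := S.asMap_mem A x
  constructor
  · intro h; have := sub_mem h this; rwa [sub_sub_cancel] at this
  · intro h; have := add_mem h this; rwa [add_sub_cancel] at this

theorem smul_Ex (hA : ∀ t, A (t + 1) ≤ A t) {t : ℕ} {M : F} (hM : M ∈ A t) {x : DF F}
    (hx : x ∈ S.Ex (t + 1)) : M • x ∈ S.KK A := by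
  have hanti : Antitone A := antitone_nat_of_succ_le hA
  induction hx using AddSubgroup.closure_induction with
  | mem y h =>
    obtain ⟨s, hs, η, rfl⟩ := h
    exact S.gen_mem A (hanti (show s ≤ t by omega) hM) η
  | zero => rw [smul_zero]; exact zero_mem _
  | add y z _ _ h1 h2 => rw [smul_add]; exact add_mem h1 h2
  | neg y _ h => rw [smul_neg]; exact neg_mem h

theorem KK_mono (h : ∀ t, A t ≤ A' t) : S.KK A ≤ S.KK A' :=
  S.KK_le A (S.asMap_mem A') (S.d_mem A') fun t M hM v => S.gen_mem A' (h t hM) v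

theorem KK_le_of_pow [CharP F p] (h : ∀ t, ∀ M ∈ A t, M ^ p ∈ A' (t + 1)) : S.KK A ≤ S.KK A' := by
  refine S.KK_le A (S.asMap_mem A') (S.d_mem A') fun t M hM v => ?_
  rw [← S.sp_mem_iff]
  have h1 := S.range_le A' (S.sp_smul M (spIter S t (S.d v)))
  have h2 := S.gen_mem A' (h t M hM) v
  rw [spIter_succ] at h2
  have := add_mem h1 h2
  rwa [sub_add_cancel] at this

end DiffStr

section Res
variable {E : Type*} [Field E] [Algebra F E] {SF : DiffStr p F} {SE : DiffStr p E}
  (R : DiffRes p F E SF SE)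

theorem res_dLog (a : F) : R.res (dLog F a) = dLog E (algebraMap F E a) := by
  rw [dLog_eq, R.res_smul, R.res_dForm, dLog_eq, map_inv₀]

theorem res_logForm {n : ℕ} (x : Fin n → F) :
    R.res (logForm F x) = logForm E (fun i => algebraMap F E (x i)) := by
  induction n with
  | zero => simp [logForm, R.res_one]
  | succ n ih => rw [PB.logForm_cons, R.res_mul, ih, res_dLog, PB.logForm_cons]

theorem res_sp (x : DF F) : R.res (SF.sp x) - SE.sp (R.res x) ∈ SE.d.range := by
  induction x using log_induct with
  | add x y hx hy =>
    convert SE.d.range.add_mem hx hy using 1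
    simp only [map_add]; abel
  | log n c x =>
    obtain ⟨η, h1⟩ := SF.sp_log' n c x
    have h2 := SE.sp_log' n (algebraMap F E c) (fun i => algebraMap F E (x i))
    have h3 := congrArg R.res h1
    rw [R.res_d, map_sub, R.res_smul, res_logForm, map_pow] at h3
    convert SE.d.range.sub_mem ⟨R.res η, h3⟩ h2 using 1
    rw [R.res_smul, res_logForm]; abel

theorem res_Ex {t : ℕ} {x : DF F} (h : x ∈ SF.Ex t) : R.res x ∈ SE.Ex t := by
  have key : ∀ s η, R.res (spIter SF s (SF.d η)) ∈ SE.Ex (s + 1) := by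
    intro s
    induction s with
    | zero => intro η; exact SE.range_le_Ex 0 ⟨R.res η, (R.res_d η).symm⟩
    | succ s ih =>
      intro η
      rw [SF.spIter_succ]
      have h1 := SE.range_le_Ex (s + 1) (res_sp R (spIter SF s (SF.d η)))
      have := add_mem h1 (SE.sp_Ex (ih η))
      rwa [sub_add_cancel] at this
  induction h using AddSubgroup.closure_induction with
  | mem y h =>
    obtain ⟨s, hs, η, rfl⟩ := h
    exact SE.Ex_mono (by omega) (key s η)
  | zero => rw [map_zero]; exact zero_mem _
  | add y z _ _ h1 h2 => rw [map_add]; exact add_mem h1 h2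
  | neg y _ h => rw [map_neg]; exact neg_mem h

theorem res_KK (A : ℕ → Subring F) (A' : ℕ → Subring E) (hA' : ∀ t, A' (t + 1) ≤ A' t)
    (h : ∀ t, ∀ M ∈ A t, algebraMap F E M ∈ A' t) : ∀ x ∈ SF.KK A, R.res x ∈ SE.KK A' := by
  intro x hx
  have : SF.KK A ≤ (SE.KK A').comap R.res := by
    refine SF.KK_le A (fun x => ?_) (fun x => ?_) fun t M hM v => ?_
    · rw [AddSubgroup.mem_comap, map_sub]
      have h1 := SE.range_le A' (res_sp R x)
      have := add_mem h1 (SE.asMap_mem A' (R.res x))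
      rwa [sub_add_sub_cancel] at this
    · rw [AddSubgroup.mem_comap, R.res_d]; exact SE.d_mem A' _
    · rw [AddSubgroup.mem_comap, R.res_smul]
      exact SE.smul_Ex A' hA' (h t M hM) (res_Ex R (SF.spIter_mem_Ex (by omega) v))
  exact this hx

end Res

theorem DiffStr.KK_unique (S S' : DiffStr p F) (A : ℕ → Subring F) (hA : ∀ t, A (t + 1) ≤ A t) :
    S.KK A ≤ S'.KK A := by
  intro x hx
  have := res_KK (F := F) (E := F) (SF := S) (SE := S') ⟨AddMonoidHom.id _, rfl, fun _ _ => rfl,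
    fun _ _ => rfl, fun _ => rfl, fun _ _ h => h, fun ω => S.d_unique S' ω⟩ A A hA (fun t M h => h) x hx
  exact this

/-- the family of `p^(t+1)`-th powers -/
def AP (p : ℕ) (F : Type*) [Field F] [Fact p.Prime] [CharP F p] (t : ℕ) : Subring F :=
  (iterateFrobenius F p (t + 1)).range

/-- The relation subgroup, ungraded. -/
def DiffStr.H (S : DiffStr p F) : AddSubgroup (DF F) := (asMap S).range ⊔ S.d.range

theorem DiffStr.H_le_KK (S : DiffStr p F) (A : ℕ → Subring F) : S.H ≤ S.KK A := by
  refine sup_le ?_ (S.range_le A)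
  rintro _ ⟨x, rfl⟩
  exact S.asMap_mem A x

theorem DiffStr.KK_AP [Fact p.Prime] [CharP F p] (S : DiffStr p F) : S.KK (AP p F) ≤ S.H := by
  have hd : ∀ x, S.d x ∈ S.H := fun x => AddSubgroup.mem_sup_right ⟨x, rfl⟩
  have ha : ∀ x, S.sp x - x ∈ S.H := fun x => AddSubgroup.mem_sup_left ⟨x, rfl⟩
  refine S.KK_le _ ha hd fun t M hM v => ?_
  obtain ⟨c, rfl⟩ := hM
  rw [iterateFrobenius_def]
  induction t with
  | zero =>
    rw [zero_add, pow_one]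
    change c ^ p • S.d v ∈ _
    rw [← S.d_pow_smul]; exact hd _
  | succ t ih =>
    obtain ⟨η, h1⟩ := S.sp_smul (c ^ p ^ (t + 1)) (spIter S t (S.d v))
    rw [S.spIter_succ]
    have h2 := ha (c ^ p ^ (t + 1) • spIter S t (S.d v))
    have h3 := sub_mem (add_mem h2 ih) (hd η)
    rw [h1, sub_add_cancel, sub_sub_cancel, ← pow_mul, ← pow_succ] at h3
    exact h3

end Gen
end Part14

section Part15
set_option linter.all false
open Finset

noncomputable section ResEx
variable {p : ℕ} {F : Type*} [Field F] {E : Type*} [Field E] [Algebra F E]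

def resAlg (F E : Type*) [Field F] [Field E] [Algebra F E] : DF F →ₐ[F] DF E :=
  ExteriorAlgebra.lift F ⟨((ExteriorAlgebra.ι E).restrictScalars F) ∘ₗ
    (KaehlerDifferential.map ℤ ℤ F E), fun m => by
      simp only [LinearMap.comp_apply, LinearMap.restrictScalars_apply]
      exact ExteriorAlgebra.ι_sq_zero _⟩

theorem resAlg_ι (m : KaehlerDifferential ℤ F) : resAlg F E (ExteriorAlgebra.ι F m) =
    ExteriorAlgebra.ι E (KaehlerDifferential.map ℤ ℤ F E m) := by
  rw [resAlg, ExteriorAlgebra.lift_ι_apply]; rfl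

theorem resAlg_dForm (a : F) : resAlg F E (dForm F a) = dForm E (algebraMap F E a) := by
  rw [dForm, resAlg_ι, KaehlerDifferential.map_D]; rfl

def mkRes (SF : DiffStr p F) (SE : DiffStr p E) : DiffRes p F E SF SE where
  res := (resAlg F E : DF F →+ DF E)
  res_one := map_one (resAlg F E)
  res_mul := map_mul (resAlg F E)
  res_smul a ω := by
    change resAlg F E (a • ω) = algebraMap F E a • resAlg F E ω
    rw [map_smul, algebraMap_smul]
  res_dForm := resAlg_dForm
  res_grade n ω h := by
    change resAlg F E ω ∈ _
    induction h using Submodule.pow_induction_on_left' with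
    | algebraMap r =>
      rw [AlgHom.commutes, omegaPow, pow_zero, Submodule.mem_one]
      exact ⟨algebraMap F E r, (IsScalarTower.algebraMap_apply F E (DF E) r).symm⟩
    | add x y i _ _ hx hy => rw [map_add]; exact add_mem hx hy
    | mem_mul m hm i x hx ih =>
      obtain ⟨α, rfl⟩ := hm
      rw [map_mul, resAlg_ι, omegaPow, pow_succ']
      exact Submodule.mul_mem_mul ⟨_, rfl⟩ ih
  res_d ω := by
    change resAlg F E (SF.d ω) = SE.d (resAlg F E ω)
    induction ω using DF_induct with
    | one => rw [SF.d_one, map_one, SE.d_one, map_zero]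
    | add x y hx hy => simp only [map_add, hx, hy]
    | smul a x hx =>
      rw [SF.d_smul, map_add, map_mul, map_smul, map_smul, resAlg_dForm, hx,
        ← algebraMap_smul E a (SE.d _), ← algebraMap_smul E a, SE.d_smul]
    | dform a x hx =>
      rw [SF.d_dForm_mul, map_neg, map_mul, map_mul, resAlg_dForm, hx, SE.d_dForm_mul]

theorem res_unique (f g : DF F → DF E) (ha : ∀ x y, f (x + y) = f x + f y)
    (ha' : ∀ x y, g (x + y) = g x + g y) (h1 : f 1 = g 1)
    (hs : ∀ (a : F) x, f (a • x) = algebraMap F E a • f x)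
    (hs' : ∀ (a : F) x, g (a • x) = algebraMap F E a • g x)
    (hd : ∀ (a : F) x, f (dForm F a * x) = dForm E (algebraMap F E a) * f x)
    (hd' : ∀ (a : F) x, g (dForm F a * x) = dForm E (algebraMap F E a) * g x) (ω) : f ω = g ω := by
  induction ω using DF_induct with
  | one => exact h1
  | add x y hx hy => rw [ha, ha', hx, hy]
  | smul a x hx => rw [hs, hs', hx]
  | dform a x hx => rw [hd, hd', hx]

theorem res_comp {L : Type*} [Field L] [Algebra F L] [Algebra L E] [IsScalarTower F L E]
    {SF : DiffStr p F} {SL : DiffStr p L} {SE : DiffStr p E}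
    (R : DiffRes p F E SF SE) (R1 : DiffRes p F L SF SL) (R2 : DiffRes p L E SL SE) (ω : DF F) :
    R2.res (R1.res ω) = R.res ω := by
  apply res_unique (fun x => R2.res (R1.res x)) (fun x => R.res x)
  · intro x y; simp
  · intro x y; simp
  · simp only [R1.res_one, R2.res_one, R.res_one]
  · intro a x; simp only [R1.res_smul, R2.res_smul, IsScalarTower.algebraMap_apply F L E]
  · intro a x; simp only [R.res_smul]
  · intro a x
    simp only [R1.res_mul, R2.res_mul, R1.res_dForm, R2.res_dForm, IsScalarTower.algebraMap_apply F L E]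
  · intro a x; simp only [R.res_mul, R.res_dForm]

theorem res_inv [Algebra E F] (he : ∀ x : F, algebraMap E F (algebraMap F E x) = x)
    {SF : DiffStr p F} {SE : DiffStr p E}
    (R : DiffRes p F E SF SE) (R' : DiffRes p E F SE SF) (ω : DF F) : R'.res (R.res ω) = ω := by
  induction ω using DF_induct with
  | one => rw [R.res_one, R'.res_one]
  | add x y hx hy => rw [map_add, map_add, hx, hy]
  | smul a x hx => rw [R.res_smul, R'.res_smul, hx, he]
  | dform a x hx => rw [R.res_mul, R'.res_mul, hx, R.res_dForm, R'.res_dForm, he]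

/-- base case -/
theorem base_case (hp : p.Prime) [CharP F p] [CharP E p] {SF : DiffStr p F} {SE : DiffStr p E}
    (R : DiffRes p F E SF SE) (hs : Function.Surjective (algebraMap F E)) (ω : DF F)
    (h : R.res ω ∈ SE.H) : ω ∈ SF.H := by
  have hF := Fact.mk hp
  let e : F ≃+* E := RingEquiv.ofBijective (algebraMap F E) ⟨(algebraMap F E).injective, hs⟩
  letI : Algebra E F := e.symm.toRingHom.toAlgebra
  have he : ∀ x : F, algebraMap E F (algebraMap F E x) = x := fun x => e.symm_apply_apply x
  have h2 := res_KK (mkRes SE SF) (AP p E) (AP p F) (fun t => ?_) (fun t M hM => ?_) _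
    (SE.H_le_KK _ h)
  · have h3 := SF.KK_AP h2
    rw [res_inv he R (mkRes SE SF) ω] at h3
    exact h3
  · rintro _ ⟨c, rfl⟩
    exact ⟨c ^ p, by rw [iterateFrobenius_def, iterateFrobenius_def, ← pow_mul, ← pow_succ']⟩
  · obtain ⟨c, rfl⟩ := hM
    exact ⟨algebraMap E F c, by rw [iterateFrobenius_def, iterateFrobenius_def, map_pow]⟩

end ResEx
end Part15

section Part16
set_option linter.all false
open Finset

noncomputable section S1

theorem s1_core {p : ℕ} (hp : p.Prime) {I : Type*} [LinearOrder I] [WellFoundedLT I]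
    {L : Type*} [Field L] [CharP L p]
    (W : WD p (Option I) L) (hnone : none ∈ W.J) (om v U W0 W1 : Finset I → L)
    (hv : FS v) (hU : FS U) (hW0 : FS W0) (hW1 : FS W1) (T : Finset I → Prop)
    (hJ : ∀ τ, v τ ≠ 0 → ∀ i ∈ τ, some i ∈ W.J)
    (hom : ∀ σ, W.dl0 (om σ) = 0)
    (H1 : ∀ σ, T σ → om σ = U σ ^ p - U σ + dd W.Di W0 σ)
    (H2 : ∀ σ, 0 = v σ ^ p - v σ + W.dl0 (W0 σ) - dd W.Di W1 σ) :
    ∃ Y Z : Finset I → L, FS Y ∧ FS Z ∧ (∀ σ, W.dl0 (Y σ) = 0) ∧ (∀ σ, W.dl0 (Z σ) = 0) ∧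
      ∀ σ, T σ → om σ = Y σ ^ p - Y σ + dd W.Di Z σ := by
  have hF := Fact.mk hp
  classical
  have hdp : ∀ x, (W.dl0)^[p] x = W.dl0 x := W.pow none
  have hrd : ∀ x : Finset I → L, ∀ σ, dd W.Di (fun σ => rho p W.dl0 (x σ)) σ = rho p W.dl0 (dd W.Di x σ) :=
    fun x σ => congrFun (rho_dd W.dl0 W.Di W.Di_dl0 x) σ
  have hHyp : W.Hyp v := by
    refine ⟨-(fun σ => rho p W.dl0 (W1 σ)), (hW1.map (fun _ a => rho p W.dl0 a) (fun _ => rho_zero _)).neg,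
      fun σ => ?_, fun σ => ?_⟩
    · rw [Pi.neg_apply, map_neg, der_rho hp _ hdp, neg_zero]
    · rw [dd_neg, Pi.neg_apply, hrd]
      have h := congrArg (rho p W.dl0) (H2 σ)
      rw [rho_zero, rho_sub, rho_add, rho_sub, rho_der hp _ hdp, rho_of_const hp _ _ (der_pow_p _ _)] at h
      linear_combination h
  obtain ⟨V, z, hV, hz, hz0, hV1, hV2⟩ := W.propN hp hnone v hv hHyp hJ
  have hdv : ∀ σ, dd W.Di v σ = W.dl0 (dd W.Di W0 σ) := by
    intro σ
    have h : v = sc p v + (fun σ => W.dl0 (W0 σ)) - dd W.Di W1 := by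
      funext τ
      have := H2 τ
      simp only [Pi.sub_apply, Pi.add_apply, sc]
      linear_combination this
    rw [h, dd_sub, dd_add, dd_sc, dd_dd _ W.Di_comm, zero_add, sub_zero]
    exact congrFun (dd_map W.Di W.Di (W.dl0 : L →+ L) (fun j a => (W.Di_dl0 j a).symm) W0) σ
  have hdU : ∀ σ, T σ → W.dl0 (U σ) = dd W.Di v σ := by
    intro σ hσ
    have h := hom σ
    rw [H1 σ hσ, map_add, map_sub, der_pow_p, ← hdv] at h
    linear_combination -h
  let Y : Finset I → L := fun σ => if T σ then U σ - V σ else 0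
  have hY0 : ∀ σ, W.dl0 (Y σ) = 0 := by
    intro σ
    simp only [Y]
    split_ifs with h
    · rw [map_sub, hdU σ h, hV1, sub_self]
    · rw [map_zero]
  refine ⟨Y, z + fun σ => rho p W.dl0 (W0 σ), ?_, ?_, hY0, ?_, ?_⟩
  · exact (hU.sub hV).map (fun σ a => if T σ then a else 0) (by simp)
  · exact hz.add (hW0.map (fun _ a => rho p W.dl0 a) (fun _ => rho_zero _))
  · intro σ
    rw [Pi.add_apply, map_add, hz0, der_rho hp _ hdp, add_zero]
  · intro σ hσ
    have hUY : U σ = Y σ + V σ := by simp only [Y, if_pos hσ]; ring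
    have h := congrArg (rho p W.dl0) (H1 σ hσ)
    rw [rho_of_const hp _ _ (hom σ), rho_add, rho_sub, rho_of_const hp _ _ (der_pow_p _ _), hUY,
      rho_add, rho_of_const hp _ _ (hY0 σ), add_pow_char (p := p)] at h
    rw [dd_add, Pi.add_apply, hrd, ← hV2]
    linear_combination h

universe w
variable {p : ℕ} {I : Type*} {F : Type w} [Field F] {P : PB I F} {i0 : I} {L : Type w} [Field L]
  [Algebra F L]

open Classical in
def LExt.W (X : LExt p P i0 L) (hp : p.Prime) [CharP L p] (J : Set I) (hi0 : i0 ∉ J) :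
    WD p (Option I) L where
  D
    | none => X.Q.D i0
    | some j => if j ∈ J then X.Q.D j else 0
  y
    | none => X.γ
    | some j => X.Q.y j
  J := {j | ∀ i, j = some i → i ∈ J}
  comm := by
    rintro (_ | i) (_ | j) x
    · rfl
    · by_cases hj : j ∈ J <;> simp [hj, X.Q.comm i0 j]
    · by_cases hi : i ∈ J <;> simp [hi, X.Q.comm i0 i]
    · by_cases hi : i ∈ J <;> by_cases hj : j ∈ J <;> simp [hi, hj, X.Q.comm i j]
  pow := by
    rintro (_ | i) x
    · exact X.Q.pow hp i0 x
    · by_cases hi : i ∈ J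
      · simp only [if_pos hi]; exact X.Q.pow hp i x
      · simp only [if_neg hi]
        obtain ⟨q, rfl⟩ : ∃ q, p = q + 1 := ⟨p - 1, by have := hp.pos; omega⟩
        rw [Function.iterate_succ_apply']; rfl
  ynz := by
    rintro (_ | j) _
    · have := X.Q.ynz i0
      rw [X.y0] at this
      exact this
    · exact X.Q.ynz j
  yself := by
    rintro (_ | j) hj
    · exact X.D_gamma
    · have : j ∈ J := hj j rfl
      simp only [if_pos this]; exact X.Q.D_self j
  yother := by
    rintro (_ | j) hj (_ | i) hij
    · exact absurd rfl hij
    · by_cases hi : i ∈ J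
      · simp only [if_pos hi]
        exact X.D_gamma_i i (fun h => hi0 (h ▸ hi))
      · simp [hi]
    · have h1 : j ∈ J := hj j rfl
      exact X.Q.D_other _ _ (fun h => hi0 (h ▸ h1))
    · by_cases hi : i ∈ J
      · simp only [if_pos hi]
        exact X.Q.D_other _ _ (fun h => hij (by rw [h]))
      · simp [hi]
  off := by
    rintro (_ | j) hj
    · exact absurd (fun i h => by cases h) hj
    · have : j ∉ J := fun h => hj (fun i hi => by cases hi; exact h)
      simp only [if_neg this]
  fin := by
    intro x
    refine (((X.Q.fin x).image some).insert none).subset ?_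
    rintro (_ | j) hj
    · exact Set.mem_insert _ _
    · refine Set.mem_insert_of_mem _ ⟨j, fun h => hj ?_, rfl⟩
      by_cases hi : j ∈ J <;> simp [hi, h]

theorem FS.comp_insert {I : Type*} [LinearOrder I] {E : Type*} [Field E] {x : Finset I → E} (hx : FS x)
    (i0 : I) (T : Finset I → Prop) (hT : ∀ σ, T σ → i0 ∉ σ) [DecidablePred T] :
    FS (fun σ => if T σ then x (insert i0 σ) else 0) := by
  refine (Set.Finite.image (fun σ => σ.erase i0) hx).subset fun σ hσ => ?_
  rw [Function.mem_support] at hσ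
  by_cases h : T σ
  · rw [if_pos h] at hσ
    exact ⟨insert i0 σ, hσ, Finset.erase_insert (hT σ h)⟩
  · rw [if_neg h] at hσ; exact absurd rfl hσ

theorem dd_insert_bot {I : Type*} [LinearOrder I] {E : Type*} [Field E] (D : I → Derivation ℤ E E)
    (w : Finset I → E) (i0 : I) (hbot : ∀ i, i0 ≤ i) (σ : Finset I) (h : i0 ∉ σ) :
    dd D w (insert i0 σ) = D i0 (w σ) - dd D (fun τ => w (insert i0 τ)) σ := by
  simp only [dd]
  rw [Finset.sum_insert h, Finset.erase_insert h, PB.eps_min _ _ (fun i _ => hbot i), one_smul,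
    sub_eq_add_neg, ← Finset.sum_neg_distrib]
  congr 1
  refine Finset.sum_congr rfl fun j hj => ?_
  have hj0 : j ≠ i0 := fun h1 => h (h1 ▸ hj)
  have h1 : (insert i0 σ).erase j = insert i0 (σ.erase j) := Finset.erase_insert_of_ne hj0.symm
  have h2 : eps j (insert i0 σ) = - eps j σ := by
    have h3 : i0 < j := lt_of_le_of_ne (hbot j) hj0.symm
    rw [eps, eps, Finset.filter_insert, if_pos h3, Finset.card_insert_of_notMem (by simp [h]), pow_succ]
    ring
  rw [h1, h2, neg_smul]

theorem s1_fun (hp : p.Prime) [LinearOrder I] [WellFoundedLT I] [CharP F p] [CharP L p]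
    (X : LExt p P i0 L) (hbot : ∀ i, i0 ≤ i) (J : Set I) (hi0 : i0 ∉ J)
    (om : Finset I → F) (u w : Finset I → L) (hu : FS u) (hw : FS w)
    (H1 : ∀ σ, (∀ i ∈ σ, i ∈ J) → algebraMap F L (om σ) = u σ ^ p - u σ + dd X.Q.D w σ)
    (H2 : ∀ σ, (∀ i ∈ σ, i ∈ J) → 0 = u (insert i0 σ) ^ p - u (insert i0 σ) +
      dd X.Q.D w (insert i0 σ)) :
    ∃ Y Z : Finset I → F, FS Y ∧ FS Z ∧
      ∀ σ, (∀ i ∈ σ, i ∈ J) → om σ = Y σ ^ p - Y σ + dd P.D Z σ := by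
  classical
  set T : Finset I → Prop := fun σ => ∀ i ∈ σ, i ∈ J with hT
  have hTi : ∀ σ, T σ → i0 ∉ σ := fun σ h h1 => hi0 (h _ h1)
  have hTe : ∀ σ j, T σ → T (σ.erase j) := fun σ j h i hi => h i (Finset.mem_of_mem_erase hi)
  set W := X.W hp J hi0 with hW
  have hd0 : ∀ x, W.dl0 x = X.Q.D i0 x := fun x => rfl
  have hdi : ∀ j ∈ J, ∀ x, W.Di j x = X.Q.D j x := fun j hj x => by
    change (if j ∈ J then X.Q.D j else 0) x = _
    rw [if_pos hj]
  have hdi' : ∀ j, j ∉ J → ∀ x, W.Di j x = 0 := fun j hj x => by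
    change (if j ∈ J then X.Q.D j else 0) x = _
    rw [if_neg hj]; rfl
  have hdd : ∀ x y : Finset I → L, (∀ σ, T σ → x σ = y σ) → ∀ σ, T σ → dd W.Di x σ = dd X.Q.D y σ := by
    intro x y h σ hσ
    refine Finset.sum_congr rfl fun j hj => ?_
    rw [h _ (hTe σ j hσ), hdi j (hσ j hj)]
  obtain ⟨Y, Z, hY, hZ, hY0, hZ0, hYZ⟩ := s1_core hp W (fun i h => by cases h)
    (fun σ => algebraMap F L (om σ)) (fun σ => if T σ then u (insert i0 σ) else 0) u
    (fun σ => if T σ then w σ else 0) (fun σ => if T σ then w (insert i0 σ) else 0)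
    (hu.comp_insert i0 T hTi) hu (hw.map (fun σ a => if T σ then a else 0) (by simp))
    (hw.comp_insert i0 T hTi) T (by
      intro τ h i hi
      have : T τ := by by_contra h1; exact h (if_neg h1)
      intro k hk
      cases hk
      exact this i hi)
    (fun σ => by rw [hd0, X.D0]) (by
      intro σ hσ
      rw [H1 σ hσ, hdd _ w (fun τ h => if_pos h) σ hσ]) (by
      intro σ
      by_cases hσ : T σ
      · simp only [if_pos hσ]
        rw [hdd _ (fun τ => w (insert i0 τ)) (fun τ h => if_pos h) σ hσ, hd0, H2 σ hσ,
          dd_insert_bot _ _ _ hbot _ (hTi σ hσ)]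
        ring
      · simp only [if_neg hσ, zero_pow hp.ne_zero, map_zero, sub_zero, add_zero, zero_sub]
        symm
        rw [neg_eq_zero]
        refine Finset.sum_eq_zero fun j hj => ?_
        by_cases hjJ : j ∈ J
        · have : ¬ T (σ.erase j) := fun h => hσ fun i hi => by
            by_cases hij : i = j
            · exact hij ▸ hjJ
            · exact h i (Finset.mem_erase.2 ⟨hij, hi⟩)
          beta_reduce
          rw [if_neg this, map_zero, smul_zero]
        · rw [hdi' j hjJ, smul_zero])
  choose Y' hY' using fun σ => X.ker_D0 (Y σ) (hY0 σ)
  choose Z' hZ' using fun σ => X.ker_D0 (Z σ) (hZ0 σ)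
  refine ⟨Y', Z', hY.subset fun σ h h1 => h ?_, hZ.subset fun σ h h1 => h ?_, fun σ hσ => ?_⟩
  · apply (algebraMap F L).injective; rw [hY', h1, map_zero]
  · apply (algebraMap F L).injective; rw [hZ', h1, map_zero]
  · apply (algebraMap F L).injective
    rw [hYZ σ hσ, map_add, map_sub, map_pow, hY']
    congr 1
    rw [hdd _ Z (fun _ _ => rfl) σ hσ]
    simp only [dd, map_sum, map_zsmul]
    refine Finset.sum_congr rfl fun j hj => ?_
    rw [← hZ', X.Di j (fun h => hi0 (h ▸ hσ j hj))]

end S1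
end Part16

section Part17
set_option linter.all false
open Finset

noncomputable section StepOne
universe w

/-- multiples of `dlog b`, `b ∈ B` -/
def DL {F : Type*} [Field F] (B : Set F) : AddSubgroup (DF F) :=
  AddSubgroup.closure {y | ∃ b ∈ B, ∃ x, y = dLog F b * x}

theorem DL_mem {F : Type*} [Field F] {B : Set F} {b : F} (h : b ∈ B) (x : DF F) : dLog F b * x ∈ DL B :=
  AddSubgroup.subset_closure ⟨b, h, x, rfl⟩

theorem H_unique {p : ℕ} {F : Type*} [Field F] (S S' : DiffStr p F) : S.H ≤ S'.H := by
  refine sup_le ?_ ?_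
  · rintro _ ⟨x, rfl⟩
    have h1 : S.sp x - S'.sp x ∈ S'.H := AddSubgroup.mem_sup_right (S.sp_unique S' x)
    have h2 : S'.sp x - x ∈ S'.H := AddSubgroup.mem_sup_left ⟨x, rfl⟩
    have := add_mem h1 h2
    rw [sub_add_sub_cancel] at this
    exact this
  · rintro _ ⟨x, rfl⟩
    rw [S.d_unique S']
    exact AddSubgroup.mem_sup_right ⟨x, rfl⟩

theorem PB.smul_e {I F : Type*} [Field F] (P : PB I F) [LinearOrder I] (c : I) (σ : Finset I) (h : c ∈ σ)
    (a : F) : a • P.e σ = dLog F (P.y c) * ((eps c σ • a) • P.e (σ.erase c)) := by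
  apply P.Phi_injective
  rw [dLog, ← P.hB, P.Phi_ι_mul, map_smul, map_smul, P.Phi_e, P.Phi_e]
  funext τ
  rw [P.wd_single]
  simp only [Pi.smul_apply, PB.dlt, smul_eq_mul, mul_ite, mul_one, mul_zero]
  by_cases h1 : τ = σ
  · subst h1
    simp only [if_pos h, if_true]
    rw [smul_smul]
    have : eps c τ * eps c τ = 1 := by
      rw [eps, ← mul_pow]; simp
    rw [this, one_smul]
  · rw [if_neg h1]
    split_ifs with h2 h3
    · exact absurd (by rw [← Finset.insert_erase h2, h3, Finset.insert_erase h]) h1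
    · simp
    · rfl

theorem PB.mem_of_support {I F : Type*} [Field F] (P : PB I F) [LinearOrder I] (C : Set I)
    (N : AddSubgroup (DF F)) (hN : ∀ c ∈ C, ∀ x, dLog F (P.y c) * x ∈ N) (ω : DF F)
    (h : ∀ σ, (∀ i ∈ σ, i ∉ C) → P.Phi ω σ = 0) : ω ∈ N := by
  rw [P.eq_inv ω, PB.inv]
  refine N.sum_mem fun σ hσ => ?_
  have h1 : P.Phi ω σ ≠ 0 := (P.Phi_FS ω).mem_toFinset.1 hσ
  obtain ⟨c, hc, hcC⟩ : ∃ c ∈ σ, c ∈ C := by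
    by_contra hcon
    push Not at hcon
    exact h1 (h σ hcon)
  rw [P.smul_e c σ hc]
  exact hN c hcC _

theorem exists_bot_order (I : Type*) (i0 : I) :
    ∃ (_ : LinearOrder I), WellFoundedLT I ∧ ∀ i, i0 ≤ i := by
  classical
  letI : LinearOrder I := linearOrderOfSTO WellOrderingRel
  have : WellFoundedLT I := ⟨WellOrderingRel.isWellOrder.wf⟩
  let f : I → WithBot I := fun i => if i = i0 then ⊥ else (i : WithBot I)
  have hf : Function.Injective f := by
    intro a b h
    simp only [f] at h
    split_ifs at h with h1 h2 h2
    · rw [h1, h2]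
    · exact absurd h (by simp)
    · exact absurd h (by simp)
    · exact WithBot.coe_injective h
  refine ⟨LinearOrder.lift' f hf, ?_, ?_⟩
  · exact ⟨InvImage.wf f (wellFounded_lt (α := WithBot I))⟩
  · intro i
    change f i0 ≤ f i
    simp [f]

theorem LExt.emb {p : ℕ} {I : Type*} {F : Type w} [Field F] {P : PB I F} {i0 : I} {L : Type w} [Field L]
    [Algebra F L] (X : LExt p P i0 L) {E : Type*} [Field E] [Algebra F E] (y : E)
    (hy : y ^ p = algebraMap F E (P.y i0)) : ∃ f : L →ₐ[F] E, f X.γ = y := by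
  let pb : PowerBasis F L := ⟨X.γ, p, X.Bγ, X.hBγ⟩
  have hp0 : p ≠ 0 := X.pos.ne'
  have hmin : minpoly F X.γ = Polynomial.X ^ p - Polynomial.C (P.y i0) := by
    symm
    refine (Polynomial.eq_of_monic_of_dvd_of_natDegree_le (minpoly.monic pb.isIntegral_gen)
      (Polynomial.monic_X_pow_sub_C _ hp0) (minpoly.dvd _ _ ?_) ?_)
    · simp [X.hγ]
    · rw [pb.natDegree_minpoly, Polynomial.natDegree_X_pow_sub_C]
  refine ⟨pb.lift y ?_, pb.lift_gen y _⟩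
  change Polynomial.aeval y (minpoly F X.γ) = 0
  rw [hmin]; simp [hy]

variable {p : ℕ} {I : Type*} {F : Type w} [Field F] {P : PB I F} {i0 : I} {L : Type w} [Field L]
  [Algebra F L]

theorem stepOne_aux (hp : p.Prime) [LinearOrder I] [WellFoundedLT I] [CharP F p] [CharP L p]
    (X : LExt p P i0 L) (hbot : ∀ i, i0 ≤ i) (C : Set I) (hi0 : i0 ∈ C) (B : Set F)
    (hBC : ∀ b ∈ B, ∀ j, j ∉ C → P.D j b = 0) (hCB : ∀ c ∈ C, P.y c ∈ insert (P.y i0) B)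
    (R : DiffRes p F L (P.S hp) (X.Q.S hp)) (ω : DF F)
    (h : R.res ω ∈ (X.Q.S hp).H ⊔ DL (algebraMap F L '' B)) :
    ω ∈ (P.S hp).H ⊔ DL (insert (P.y i0) B) := by
  obtain ⟨y, hy, r, hr, hyr⟩ := AddSubgroup.mem_sup.1 h
  obtain ⟨_, ⟨u, rfl⟩, _, ⟨w, rfl⟩, rfl⟩ := AddSubgroup.mem_sup.1 hy
  have hr0 : ∀ σ : Finset I, (∀ i ∈ σ, i = i0 ∨ i ∉ C) → X.Q.Phi r σ = 0 := by
    intro σ hσ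
    clear hyr
    induction hr using AddSubgroup.closure_induction with
    | mem z hz =>
      obtain ⟨_, ⟨b, hb, rfl⟩, x, rfl⟩ := hz
      rw [PB.Phi_dLog_mul]
      refine Finset.sum_eq_zero fun j hj => ?_
      have : X.Q.D j (algebraMap F L b) = 0 := by
        by_cases h1 : j = i0
        · subst h1; exact X.D0 b
        · rw [X.Di j h1, hBC b hb j ((hσ j hj).resolve_left h1), map_zero]
      rw [dl, this]; simp
    | zero => rw [map_zero]; rfl
    | add a b _ _ h1 h2 => rw [map_add, Pi.add_apply, h1, h2, add_zero]
    | neg a _ h1 => rw [map_neg, Pi.neg_apply, h1, neg_zero]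
  have hPhi : ∀ σ : Finset I, (∀ i ∈ σ, i = i0 ∨ i ∉ C) → X.Q.Phi (R.res ω) σ =
      X.Q.Phi u σ ^ p - X.Q.Phi u σ + dd X.Q.D (X.Q.Phi w) σ := by
    intro σ hσ
    rw [← hyr, map_add, map_add, Pi.add_apply, hr0 σ hσ, add_zero, Pi.add_apply, PB.Phi_d]
    change X.Q.Phi ((X.Q.S hp).sp u - u) σ + _ = _
    rw [map_sub, Pi.sub_apply, PB.Phi_sp]; rfl
  have hres := X.Phi_res R.res R.res_one R.res_mul R.res_smul R.res_dForm ω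
  obtain ⟨Y, Z, hY, hZ, hYZ⟩ := s1_fun hp X hbot Cᶜ (fun h => h hi0) (P.Phi ω) (X.Q.Phi u) (X.Q.Phi w)
    (X.Q.Phi_FS u) (X.Q.Phi_FS w) (by
      intro σ hσ
      rw [← hPhi σ (fun i hi => Or.inr (hσ i hi)), hres]
      exact (if_neg (fun h => hσ _ h hi0)).symm) (by
      intro σ hσ
      rw [← hPhi (insert i0 σ) (fun i hi => (Finset.mem_insert.1 hi).imp id (fun h => hσ i h)), hres]
      exact (if_pos (Finset.mem_insert_self _ _)).symm)
  set S := P.S hp with hS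
  set y' := P.inv Y hY
  set z' := P.inv Z hZ
  have hrem : ω - ((S.sp y' - y') + S.d z') ∈ DL (insert (P.y i0) B) := by
    refine P.mem_of_support C _ (fun c hc x => DL_mem (hCB c hc) x) _ fun σ hσ => ?_
    rw [map_sub, map_add, map_sub, hS, PB.Phi_sp, PB.Phi_d, PB.Phi_inv, PB.Phi_inv]
    simp only [Pi.sub_apply, Pi.add_apply, sc]
    rw [hYZ σ hσ, sub_self]
  have h1 : (S.sp y' - y') + S.d z' ∈ S.H :=
    add_mem (AddSubgroup.mem_sup_left ⟨y', rfl⟩) (AddSubgroup.mem_sup_right ⟨z', rfl⟩)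
  have := add_mem (AddSubgroup.mem_sup_right hrem) (AddSubgroup.mem_sup_left h1)
  rwa [sub_add_cancel] at this

/-- first step -/
theorem stepOne (hp : p.Prime) [CharP F p] (b0 : F) (hb0 : ∀ c, c ^ p ≠ b0) (B : Set F) :
    ∃ (L : Type w) (_ : Field L) (_ : Algebra F L) (_ : CharP L p) (γ : L), γ ^ p = algebraMap F L b0 ∧
      (∀ (E : Type*) [Field E] [Algebra F E] (y : E), y ^ p = algebraMap F E b0 →
        ∃ f : L →ₐ[F] E, f γ = y) ∧
      ∀ (SF : DiffStr p F) (SL : DiffStr p L) (R : DiffRes p F L SF SL) (ω : DF F),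
        R.res ω ∈ SL.H ⊔ DL (algebraMap F L '' B) → ω ∈ SF.H ⊔ DL (insert b0 B) := by
  have hb00 : b0 ≠ 0 := fun h => hb0 0 (by rw [h, zero_pow hp.ne_zero])
  have h1 : LinearIndepOn F (KaehlerDifferential.D ℤ F) {b0} :=
    LinearIndepOn.singleton (D_ne_zero hp b0 hb0)
  have hsub : ({b0} : Set F) ⊆ insert b0 B := by simp
  set s := h1.extend hsub with hs
  have hsl : LinearIndepOn F (KaehlerDifferential.D ℤ F) s := h1.linearIndepOn_extend hsub
  have hs0 : (0 : F) ∉ s := fun h => by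
    have := hsl.ne_zero h; simp at this
  obtain ⟨t, P, hst, hPy⟩ := exists_PB F s hsl hs0
  have hbs : b0 ∈ s := h1.subset_extend hsub rfl
  let i0 : t := ⟨b0, hst hbs⟩
  have hyi0 : P.y i0 = b0 := hPy i0
  obtain ⟨_, hwf, hbot⟩ := exists_bot_order t i0
  obtain ⟨L, _, _, ⟨X⟩⟩ := exists_LExt hp P i0 (by rw [hyi0]; exact hb0)
  have hL : CharP L p := charP_of_injective_algebraMap (algebraMap F L).injective p
  refine ⟨L, inferInstance, inferInstance, hL, X.γ, by rw [X.hγ, hyi0], ?_, ?_⟩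
  · intro E _ _ y hy
    exact X.emb y (by rw [hyi0, hy])
  · intro SF SL R ω hω
    have hBC : ∀ b ∈ B, ∀ j : t, j ∉ {i : t | (i : F) ∈ s} → P.D j b = 0 := by
      intro b hb j hj
      have h2 : KaehlerDifferential.D ℤ F b ∈ Submodule.span F (KaehlerDifferential.D ℤ F '' s) :=
        h1.image_subset_span_image_extend hsub ⟨b, Or.inr hb, rfl⟩
      rw [PB.D_apply]
      change P.B.coord j _ = 0
      generalize KaehlerDifferential.D ℤ F b = δ at h2 ⊢
      induction h2 using Submodule.span_induction with
      | mem x hx =>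
        obtain ⟨c, hc, rfl⟩ := hx
        have h3 := P.D_other j ⟨c, hst hc⟩ (fun h => hj (by rw [h]; exact hc))
        rw [hPy] at h3
        exact h3
      | zero => rw [map_zero]
      | add x y _ _ hx hy => rw [map_add, hx, hy, add_zero]
      | smul a x _ hx => rw [map_smul, hx, smul_zero]
    let R' : DiffRes p F L (P.S hp) (X.Q.S hp) :=
      ⟨R.res, R.res_one, R.res_mul, R.res_smul, R.res_dForm, R.res_grade, fun ω => by
        rw [(P.S hp).d_unique SF, R.res_d, SL.d_unique]⟩
    have h3 := stepOne_aux hp X hbot {i : t | (i : F) ∈ s} hbs B hBC (by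
      intro c hc
      rw [hyi0, hPy]
      exact h1.extend_subset hsub hc) R' ω (sup_le_sup_right (H_unique _ _) _ hω)
    rw [hyi0] at h3
    exact sup_le_sup_right (H_unique _ _) _ h3

end StepOne
end Part17

section Part18
set_option linter.all false
open Finset

noncomputable section StepTwo
universe w

def Afam (p : ℕ) {ι F : Type*} [Field F] (b : ι → F) (m : ι → ℕ) (t : ℕ) : Subring F :=
  Subring.closure (Set.range (fun a : F => a ^ p ^ (t + 1)) ∪
    Set.range (fun i => b i ^ p ^ (t + 1 - m i)))

section
variable {p : ℕ} {ι F : Type*} [Field F] (b : ι → F) (m : ι → ℕ)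

theorem Afam_pow_mem (t : ℕ) (a : F) : a ^ p ^ (t + 1) ∈ Afam p b m t :=
  Subring.subset_closure (Or.inl ⟨a, rfl⟩)

theorem Afam_b_mem (t : ℕ) (i : ι) (k : ℕ) (hk : t + 1 - m i ≤ k) : b i ^ p ^ k ∈ Afam p b m t := by
  obtain ⟨l, rfl⟩ := Nat.exists_eq_add_of_le hk
  have h : b i ^ p ^ (t + 1 - m i) ∈ Afam p b m t := Subring.subset_closure (Or.inr ⟨i, rfl⟩)
  rw [pow_add, pow_mul]
  exact pow_mem h _

theorem Afam_le {t : ℕ} {N : Subring F} (h1 : ∀ a : F, a ^ p ^ (t + 1) ∈ N)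
    (h2 : ∀ i, b i ^ p ^ (t + 1 - m i) ∈ N) : Afam p b m t ≤ N := by
  rw [Afam, Subring.closure_le]
  rintro _ (⟨a, rfl⟩ | ⟨i, rfl⟩)
  · exact h1 a
  · exact h2 i

theorem Afam_anti (t : ℕ) : Afam p b m (t + 1) ≤ Afam p b m t := by
  refine Afam_le b m (fun a => ?_) fun i => Afam_b_mem b m t i _ (by omega)
  rw [pow_succ, mul_comm, pow_mul]
  exact Afam_pow_mem b m t _

theorem Afam_dLog (S : DiffStr p F) (i : ι) (hi : 1 ≤ m i) (x : DF F) :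
    dLog F (b i) * x ∈ S.KK (Afam p b m) := by
  by_cases h0 : b i = 0
  · rw [dLog_eq, h0]; simp
  have h1 : b i ∈ Afam p b m 0 := by
    have := Afam_b_mem (p := p) b m 0 i 0 (by omega)
    simpa using this
  have h2 := S.gen_mem _ h1 ((b i)⁻¹ • x)
  have h3 : dForm F (b i)⁻¹ = (-((b i)⁻¹ ^ 2)) • dForm F (b i) := by
    simp only [dForm]; rw [Derivation.leibniz_inv]; simp
  have h4 : b i • S.d ((b i)⁻¹ • x) = - (dLog F (b i) * x) + S.d x := by
    rw [S.d_smul, smul_add, smul_smul, mul_inv_cancel₀ h0, one_smul, h3, dLog_eq, smul_mul_assoc, smul_smul,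
      smul_mul_assoc, ← neg_smul]
    congr 2
    field_simp
  have h5 : b i • S.d ((b i)⁻¹ • x) ∈ S.KK (Afam p b m) := h2
  rw [h4] at h5
  have := sub_mem (S.d_mem (Afam p b m) x) h5
  convert this using 1; abel
end

section
variable {p : ℕ} {I : Type*} {F : Type w} [Field F] {P : PB I F} {i0 : I} {L : Type w} [Field L]
  [Algebra F L]

theorem LExt.exists_psi (hp : p.Prime) [CharP F p] [CharP L p] (X : LExt p P i0 L) :
    ∃ ψ : L →+* F, ∀ x, algebraMap F L (ψ x) = x ^ p := by
  have := Fact.mk hp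
  have h1 : ∀ x : L, ∃ a, algebraMap F L a = x ^ p := by
    intro x
    apply X.ker_D0
    rw [Derivation.leibniz_pow, ← Nat.cast_smul_eq_nsmul L, CharP.cast_eq_zero, zero_smul]
  choose ψ hψ using h1
  have hi := (algebraMap F L).injective
  exact ⟨⟨⟨⟨ψ, hi (by rw [hψ]; simp)⟩, fun x y => hi (by rw [hψ, map_mul, hψ, hψ, mul_pow])⟩,
    hi (by rw [hψ]; simp [hp.ne_zero]), fun x y => hi (by
      change algebraMap F L (ψ (x + y)) = algebraMap F L (ψ x + ψ y)
      rw [hψ, map_add, hψ, hψ, add_pow_char])⟩, hψ⟩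

theorem LExt.psi_alg (hp : p.Prime) [CharP F p] [CharP L p] (X : LExt p P i0 L) (ψ : L →+* F)
    (hψ : ∀ x, algebraMap F L (ψ x) = x ^ p) (a : F) : ψ (algebraMap F L a) = a ^ p :=
  (algebraMap F L).injective (by rw [hψ, map_pow])

theorem LExt.psi_sum (hp : p.Prime) [CharP F p] [CharP L p] (X : LExt p P i0 L) (ψ : L →+* F)
    (hψ : ∀ x, algebraMap F L (ψ x) = x ^ p) (x : L) :
    ψ x = ∑ i : Fin p, P.y i0 ^ (i : ℕ) * X.Bγ.repr x i ^ p := by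
  have hγ : ψ X.γ = P.y i0 := (algebraMap F L).injective (by rw [hψ, X.hγ])
  conv_lhs => rw [← X.Bγ.sum_repr x, map_sum]
  refine Finset.sum_congr rfl fun i _ => ?_
  rw [X.hBγ, Algebra.smul_def, map_mul, X.psi_alg hp ψ hψ, map_pow, hγ, mul_comm]

theorem PB.sp_smul_exact [LinearOrder I] (hp : p.Prime) [CharP F p] (P : PB I F) (a : F) (x : DF F) :
    (P.S hp).sp (a • x) = a ^ p • (P.S hp).sp x := by
  apply P.Phi_injective
  rw [P.Phi_sp, P.Phi.map_smul, P.Phi.map_smul, P.Phi_sp]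
  funext σ
  simp [sc, mul_pow]

theorem PB.spIter_smul_exact [LinearOrder I] (hp : p.Prime) [CharP F p] (P : PB I F) (t : ℕ) (a : F)
    (x : DF F) : spIter (P.S hp) t (a • x) = a ^ p ^ t • spIter (P.S hp) t x := by
  induction t with
  | zero => simp [spIter]
  | succ t ih => rw [DiffStr.spIter_succ, ih, P.sp_smul_exact, DiffStr.spIter_succ, ← pow_mul, pow_succ]

theorem spIter_add {p : ℕ} {F : Type*} [Field F] (S : DiffStr p F) (t : ℕ) (x y : DF F) :
    spIter S t (x + y) = spIter S t x + spIter S t y := by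
  induction t with
  | zero => rfl
  | succ t ih => simp only [DiffStr.spIter_succ, ih, map_add]

def spIterHom {p : ℕ} {F : Type*} [Field F] (S : DiffStr p F) (t : ℕ) : DF F →+ DF F :=
  AddMonoidHom.mk' (spIter S t) (spIter_add S t)

theorem PB.spIter_supp [LinearOrder I] (hp : p.Prime) [CharP F p] (P : PB I F) (t : ℕ) (x : DF F)
    (σ : Finset I) (h : P.Phi x σ = 0) : P.Phi (spIter (P.S hp) t x) σ = 0 := by
  induction t with
  | zero => exact h
  | succ t ih => rw [DiffStr.spIter_succ, P.Phi_sp, sc, ih, zero_pow hp.ne_zero]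

variable [LinearOrder I]

theorem FSpsi (X : LExt p P i0 L) (ψ : L →+* F) (x : DF L) :
    FS (fun σ => if i0 ∈ σ then 0 else ψ (X.Q.Phi x σ)) := by
  refine (X.Q.Phi_FS x).subset fun σ hσ h0 => hσ ?_
  change (if i0 ∈ σ then 0 else ψ (X.Q.Phi x σ)) = 0
  have : X.Q.Phi x σ = 0 := h0
  rw [this, map_zero, ite_self]

def Psi (X : LExt p P i0 L) (ψ : L →+* F) : DF L →+ DF F :=
  AddMonoidHom.mk' (fun x => P.inv _ (FSpsi X ψ x)) (by
    intro a b
    apply P.Phi_injective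
    rw [P.Phi.map_add, P.Phi_inv, P.Phi_inv, P.Phi_inv]
    funext σ
    simp only [map_add, Pi.add_apply]
    split_ifs <;> simp)

theorem Phi_Psi (X : LExt p P i0 L) (ψ : L →+* F) (x : DF L) (σ : Finset I) :
    P.Phi (Psi X ψ x) σ = if i0 ∈ σ then 0 else ψ (X.Q.Phi x σ) := by
  change P.Phi (P.inv _ (FSpsi X ψ x)) σ = _
  rw [P.Phi_inv]

theorem Psi_smul (X : LExt p P i0 L) (ψ : L →+* F) (c : L) (x : DF L) :
    Psi X ψ (c • x) = ψ c • Psi X ψ x := by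
  apply P.Phi_injective
  funext σ
  rw [Phi_Psi, P.Phi.map_smul, Pi.smul_apply, Phi_Psi, X.Q.Phi.map_smul, Pi.smul_apply, smul_eq_mul, map_mul]
  split_ifs <;> simp

theorem Psi_sp (hp : p.Prime) [CharP F p] [CharP L p] (X : LExt p P i0 L) (ψ : L →+* F) (x : DF L) :
    Psi X ψ ((X.Q.S hp).sp x) = (P.S hp).sp (Psi X ψ x) := by
  apply P.Phi_injective
  funext σ
  rw [P.Phi_sp, Phi_Psi, X.Q.Phi_sp, sc, sc, Phi_Psi]
  split_ifs
  · rw [zero_pow hp.ne_zero]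
  · rw [map_pow]

theorem Psi_spIter (hp : p.Prime) [CharP F p] [CharP L p] (X : LExt p P i0 L) (ψ : L →+* F) (t : ℕ)
    (x : DF L) : Psi X ψ (spIter (X.Q.S hp) t x) = spIter (P.S hp) t (Psi X ψ x) := by
  induction t with
  | zero => rfl
  | succ t ih => rw [DiffStr.spIter_succ, Psi_sp, ih, DiffStr.spIter_succ]

theorem LExt.repr_D (X : LExt p P i0 L) (j : I) (hj : j ≠ i0) (x : L) (i : Fin p) :
    X.Bγ.repr (X.Q.D j x) i = P.D j (X.Bγ.repr x i) := by
  have h : X.Q.D j x = ∑ i : Fin p, P.D j (X.Bγ.repr x i) • X.Bγ i := by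
    conv_lhs => rw [← X.Bγ.sum_repr x, map_sum]
    refine Finset.sum_congr rfl fun i _ => ?_
    rw [X.hBγ, Algebra.smul_def, Derivation.leibniz, Derivation.leibniz_pow, X.D_gamma_i j hj, X.Di j hj,
      Algebra.smul_def (P.D j _), mul_comm (algebraMap F L _)]
    simp
  rw [h, X.Bγ.repr_sum_self]

theorem FSrepr (X : LExt p P i0 L) (x : DF L) (i : Fin p) :
    FS (fun σ => X.Bγ.repr (X.Q.Phi x σ) i) := by
  refine (X.Q.Phi_FS x).subset fun σ hσ h0 => hσ ?_
  change X.Bγ.repr (X.Q.Phi x σ) i = 0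
  have : X.Q.Phi x σ = 0 := h0
  rw [this]; simp

theorem Psi_d (hp : p.Prime) [CharP F p] [CharP L p] (X : LExt p P i0 L) (ψ : L →+* F)
    (hψ : ∀ x, algebraMap F L (ψ x) = x ^ p) (x : DF L) (σ : Finset I) (hσ : i0 ∉ σ) :
    P.Phi (Psi X ψ ((X.Q.S hp).d x) - ∑ i : Fin p, P.y i0 ^ (i : ℕ) •
      (P.S hp).sp ((P.S hp).d (P.inv _ (FSrepr X x i)))) σ = 0 := by
  rw [map_sub, map_sum, Pi.sub_apply, Finset.sum_apply, Phi_Psi, if_neg hσ, X.psi_sum hp ψ hψ, sub_eq_zero]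
  refine Finset.sum_congr rfl fun i _ => ?_
  rw [map_smul, Pi.smul_apply, smul_eq_mul, P.Phi_sp, sc, P.Phi_d, P.Phi_inv, X.Q.Phi_d]
  congr 2
  simp only [dd]
  rw [map_sum, Finsupp.finsetSum_apply]
  refine Finset.sum_congr rfl fun j hj => ?_
  have hj0 : j ≠ i0 := fun h => hσ (h ▸ hj)
  rw [← X.repr_D j hj0, map_zsmul, Finsupp.smul_apply]

theorem stepTwo_aux {ι : Type*} [DecidableEq ι] (hp : p.Prime) [CharP F p] [CharP L p] (X : LExt p P i0 L)
    (b : ι → F) (m : ι → ℕ) (i1 : ι) (hm1 : 2 ≤ m i1) (hb : b i1 = P.y i0)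
    (R : DiffRes p F L (P.S hp) (X.Q.S hp)) (ω : DF F)
    (h : R.res ω ∈ (X.Q.S hp).KK (Afam p (Function.update (fun i => algebraMap F L (b i)) i1 X.γ)
      (Function.update m i1 (m i1 - 1)))) :
    ω ∈ (P.S hp).KK (Afam p b m) := by
  have hF := Fact.mk hp
  obtain ⟨ψ, hψ⟩ := X.exists_psi hp
  have hγ : ψ X.γ = b i1 := (algebraMap F L).injective (by rw [hψ, X.hγ, hb])
  set N := (P.S hp).KK (Afam p b m) with hN
  have hsupp : ∀ x : DF F, (∀ σ, i0 ∉ σ → P.Phi x σ = 0) → x ∈ N := by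
    intro x hx
    refine P.mem_of_support {i0} N ?_ x fun σ hσ => hx σ fun h => hσ i0 h rfl
    rintro c hc y
    rw [Set.mem_singleton_iff.1 hc, ← hb]
    exact Afam_dLog b m _ i1 (by omega) y
  have hA : ∀ t, Afam p (Function.update (fun i => algebraMap F L (b i)) i1 X.γ)
      (Function.update m i1 (m i1 - 1)) t ≤ (Afam p b m (t + 1)).comap ψ := by
    intro t
    refine Afam_le _ _ (fun a => ?_) fun i => ?_
    · rw [Subring.mem_comap, map_pow, X.psi_sum hp ψ hψ, sum_pow_char_pow]
      refine Subring.sum_mem _ fun i _ => ?_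
      rw [mul_pow, ← pow_mul, ← pow_mul, ← hb]
      refine mul_mem ?_ ?_
      · rw [mul_comm, pow_mul]
        exact pow_mem (Afam_b_mem b m (t + 1) i1 _ (by omega)) _
      · rw [← pow_succ']
        exact Afam_pow_mem b m (t + 1) _
    · rw [Subring.mem_comap, map_pow]
      by_cases hi : i = i1
      · subst hi
        rw [Function.update_self, Function.update_self, hγ]
        exact Afam_b_mem b m (t + 1) i _ (by omega)
      · rw [Function.update_of_ne hi, Function.update_of_ne hi, X.psi_alg hp ψ hψ, ← pow_mul, ← pow_succ']
        exact Afam_b_mem b m (t + 1) i _ (by omega)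
  have hgen : ∀ t, ∀ M ∈ Afam p (Function.update (fun i => algebraMap F L (b i)) i1 X.γ)
      (Function.update m i1 (m i1 - 1)) t, ∀ v,
      Psi X ψ (M • spIter (X.Q.S hp) t ((X.Q.S hp).d v)) ∈ N := by
    intro t M hM v
    rw [Psi_smul, Psi_spIter]
    set x0 := Psi X ψ ((X.Q.S hp).d v)
    set x1 := ∑ i : Fin p, P.y i0 ^ (i : ℕ) •
      (P.S hp).sp ((P.S hp).d (P.inv _ (FSrepr X v i))) with hx1
    have hx : x0 = (x0 - x1) + x1 := by abel
    rw [hx, spIter_add, smul_add]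
    refine add_mem (hsupp _ fun σ hσ => ?_) ?_
    · rw [map_smul, Pi.smul_apply, P.spIter_supp hp t _ _ (Psi_d hp X ψ hψ v σ hσ), smul_zero]
    · have : spIter (P.S hp) t x1 = spIterHom (P.S hp) t x1 := rfl
      rw [this, hx1, map_sum, Finset.smul_sum]
      refine sum_mem fun i _ => ?_
      change ψ M • spIter (P.S hp) t _ ∈ N
      rw [P.spIter_smul_exact, smul_smul, ← DiffStr.spIter_succ', ← pow_mul, mul_comm (i : ℕ), pow_mul]
      refine (P.S hp).gen_mem _ (mul_mem (hA t hM) (pow_mem ?_ _)) _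
      rw [← hb]
      exact Afam_b_mem b m (t + 1) i1 _ (by omega)
  have hle : (X.Q.S hp).KK (Afam p (Function.update (fun i => algebraMap F L (b i)) i1 X.γ)
      (Function.update m i1 (m i1 - 1))) ≤ N.comap (Psi X ψ) := by
    refine DiffStr.KK_le _ _ (fun x => ?_) (fun x => ?_) hgen
    · rw [AddSubgroup.mem_comap, map_sub, Psi_sp]
      exact (P.S hp).asMap_mem _ _
    · have := hgen 0 1 (one_mem _) x
      rw [one_smul] at this
      exact this
  have h1 : Psi X ψ (R.res ω) ∈ N := hle h
  rw [hN, ← DiffStr.sp_mem_iff]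
  have h2 : (P.S hp).sp ω - Psi X ψ (R.res ω) ∈ N := by
    refine hsupp _ fun σ hσ => ?_
    rw [map_sub, Pi.sub_apply, P.Phi_sp, Phi_Psi, if_neg hσ,
      X.Phi_res R.res R.res_one R.res_mul R.res_smul R.res_dForm ω]
    simp only [if_neg hσ]
    rw [X.psi_alg hp ψ hψ, sc, sub_self]
  have := add_mem h2 h1
  rwa [sub_add_cancel] at this

/-- second step -/
theorem stepTwo {ι : Type*} [DecidableEq ι] (hp : p.Prime) [CharP F p] (b : ι → F) (m : ι → ℕ) (i1 : ι)
    (hm1 : 2 ≤ m i1) (hb0 : ∀ c, c ^ p ≠ b i1) :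
    ∃ (L : Type w) (_ : Field L) (_ : Algebra F L) (_ : CharP L p) (γ : L), γ ^ p = algebraMap F L (b i1) ∧
      (∀ (E : Type*) [Field E] [Algebra F E] (y : E), y ^ p = algebraMap F E (b i1) →
        ∃ f : L →ₐ[F] E, f γ = y) ∧
      ∀ (SF : DiffStr p F) (SL : DiffStr p L) (R : DiffRes p F L SF SL) (ω : DF F),
        R.res ω ∈ SL.KK (Afam p (Function.update (fun i => algebraMap F L (b i)) i1 γ)
          (Function.update m i1 (m i1 - 1))) → ω ∈ SF.KK (Afam p b m) := by
  have hb00 : b i1 ≠ 0 := fun h => hb0 0 (by rw [h, zero_pow hp.ne_zero])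
  have h1 : LinearIndepOn F (KaehlerDifferential.D ℤ F) {b i1} :=
    LinearIndepOn.singleton (D_ne_zero hp (b i1) hb0)
  obtain ⟨t, P, hst, hPy⟩ := exists_PB F {b i1} h1 (fun h => hb00 (Set.mem_singleton_iff.1 h).symm)
  let i0 : t := ⟨b i1, hst rfl⟩
  have hyi0 : P.y i0 = b i1 := hPy i0
  obtain ⟨_, hwf, hbot⟩ := exists_bot_order t i0
  obtain ⟨L, _, _, ⟨X⟩⟩ := exists_LExt hp P i0 (by rw [hyi0]; exact hb0)
  have hL : CharP L p := charP_of_injective_algebraMap (algebraMap F L).injective p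
  refine ⟨L, inferInstance, inferInstance, hL, X.γ, by rw [X.hγ, hyi0], ?_, ?_⟩
  · intro E _ _ y hy
    exact X.emb y (by rw [hyi0, hy])
  · intro SF SL R ω hω
    let R' : DiffRes p F L (P.S hp) (X.Q.S hp) :=
      ⟨R.res, R.res_one, R.res_mul, R.res_smul, R.res_dForm, R.res_grade, fun ω => by
        rw [(P.S hp).d_unique SF, R.res_d, SL.d_unique]⟩
    have h3 := stepTwo_aux hp X b m i1 hm1 hyi0.symm R' ω (DiffStr.KK_unique _ _ _ (Afam_anti _ _) hω)
    exact DiffStr.KK_unique _ _ _ (Afam_anti _ _) h3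
end
end StepTwo
end Part18

section Part19
set_option linter.all false
open Finset

section MainInd
universe w w' w''

theorem DL_mono {F : Type*} [Field F] {B B' : Set F} (h : B ⊆ B') : DL B ≤ DL B' :=
  AddSubgroup.closure_mono fun _ ⟨b, hb, x, hx⟩ => ⟨b, h hb, x, hx⟩

section
variable {p : ℕ} {ι F : Type*} [Field F] (b : ι → F) (m : ι → ℕ)

theorem Afam_root (hp : p.Prime) [CharP F p] (hm : ∀ i, m i ≤ 1) (t : ℕ) (M : F) (hM : M ∈ Afam p b m t) :
    ∃ N ∈ Afam p b m 0, N ^ p ^ t = M := by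
  have := Fact.mk hp
  have h : Afam p b m t ≤ (Afam p b m 0).map (iterateFrobenius F p t) := by
    refine Afam_le b m (fun a => ⟨a ^ p ^ (0 + 1), Afam_pow_mem b m 0 a, ?_⟩)
      fun i => ⟨b i ^ p ^ (0 + 1 - m i), Afam_b_mem b m 0 i _ le_rfl, ?_⟩
    · rw [iterateFrobenius_def, ← pow_mul, ← pow_add]; congr 2; omega
    · rw [iterateFrobenius_def, ← pow_mul, ← pow_add]
      have := hm i
      congr 2; omega
  obtain ⟨N, hN, h1⟩ := h hM
  exact ⟨N, hN, by rw [← h1, iterateFrobenius_def]⟩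

theorem KK_le_HDL (hp : p.Prime) [CharP F p] (S : DiffStr p F) (hm : ∀ i, m i ≤ 1) :
    S.KK (Afam p b m) ≤ S.H ⊔ DL (b '' {i | m i = 1}) := by
  set T := S.H ⊔ DL (b '' {i | m i = 1}) with hT
  have hd : ∀ x, S.d x ∈ T := fun x => AddSubgroup.mem_sup_left (AddSubgroup.mem_sup_right ⟨x, rfl⟩)
  have ha : ∀ x, S.sp x - x ∈ T := fun x => AddSubgroup.mem_sup_left (AddSubgroup.mem_sup_left ⟨x, rfl⟩)
  have hr : S.d.range ≤ T := by rintro _ ⟨x, rfl⟩; exact hd x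
  have h1 : ∀ N ∈ Afam p b m 0, ∀ v, dForm F N * v ∈ T := by
    intro N hN
    induction hN using Subring.closure_induction with
    | mem x hx =>
      intro v
      rcases hx with ⟨a, rfl⟩ | ⟨i, rfl⟩
      · simp only [zero_add, pow_one]
        rw [dForm_pow_p, zero_mul]; exact zero_mem _
      · have := hm i
        obtain h | h : m i = 0 ∨ m i = 1 := by omega
        · simp only [h, zero_add, Nat.sub_zero, pow_one]
          rw [dForm_pow_p, zero_mul]; exact zero_mem _
        · simp only [h, zero_add, Nat.sub_self, pow_zero, pow_one]
          rw [dForm_eq, smul_mul_assoc, ← mul_smul_comm]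
          have hbi : b i ∈ b '' {i | m i = 1} := ⟨i, h, rfl⟩
          exact AddSubgroup.mem_sup_right (DL_mem hbi _)
    | zero => intro v; simp [dForm]
    | one => intro v; simp [dForm]
    | add x y _ _ hx hy => intro v; rw [dForm_add, add_mul]; exact add_mem (hx v) (hy v)
    | neg x _ hx =>
      intro v
      have : dForm F (-x) = - dForm F x := by simp [dForm]
      rw [this, neg_mul]; exact neg_mem (hx v)
    | mul x y _ _ hx hy =>
      intro v
      rw [dForm_mul, add_mul, smul_mul_assoc, smul_mul_assoc, ← mul_smul_comm, ← mul_smul_comm]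
      exact add_mem (hy _) (hx _)
  have h2 : ∀ N ∈ Afam p b m 0, ∀ t v, N ^ p ^ t • spIter S t (S.d v) ∈ T := by
    intro N hN t v
    induction t with
    | zero =>
      have h3 := S.d_smul N v
      have : N ^ p ^ 0 • spIter S 0 (S.d v) = S.d (N • v) - dForm F N * v := by
        rw [h3]; simp [spIter]
      rw [this]
      exact sub_mem (hd _) (h1 N hN v)
    | succ t ih =>
      rw [S.spIter_succ]
      have h3 := hr (S.sp_smul (N ^ p ^ t) (spIter S t (S.d v)))
      rw [← pow_mul, ← pow_succ] at h3
      have h4 := add_mem (ha (N ^ p ^ t • spIter S t (S.d v))) ih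
      rw [sub_add_cancel] at h4
      have := sub_mem h4 h3
      rwa [sub_sub_cancel] at this
  refine S.KK_le _ ha hd fun t M hM v => ?_
  obtain ⟨N, hN, rfl⟩ := Afam_root b m hp hm t M hM
  exact h2 N hN t v

theorem HDL_le_KK (S : DiffStr p F) (B : Set F) (hB : ∀ x ∈ B, ∃ i, 1 ≤ m i ∧ b i = x) :
    S.H ⊔ DL B ≤ S.KK (Afam p b m) := by
  refine sup_le (S.H_le_KK _) ?_
  rw [DL, AddSubgroup.closure_le]
  rintro _ ⟨x, hx, y, rfl⟩
  obtain ⟨i, hi, rfl⟩ := hB x hx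
  exact Afam_dLog b m S i hi y

end

theorem pow_pow_pred {E : Type*} [Field E] {p m : ℕ} (h : 1 ≤ m) (x : E) :
    (x ^ p ^ (m - 1)) ^ p = x ^ p ^ m := by
  obtain ⟨k, rfl⟩ := Nat.exists_eq_add_of_le h
  rw [← pow_mul, ← pow_succ]; congr 2; omega

theorem adjoin_top_of_tower {F L E : Type*} [Field F] [Field L] [Field E] [Algebra F L] [Algebra F E]
    [Algebra L E] [IsScalarTower F L E] (s : Set E) (h : Algebra.adjoin F s = ⊤) : Algebra.adjoin L s = ⊤ := by
  rw [eq_top_iff]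
  intro x _
  have : Algebra.adjoin F s ≤ (Algebra.adjoin L s).restrictScalars F :=
    Algebra.adjoin_le Algebra.subset_adjoin
  exact this (by rw [h]; trivial)

theorem sum_update_pred {ι : Type*} [Fintype ι] [DecidableEq ι] (m : ι → ℕ) (i : ι) (h : 1 ≤ m i) (N : ℕ)
    (hN : ∑ i, m i = N + 1) : ∑ j, Function.update m i (m i - 1) j = N := by
  have h1 := Finset.sum_update_of_mem (Finset.mem_univ i) m (m i - 1)
  have h2 := Finset.sum_eq_add_sum_sdiff_singleton_of_mem (Finset.mem_univ i) m
  omega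

theorem main_ind {p : ℕ} (hp : p.Prime) {ι : Type w''} [Fintype ι] [DecidableEq ι] (E : Type w') [Field E]
    [CharP E p] (SE : DiffStr p E) (N : ℕ) :
    ∀ (F : Type w) [Field F] [CharP F p] [Algebra F E] (SF : DiffStr p F) (R : DiffRes p F E SF SE)
      (b : ι → F) (m : ι → ℕ) (β : ι → E) (hβ : ∀ i, β i ^ p ^ m i = algebraMap F E (b i))
      (hgen : Algebra.adjoin F (Set.range β) = ⊤) (hN : ∑ i, m i = N) (ω : DF F),
      R.res ω ∈ SE.H → ω ∈ SF.KK (Afam p b m) := by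
  have hF := Fact.mk hp
  induction N with
  | zero =>
    intro F _ _ _ SF R b m β hβ hgen hN ω hω
    have hm : ∀ i, m i = 0 := fun i => (Finset.sum_eq_zero_iff.1 hN) i (Finset.mem_univ i)
    refine SF.H_le_KK _ (base_case hp R ?_ ω hω)
    have h1 : Algebra.adjoin F (Set.range β) ≤ ⊥ := by
      refine Algebra.adjoin_le ?_
      rintro _ ⟨i, rfl⟩
      have := hβ i
      rw [hm i, pow_zero, pow_one] at this
      rw [this]
      exact ⟨b i, rfl⟩
    rw [hgen] at h1
    intro x
    obtain ⟨a, ha⟩ := h1 (show x ∈ ⊤ from trivial)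
    exact ⟨a, ha⟩
  | succ N ih =>
    intro F _ _ _ SF R b m β hβ hgen hN ω hω
    by_cases hc : ∃ i, 1 ≤ m i ∧ ∃ c, c ^ p = b i
    · obtain ⟨i, hi, c, hc⟩ := hc
      have h1 := ih F SF R (Function.update b i c) (Function.update m i (m i - 1)) β (by
        intro j
        by_cases hj : j = i
        · subst hj
          rw [Function.update_self, Function.update_self]
          apply frobenius_inj E p
          rw [frobenius_def, frobenius_def, pow_pow_pred hi, hβ, ← map_pow, hc]
        · rw [Function.update_of_ne hj, Function.update_of_ne hj, hβ]) hgen (sum_update_pred m i hi N hN) ω hω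
      refine SF.KK_le_of_pow _ _ ?_ h1
      intro t
      have h2 : Afam p (Function.update b i c) (Function.update m i (m i - 1)) t ≤
          (Afam p b m (t + 1)).comap (frobenius F p) := by
        refine Afam_le _ _ (fun a => ?_) fun j => ?_
        · rw [Subring.mem_comap, frobenius_def, ← pow_mul, ← pow_succ]
          exact Afam_pow_mem b m (t + 1) a
        · rw [Subring.mem_comap, frobenius_def]
          by_cases hj : j = i
          · subst hj
            rw [Function.update_self, Function.update_self, ← pow_mul, mul_comm, pow_mul, hc]
            exact Afam_b_mem b m (t + 1) j _ (by omega)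
          · rw [Function.update_of_ne hj, Function.update_of_ne hj, ← pow_mul, ← pow_succ]
            exact Afam_b_mem b m (t + 1) j _ (by omega)
      exact fun M hM => h2 hM
    · push Not at hc
      have key : ∀ (i : ι) (hi : 1 ≤ m i) (L : Type w) [Field L] [Algebra F L] [CharP L p] (γ : L)
          (hγ : γ ^ p = algebraMap F L (b i)) (f : L →ₐ[F] E) (hf : f γ = β i ^ p ^ (m i - 1))
          (SL : DiffStr p L), (mkRes SF SL).res ω ∈ SL.KK (Afam p
            (Function.update (fun i => algebraMap F L (b i)) i γ) (Function.update m i (m i - 1))) := by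
        intro i hi L _ _ _ γ hγ f hf SL
        letI : Algebra L E := f.toRingHom.toAlgebra
        haveI : IsScalarTower F L E := IsScalarTower.of_algebraMap_eq fun x => (f.commutes x).symm
        refine ih L SL (mkRes SL SE) _ _ β ?_ (adjoin_top_of_tower (F := F) _ hgen)
          (sum_update_pred m i hi N hN) _ ?_
        · intro j
          by_cases hj : j = i
          · subst hj
            rw [Function.update_self, Function.update_self]
            exact hf.symm
          · rw [Function.update_of_ne hj, Function.update_of_ne hj, hβ]
            exact IsScalarTower.algebraMap_apply F L E _
        · rw [res_comp R]
          exact hω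
      by_cases h2 : ∃ i, 2 ≤ m i
      · obtain ⟨i, hi⟩ := h2
        obtain ⟨L, _, _, _, γ, hγ, hf, hL⟩ := stepTwo hp b m i hi (hc i (by omega))
        obtain ⟨f, hf⟩ := hf E (β i ^ p ^ (m i - 1)) (by rw [pow_pow_pred (by omega), hβ])
        obtain ⟨SL⟩ := exists_DiffStr hp L
        exact hL SF SL (mkRes SF SL) ω (key i (by omega) L γ hγ f hf SL)
      · push Not at h2
        obtain ⟨i, hi⟩ : ∃ i, 1 ≤ m i := by
          by_contra hcon
          push Not at hcon
          have : ∑ i, m i = 0 := Finset.sum_eq_zero fun i _ => by have := hcon i; omega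
          omega
        obtain ⟨L, _, _, _, γ, hγ, hf, hL⟩ := stepOne hp (b i) (hc i hi) (b '' {j | j ≠ i ∧ m j = 1})
        obtain ⟨f, hf⟩ := hf E (β i ^ p ^ (m i - 1)) (by rw [pow_pow_pred (by omega), hβ])
        obtain ⟨SL⟩ := exists_DiffStr hp L
        have h3 := key i hi L γ hγ f hf SL
        have h4 := KK_le_HDL _ _ hp SL (by
          intro j
          by_cases hj : j = i
          · subst hj; rw [Function.update_self]; have := h2 j; omega
          · rw [Function.update_of_ne hj]; have := h2 j; omega) h3
        refine HDL_le_KK b m SF _ ?_ (hL SF SL (mkRes SF SL) ω (sup_le_sup_left (DL_mono ?_) _ h4))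
        · rintro x (rfl | ⟨j, ⟨_, hj⟩, rfl⟩)
          · exact ⟨i, hi, rfl⟩
          · exact ⟨j, hj.ge, rfl⟩
        · rintro _ ⟨j, hj, rfl⟩
          have hji : j ≠ i := by
            rintro rfl
            rw [Set.mem_setOf_eq, Function.update_self] at hj
            have := h2 j; omega
          rw [Set.mem_setOf_eq, Function.update_of_ne hji] at hj
          rw [Function.update_of_ne hji]
          exact ⟨b j, ⟨j, ⟨hji, hj⟩, rfl⟩, rfl⟩

/-- the easy direction -/
theorem KK_res {p : ℕ} (hp : p.Prime) {ι F E : Type*} [Field F] [Field E] [Algebra F E] [CharP F p] [CharP E p]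
    {SF : DiffStr p F} {SE : DiffStr p E} (R : DiffRes p F E SF SE) (b : ι → F) (m : ι → ℕ) (β : ι → E)
    (hβ : ∀ i, β i ^ p ^ m i = algebraMap F E (b i)) (ω : DF F) (h : ω ∈ SF.KK (Afam p b m)) :
    R.res ω ∈ SE.H := by
  have hF := Fact.mk hp
  refine SE.KK_AP (res_KK R (Afam p b m) (AP p E) ?_ ?_ ω h)
  · rintro t _ ⟨x, rfl⟩
    refine ⟨x ^ p, ?_⟩
    rw [iterateFrobenius_def, iterateFrobenius_def, ← pow_mul, ← pow_succ']
  · intro t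
    have : Afam p b m t ≤ (AP p E t).comap (algebraMap F E) := by
      refine Afam_le _ _ (fun a => ?_) fun i => ?_
      · exact ⟨algebraMap F E a, by rw [iterateFrobenius_def, map_pow]⟩
      · refine ⟨β i ^ p ^ (m i + (t + 1 - m i) - (t + 1)), ?_⟩
        rw [iterateFrobenius_def, map_pow, ← hβ, ← pow_mul, ← pow_mul, ← pow_add, ← pow_add]
        congr 2; omega
    exact fun M hM => this hM

end MainInd
end Part19

section Part20
set_option linter.all false
open Finset

noncomputable section Fin20
variable {p : ℕ} {F : Type*} [Field F]

theorem spIter_smul_Ex [CharP F p] (S : DiffStr p F) (t : ℕ) (c : F) (x : DF F) :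
    spIter S t (c • x) - c ^ p ^ t • spIter S t x ∈ S.Ex t := by
  induction t with
  | zero => simp [spIter]
  | succ t ih =>
    have h1 := S.sp_Ex ih
    have h2 := S.range_le_Ex t (S.sp_smul (c ^ p ^ t) (spIter S t x))
    rw [← pow_mul, ← pow_succ] at h2
    have := add_mem h1 h2
    rw [map_sub, sub_add_sub_cancel] at this
    rwa [S.spIter_succ, S.spIter_succ]

theorem spIter_dLog_Ex (S : DiffStr p F) (t : ℕ) (c : F) (x : DF F) :
    spIter S t (dLog F c * x) - dLog F c * spIter S t x ∈ S.Ex t := by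
  induction t with
  | zero => simp [spIter]
  | succ t ih =>
    have h1 := S.sp_Ex ih
    have h2 := S.range_le_Ex t (S.sp_dLog_mul c (spIter S t x))
    have := add_mem h1 h2
    rw [map_sub, sub_add_sub_cancel] at this
    rwa [S.spIter_succ, S.spIter_succ]

variable {r : ℕ} (b : Fin r → F) (m : Fin r → ℕ)

theorem Afam_zero_DL [CharP F p] (hm : ∀ i, 1 ≤ m i) (N : F) (hN : N ∈ Afam p b m 0) :
    ∀ v, dForm F N * v ∈ DL (Set.range b) := by
  induction hN using Subring.closure_induction with
  | mem x hx =>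
    intro v
    rcases hx with ⟨a, rfl⟩ | ⟨i, rfl⟩
    · simp only [zero_add, pow_one]
      rw [dForm_pow_p, zero_mul]; exact zero_mem _
    · have h : 0 + 1 - m i = 0 := by have := hm i; omega
      simp only [h, pow_zero, pow_one]
      rw [dForm_eq, smul_mul_assoc, ← mul_smul_comm]
      have hbi : b i ∈ Set.range b := ⟨i, rfl⟩
      exact DL_mem hbi _
  | zero => intro v; simp [dForm]
  | one => intro v; simp [dForm]
  | add x y _ _ hx hy => intro v; rw [dForm_add, add_mul]; exact add_mem (hx v) (hy v)
  | neg x _ hx =>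
    intro v
    have : dForm F (-x) = - dForm F x := by simp [dForm]
    rw [this, neg_mul]; exact neg_mem (hx v)
  | mul x y _ _ hx hy =>
    intro v
    rw [dForm_mul, add_mul, smul_mul_assoc, smul_mul_assoc, ← mul_smul_comm, ← mul_smul_comm]
    exact add_mem (hy _) (hx _)

theorem Afam_mono_form (t : ℕ) (M : F) (hM : M ∈ Afam p b m t) :
    M ∈ AddSubgroup.closure {x : F | ∃ (a : F) (k : Fin r → ℕ), (∀ i, p ^ (t + 1 - m i) ∣ k i) ∧
      x = a ^ p ^ (t + 1) * ∏ i, b i ^ k i} := by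
  rw [Afam, Subring.mem_closure_iff] at hM
  refine AddSubgroup.closure_mono ?_ hM
  intro x hx
  induction hx using Submonoid.closure_induction with
  | mem x hx =>
    rcases hx with ⟨a, rfl⟩ | ⟨i, rfl⟩
    · exact ⟨a, 0, by simp, by simp⟩
    · refine ⟨1, Pi.single i (p ^ (t + 1 - m i)), ?_, ?_⟩
      · intro j
        by_cases h : j = i
        · subst h; simp
        · simp [Pi.single_eq_of_ne h]
      · rw [Finset.prod_eq_single i]
        · simp
        · intro j _ h; simp [Pi.single_eq_of_ne h]
        · simp
  | one => exact ⟨1, 0, by simp, by simp⟩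
  | mul x y _ _ hx hy =>
    obtain ⟨a, k, hk, rfl⟩ := hx
    obtain ⟨a', k', hk', rfl⟩ := hy
    refine ⟨a * a', k + k', fun i => dvd_add (hk i) (hk' i), ?_⟩
    simp only [Pi.add_apply, pow_add, Finset.prod_mul_distrib, mul_pow]
    ring

theorem Afam_frob (hp : p.Prime) [CharP F p] (t : ℕ) (ht : ∀ i, m i ≤ t + 1) (M : F)
    (hM : M ∈ Afam p b m (t + 1)) : ∃ N ∈ Afam p b m t, N ^ p = M := by
  have := Fact.mk hp
  have h : Afam p b m (t + 1) ≤ (Afam p b m t).map (frobenius F p) := by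
    refine Afam_le b m (fun a => ⟨a ^ p ^ (t + 1), Afam_pow_mem b m t a, ?_⟩)
      fun i => ⟨b i ^ p ^ (t + 1 - m i), Afam_b_mem b m t i _ le_rfl, ?_⟩
    · rw [frobenius_def, ← pow_mul, ← pow_succ]
    · rw [frobenius_def, ← pow_mul, ← pow_succ]
      have := ht i
      congr 2; omega
  obtain ⟨N, hN, h1⟩ := h hM
  exact ⟨N, hN, by rw [← h1, frobenius_def]⟩

theorem KK_le_of_gens (hp : p.Prime) [CharP F p] (S : DiffStr p F) (hb : ∀ i, b i ≠ 0) (hm : ∀ i, 1 ≤ m i)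
    (G : AddSubgroup (DF F)) (h1 : ∀ x, S.sp x - x ∈ G) (h2 : ∀ x, S.d x ∈ G) (h3 : ∀ i x, b i • S.d x ∈ G)
    (h4 : ∀ (t : ℕ) (k : Fin r → ℕ), 0 < t → t < Finset.univ.sup m →
      (∀ i, k i < p ^ t ∧ p ^ (t + 1 - m i) ∣ k i) → ∀ v, (∏ i, b i ^ k i) • spIter S t (S.d v) ∈ G) :
    S.KK (Afam p b m) ≤ G := by
  have hr : S.d.range ≤ G := by rintro _ ⟨x, rfl⟩; exact h2 x
  have hL : ∀ i x, dLog F (b i) * x ∈ G := by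
    intro i x
    have h0 := hb i
    have h5 : dForm F (b i)⁻¹ = (-((b i)⁻¹ ^ 2)) • dForm F (b i) := by
      simp only [dForm]; rw [Derivation.leibniz_inv]; simp
    have h6 : b i • S.d ((b i)⁻¹ • x) = - (dLog F (b i) * x) + S.d x := by
      rw [S.d_smul, smul_add, smul_smul, mul_inv_cancel₀ h0, one_smul, h5, dLog_eq, smul_mul_assoc, smul_smul,
        smul_mul_assoc, ← neg_smul]
      congr 2
      field_simp
    have h7 := h3 i ((b i)⁻¹ • x)
    rw [h6] at h7
    have := sub_mem (h2 x) h7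
    convert this using 1; abel
  have hDL : DL (Set.range b) ≤ G := by
    rw [DL, AddSubgroup.closure_le]
    rintro _ ⟨_, ⟨i, rfl⟩, x, rfl⟩
    exact hL i x
  have hanti : Antitone (Afam p b m) := antitone_nat_of_succ_le (Afam_anti b m)
  refine S.KK_le _ h1 h2 ?_
  intro t
  induction t using Nat.strong_induction_on with
  | _ t ih =>
  intro M hM v
  rcases Nat.eq_zero_or_pos t with rfl | ht
  · have : M • spIter S 0 (S.d v) = S.d (M • v) - dForm F M * v := by
      rw [S.d_smul]; simp [spIter]
    rw [this]
    exact sub_mem (h2 _) (hDL (Afam_zero_DL b m hm M hM v))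
  by_cases hlt : t < Finset.univ.sup m
  · have hEx : ∀ B ∈ Afam p b m t, ∀ e ∈ S.Ex t, B • e ∈ G := by
      intro B hB e he
      induction he using AddSubgroup.closure_induction with
      | mem y h =>
        obtain ⟨s, hs, η, rfl⟩ := h
        exact ih s hs B (hanti hs.le hB) η
      | zero => rw [smul_zero]; exact zero_mem _
      | add x y _ _ hx hy => rw [smul_add]; exact add_mem hx hy
      | neg x _ hx => rw [smul_neg]; exact neg_mem hx
    have hLam : ∀ B ∈ Afam p b m t, ∀ l ∈ DL (Set.range b), B • spIter S t l ∈ G := by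
      intro B hB l hl
      change B • spIterHom S t l ∈ G
      induction hl using AddSubgroup.closure_induction with
      | mem y h =>
        obtain ⟨_, ⟨i, rfl⟩, x, rfl⟩ := h
        have h5 := hEx B hB _ (spIter_dLog_Ex S t (b i) x)
        rw [smul_sub, ← mul_smul_comm] at h5
        have h6 := add_mem h5 (hL i (B • spIter S t x))
        rw [sub_add_cancel] at h6
        exact h6
      | zero => rw [map_zero, smul_zero]; exact zero_mem _
      | add x y _ _ hx hy => rw [map_add, smul_add]; exact add_mem hx hy
      | neg x _ hx => rw [map_neg, smul_neg]; exact neg_mem hx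
    have hM' := Afam_mono_form b m t M hM
    clear hM
    induction hM' using AddSubgroup.closure_induction with
    | mem y h =>
      obtain ⟨a, k, hk, rfl⟩ := h
      have hpt : 0 < p ^ t := pow_pos hp.pos t
      have hdvd : ∀ i, p ^ (t + 1 - m i) ∣ p ^ t := fun i => pow_dvd_pow p (by have := hm i; omega)
      have hk' : ∀ i, k i % p ^ t < p ^ t ∧ p ^ (t + 1 - m i) ∣ k i % p ^ t := fun i =>
        ⟨Nat.mod_lt _ hpt, (Nat.dvd_mod_iff (hdvd i)).2 (hk i)⟩
      set B := ∏ i, b i ^ (k i % p ^ t) with hBdef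
      set c := a ^ p * ∏ i, b i ^ (k i / p ^ t) with hcdef
      have hM : a ^ p ^ (t + 1) * ∏ i, b i ^ k i = B * c ^ p ^ t := by
        rw [hBdef, hcdef, mul_pow, ← pow_mul, ← pow_succ', ← Finset.prod_pow, mul_left_comm,
          ← Finset.prod_mul_distrib]
        congr 1
        refine Finset.prod_congr rfl fun i _ => ?_
        rw [← pow_mul, ← pow_add, Nat.mod_add_div']
      have hBA : B ∈ Afam p b m t := by
        refine prod_mem fun i _ => ?_
        obtain ⟨l, hl⟩ := (hk' i).2
        rw [hl, pow_mul]
        exact pow_mem (Afam_b_mem b m t i _ le_rfl) _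
      have hcA : c ∈ Afam p b m 0 := by
        refine mul_mem (by simpa using Afam_pow_mem (p := p) b m 0 a) (prod_mem fun i _ => pow_mem ?_ _)
        have := Afam_b_mem (p := p) b m 0 i 0 (by have := hm i; omega)
        simpa using this
      have h5 := hEx B hBA _ (spIter_smul_Ex S t c (S.d v))
      have h6 : c • S.d v = S.d (c • v) - dForm F c * v := by rw [S.d_smul]; abel
      have h7 : B • spIter S t (c • S.d v) ∈ G := by
        rw [h6]
        change B • spIterHom S t _ ∈ G
        rw [map_sub, smul_sub]
        exact sub_mem (h4 t _ ht hlt hk' _) (hLam B hBA _ (Afam_zero_DL b m hm c hcA v))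
      have h8 := sub_mem h7 h5
      rw [smul_sub, sub_sub_cancel, smul_smul, ← hM] at h8
      exact h8
    | zero => rw [zero_smul]; exact zero_mem _
    | add x y _ _ hx hy => rw [add_smul]; exact add_mem hx hy
    | neg x _ hx => rw [neg_smul]; exact neg_mem hx
  · obtain ⟨s, rfl⟩ : ∃ s, t = s + 1 := ⟨t - 1, by omega⟩
    obtain ⟨N, hN, rfl⟩ := Afam_frob b m hp s (fun i => (Finset.le_sup (Finset.mem_univ i)).trans
      (not_lt.1 hlt)) M hM
    have h5 := ih s (by omega) N hN v
    have h6 := add_mem (h1 (N • spIter S s (S.d v))) h5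
    rw [sub_add_cancel] at h6
    have h7 := sub_mem h6 (hr (S.sp_smul N (spIter S s (S.d v))))
    rw [sub_sub_cancel] at h7
    rw [S.spIter_succ]
    exact h7

end Fin20
end Part20

section Part21
set_option linter.all false
open Finset

noncomputable section Fin21
variable {p : ℕ} {F : Type*} [Field F]

theorem logForm_mem' {n : ℕ} (x : Fin n → F) : logForm F x ∈ omegaPow F n := by
  induction n with
  | zero => simp [logForm, omegaPow]
  | succ n ih =>
    rw [PB.logForm_cons, omegaPow, pow_succ']
    exact Submodule.mul_mem_mul ⟨_, rfl⟩ (ih _)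

theorem exists_pr (F : Type*) [Field F] : ∃ pr : (ℕ → Prop) → DF F →ₗ[F] DF F, ∀ q k, ∀ x ∈ omegaPow F k,
    (q k → pr q x = x) ∧ (¬ q k → pr q x = 0) := by
  classical
  obtain ⟨t, ⟨P⟩⟩ := exists_PB_any F
  letI : LinearOrder t := linearOrderOfSTO WellOrderingRel
  have hfs : ∀ (q : ℕ → Prop) (x : DF F), FS (fun σ => if q #σ then P.Phi x σ else 0) := by
    intro q x
    refine (P.Phi_FS x).subset fun σ hσ h0 => hσ ?_
    change (if q #σ then P.Phi x σ else 0) = 0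
    have : P.Phi x σ = 0 := h0
    rw [this, ite_self]
  refine ⟨fun q => { toFun := fun x => P.inv _ (hfs q x), map_add' := ?_, map_smul' := ?_ }, ?_⟩
  · intro x y
    apply P.Phi_injective
    refine (P.Phi_inv _ _).trans ?_
    rw [P.Phi.map_add, P.Phi.map_add, P.Phi_inv, P.Phi_inv]
    funext σ
    simp only [map_add, Pi.add_apply]
    split_ifs <;> simp
  · intro a x
    apply P.Phi_injective
    refine (P.Phi_inv _ _).trans ?_
    rw [P.Phi.map_smul, P.Phi.map_smul, P.Phi_inv]
    funext σ
    simp only [map_smul, Pi.smul_apply]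
    split_ifs <;> simp
  · intro q k x hx
    rw [P.mem_omegaPow_iff] at hx
    constructor
    · intro hq
      apply P.Phi_injective
      change P.Phi (P.inv _ (hfs q x)) = _
      rw [P.Phi_inv]
      funext σ
      by_cases h : P.Phi x σ = 0
      · simp [h]
      · simp [hx σ h, hq]
    · intro hq
      apply P.Phi_injective
      change P.Phi (P.inv _ (hfs q x)) = _
      rw [P.Phi_inv]
      funext σ
      by_cases h : P.Phi x σ = 0
      · simp [h]
      · simp [hx σ h, hq]

/-- projection on homogeneous components -/
def pr (q : ℕ → Prop) : DF F →ₗ[F] DF F := (exists_pr F).choose q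

theorem pr_pos {q : ℕ → Prop} {k : ℕ} {x : DF F} (hx : x ∈ omegaPow F k) (hq : q k) : pr q x = x :=
  ((exists_pr F).choose_spec q k x hx).1 hq

theorem pr_neg {q : ℕ → Prop} {k : ℕ} {x : DF F} (hx : x ∈ omegaPow F k) (hq : ¬ q k) : pr q x = 0 :=
  ((exists_pr F).choose_spec q k x hx).2 hq

theorem hom_induct {C : DF F → Prop} (add : ∀ x y, C x → C y → C (x + y))
    (hom : ∀ (k : ℕ), ∀ x ∈ omegaPow F k, C x) (x : DF F) : C x :=
  log_induct add (fun n a x => hom n _ ((omegaPow F n).smul_mem a (logForm_mem' x))) x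

theorem pr_mem (n : ℕ) (x : DF F) : pr (· = n) x ∈ omegaPow F n := by
  induction x using hom_induct with
  | add x y hx hy => rw [map_add]; exact add_mem hx hy
  | hom k x hx =>
    by_cases h : k = n
    · rw [pr_pos hx h, ← h]; exact hx
    · rw [pr_neg hx h]; exact zero_mem _

theorem pr_mem' (n : ℕ) (x : DF F) : pr (· + 1 = n) x ∈ omegaPred F n := by
  induction x using hom_induct with
  | add x y hx hy => rw [map_add]; exact add_mem hx hy
  | hom k x hx =>
    by_cases h : k + 1 = n
    · rw [pr_pos hx h, ← h]; exact hx
    · rw [pr_neg hx h]; exact zero_mem _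

theorem pr_sp (S : DiffStr p F) (n : ℕ) (x : DF F) : pr (· = n) (S.sp x) = S.sp (pr (· = n) x) := by
  induction x using hom_induct with
  | add x y hx hy => simp only [map_add, hx, hy]
  | hom k x hx =>
    by_cases h : k = n
    · rw [pr_pos hx h, pr_pos (S.sp_grade k x hx) h]
    · rw [pr_neg hx h, pr_neg (S.sp_grade k x hx) h, map_zero]

theorem pr_d (S : DiffStr p F) (n : ℕ) (x : DF F) : pr (· = n) (S.d x) = S.d (pr (· + 1 = n) x) := by
  induction x using hom_induct with
  | add x y hx hy => simp only [map_add, hx, hy]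
  | hom k x hx =>
    by_cases h : k + 1 = n
    · rw [pr_pos hx h, pr_pos (S.d_grade k x hx) h]
    · rw [pr_neg hx h, pr_neg (S.d_grade k x hx) h, map_zero]

theorem pr_spIter (S : DiffStr p F) (n t : ℕ) (x : DF F) :
    pr (· = n) (spIter S t x) = spIter S t (pr (· = n) x) := by
  induction t with
  | zero => rfl
  | succ t ih => rw [S.spIter_succ, pr_sp, ih, S.spIter_succ]

theorem hRel_sp (S : DiffStr p F) (n : ℕ) (x : DF F) : pr (· = n) (S.sp x - x) ∈ hRel S n := by
  rw [map_sub, pr_sp]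
  exact AddSubgroup.mem_sup_left ⟨_, pr_mem n x, rfl⟩

theorem hRel_d (S : DiffStr p F) (n : ℕ) (x : DF F) : pr (· = n) (S.d x) ∈ hRel S n := by
  rw [pr_d]
  exact AddSubgroup.mem_sup_right ⟨_, pr_mem' n x, rfl⟩

theorem hRel_le_H (S : DiffStr p F) (n : ℕ) : hRel S n ≤ S.H := by
  refine sup_le_sup ?_ ?_
  · rintro _ ⟨x, _, rfl⟩; exact ⟨x, rfl⟩
  · rintro _ ⟨x, _, rfl⟩; exact ⟨x, rfl⟩

theorem hRel_of_H (S : DiffStr p F) (n : ℕ) (x : DF F) (hx : x ∈ omegaPow F n) (h : x ∈ S.H) :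
    x ∈ hRel S n := by
  have h1 : S.H ≤ (hRel S n).comap (pr (· = n)).toAddMonoidHom := by
    refine sup_le ?_ ?_
    · rintro _ ⟨x, rfl⟩; exact hRel_sp S n x
    · rintro _ ⟨x, rfl⟩; exact hRel_d S n x
  have h2 : pr (· = n) x ∈ hRel S n := h1 h
  rwa [pr_pos (q := (· = n)) hx rfl] at h2

variable {r : ℕ} (b : Fin r → F) (m : Fin r → ℕ)

theorem kGroup_of_KK (hp : p.Prime) [CharP F p] (S : DiffStr p F) (hb : ∀ i, b i ≠ 0) (hm : ∀ i, 1 ≤ m i)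
    (n : ℕ) (x : DF F) (hx : x ∈ omegaPow F n) (h : x ∈ S.KK (Afam p b m)) : x ∈ kGroup S b m n := by
  have hle : ∀ y ∈ hRel S n, y ∈ kGroup S b m n := fun y hy => AddSubgroup.subset_closure (Or.inl hy)
  have h1 : S.KK (Afam p b m) ≤ (kGroup S b m n).comap (pr (· = n)).toAddMonoidHom := by
    refine KK_le_of_gens b m hp S hb hm _ (fun x => hle _ (hRel_sp S n x)) (fun x => hle _ (hRel_d S n x)) ?_ ?_
    · intro i x
      change pr (· = n) (b i • S.d x) ∈ kGroup S b m n
      rw [LinearMap.map_smul, pr_d]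
      exact AddSubgroup.subset_closure (Or.inr (Or.inl ⟨i, _, pr_mem' n x, rfl⟩))
    · intro t k ht ht' hk v
      change pr (· = n) _ ∈ kGroup S b m n
      rw [LinearMap.map_smul, pr_spIter, pr_d]
      exact AddSubgroup.subset_closure (Or.inr (Or.inr ⟨t, k, ht, ht', hk, _, pr_mem' n v, rfl⟩))
  have h2 : pr (· = n) x ∈ kGroup S b m n := h1 h
  rwa [pr_pos (q := (· = n)) hx rfl] at h2

theorem kGroup_le_KK (S : DiffStr p F) (hm : ∀ i, 1 ≤ m i) (n : ℕ) : kGroup S b m n ≤ S.KK (Afam p b m) := by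
  rw [kGroup, AddSubgroup.closure_le]
  rintro x (hx | ⟨i, z, _, rfl⟩ | ⟨t, k, _, _, hk, v, _, rfl⟩)
  · exact S.H_le_KK _ (hRel_le_H S n hx)
  · refine S.gen_mem (t := 0) _ ?_ z
    have := Afam_b_mem (p := p) b m 0 i 0 (by have := hm i; omega)
    simpa using this
  · refine S.gen_mem _ (prod_mem fun i _ => ?_) v
    obtain ⟨l, hl⟩ := (hk i).2
    rw [hl, pow_mul]
    exact pow_mem (Afam_b_mem b m t i _ le_rfl) _

end Fin21
end Part21

/-- **Theorem 1.** Let `E = F(b₁^{1/p^{m₁}},…,b_r^{1/p^{m_r}})` be a purely inseparable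
extension with `b₁,…,b_r ∈ F^*` and `m₁,…,m_r ≥ 1`. Then
`H_p^{n+1}(E/F) = K_F((b₁,m₁),…,(b_r,m_r))`: the class of `ω ∈ Ω_F^n` dies in
`H_p^{n+1}(E)` iff `ω` lies in the preimage of `K_F`. -/
theorem hKernel_purely_inseparable
    (p : ℕ) (hp : p.Prime) (F E : Type*) [Field F] [Field E] [Algebra F E]
    [CharP F p] [CharP E p]
    (SF : DiffStr p F) (SE : DiffStr p E) (R : DiffRes p F E SF SE)
    (r : ℕ) (b : Fin r → F) (m : Fin r → ℕ)
    (hb : ∀ i, b i ≠ 0) (hm : ∀ i, 1 ≤ m i)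
    (β : Fin r → E) (hβ : ∀ i, β i ^ p ^ m i = algebraMap F E (b i))
    (hgen : Algebra.adjoin F (Set.range β) = ⊤)
    (n : ℕ) (ω : DF F) (hω : ω ∈ omegaPow F n) :
    R.res ω ∈ hRel SE n ↔ ω ∈ kGroup SF b m n := by
  constructor
  · intro h
    exact kGroup_of_KK b m hp SF hb hm n ω hω
      (main_ind hp E SE _ F SF R b m β hβ hgen rfl ω (hRel_le_H SE n h))
  · intro h
    exact hRel_of_H SE n _ (R.res_grade n ω hω)
      (KK_res hp R b m β hβ ω (kGroup_le_KK b m SF hm n h))
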